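/- Let k ≥ 2 and n ∈ ℕ with 2n ≥ k² + 3, and let δ_0 ∈ (0,1) be as in the generic counting theorem. For every δ ∈ (δ_0, 1) and every collection of bounded intervals (a_{ij}, b_{ij}) ⊆ ℝ (1 ≤ i < j ≤ k), for Haar-almost every g ∈ SL_{2n}(ℝ) the following holds: there exist a constant c_g > 0 depending only on g, n and k (the same constant as in the non-primitive generic counting theorem) and constants C, T_0 > 0 such that for all T > T_0, |N̂_{g,I}(T) − (c_g/ζ(2n)^k) · ∏_{1≤i<j≤k}(b_{ij} − a_{ij}) · T^{2nk − k(k−1)}| ≤ C · T^{δ(2nk − k(k−1))}, where ζ is the Riemann zeta function and N̂_{g,I}(T) = #{(v_1, …, v_k) ∈ P(ℤ^{2n})^k : ⟨v_i, v_j⟩^g ∈ (a_{ij}, b_{ij}) for all 1 ≤ i < j ≤ k, and ‖v_ℓ‖ < T for all 1 ≤ ℓ ≤ k}. -/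

import Mathlib

open Matrix MeasureTheory

noncomputable section

abbrev Pairs (k : ℕ) := {p : Fin k × Fin k // p.1 < p.2}

/-- The standard symplectic matrix `J_n` with block form `(0 Iₙ; -Iₙ 0)`. -/
def Jmat (n : ℕ) : Matrix (Fin (2*n)) (Fin (2*n)) ℝ :=
  fun i j => if (i : ℕ) + n = (j : ℕ) then 1 else if (j : ℕ) + n = (i : ℕ) then -1 else 0

/-- The standard symplectic form `⟨v,w⟩ = vᵀ Jₙ w` on `ℝ^{2n}`. -/
def symp (n : ℕ) (v w : Fin (2*n) → ℝ) : ℝ := v ⬝ᵥ (Jmat n).mulVec w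

abbrev SL2n (n : ℕ) := Matrix.SpecialLinearGroup (Fin (2*n)) ℝ

/-- The symplectic form `⟨v,w⟩^g = ⟨g v, g w⟩` attached to `g ∈ SL_{2n}(ℝ)`. -/
def sympG (n : ℕ) (g : SL2n n) (v w : Fin (2*n) → ℝ) : ℝ :=
  symp n ((g : Matrix (Fin (2*n)) (Fin (2*n)) ℝ).mulVec v)
         ((g : Matrix (Fin (2*n)) (Fin (2*n)) ℝ).mulVec w)

/-- Euclidean norm on `ℝ^d` (presented as `Fin d → ℝ`). -/
def enorm2 {d : ℕ} (v : Fin d → ℝ) : ℝ := Real.sqrt (∑ i, (v i)^2)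

instance (m : ℕ) : MeasurableSpace (Matrix (Fin m) (Fin m) ℝ) := MeasurableSpace.pi

noncomputable instance (m : ℕ) : TopologicalSpace (Matrix.SpecialLinearGroup (Fin m) ℝ) :=
  instTopologicalSpaceSubtype

instance (m : ℕ) : MeasurableSpace (Matrix.SpecialLinearGroup (Fin m) ℝ) :=
  Subtype.instMeasurableSpace

/-- The exponent `2nk - k(k-1)` as a real number. -/
def expo (n k : ℕ) : ℝ := ((2*n*k : ℕ) : ℝ) - ((k*(k-1) : ℕ) : ℝ)

/-- The counting function `N_{g,I}(T)`: the number of integer tuples `(v_1,…,v_k)`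
with `⟨v_i,v_j⟩^g ∈ (a_{ij},b_{ij})` for `i < j` and `‖v_ℓ‖ < T`. -/
def Ncount (n k : ℕ) (g : SL2n n) (a b : Pairs k → ℝ) (T : ℝ) : ℕ :=
  Nat.card {v : Fin k → (Fin (2*n) → ℤ) |
    (∀ p : Pairs k, sympG n g (fun j => ((v p.1.1 j : ℤ) : ℝ))
        (fun j => ((v p.1.2 j : ℤ) : ℝ)) ∈ Set.Ioo (a p) (b p)) ∧
    ∀ l, enorm2 (fun j => ((v l j : ℤ) : ℝ)) < T}

/-- A primitive integer vector: nonzero with coprime coordinates. -/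
def IsPrimitiveVec {d : ℕ} (v : Fin d → ℤ) : Prop := v ≠ 0 ∧ Finset.univ.gcd v = 1

/-- The value `ζ(s)` of the Riemann zeta function at a natural number `s`. -/
def zetaval (s : ℕ) : ℝ := ∑' m : ℕ, (1:ℝ) / ((m+1 : ℝ) ^ s)

/-- The primitive counting function `N̂_{g,I}(T)`: the number of primitive integer tuples
`(v_1,…,v_k)` with `⟨v_i,v_j⟩^g ∈ (a_{ij},b_{ij})` for `i < j` and `‖v_ℓ‖ < T`. -/
def NcountPrim (n k : ℕ) (g : SL2n n) (a b : Pairs k → ℝ) (T : ℝ) : ℕ :=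
  Nat.card {v : Fin k → (Fin (2*n) → ℤ) |
    (∀ l, IsPrimitiveVec (v l)) ∧
    (∀ p : Pairs k, sympG n g (fun j => ((v p.1.1 j : ℤ) : ℝ))
        (fun j => ((v p.1.2 j : ℤ) : ℝ)) ∈ Set.Ioo (a p) (b p)) ∧
    ∀ l, enorm2 (fun j => ((v l j : ℤ) : ℝ)) < T}

open scoped FourierTransform

notation:max "Mm" d:max => Matrix (Fin d) (Fin d) ℝ
notation:max "Vv" d:max => Fin d → ℝ
notation:max "oR" => ENNReal.ofReal
notation:max "eF" => Filter.Eventually.of_forall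
notation:max "mL" => mul_le_mul_of_nonneg_left
notation:max "mR" => mul_le_mul_of_nonneg_right
notation:max "nA" => Real.norm_eq_abs
notation:max "oL" => ENNReal.ofReal_le_ofReal
notation:max "oM" => ENNReal.ofReal_mul

notation:max "sG" => Matrix.SpecialLinearGroup
notation:max "pN" => pi_norm_le_iff_of_nonneg
notation:max "rN" => Real.norm_of_nonneg
notation:max "fC" => Fintype.card
notation:max "iL" => inv_le_one_of_one_le₀
notation:max "iM" => Set.indicator_of_mem
notation:max "pI" => norm_le_pi_norm
notation:max "aP" => abs_of_pos
notation:max "pL" => pow_le_pow_left₀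
notation:max "oP" => one_le_pow₀
notation:max "mb" => ArithmeticFunction.moebius
notation:max "iN" => Set.indicator_of_notMem
notation:max "uN" => Function.update_of_ne
notation:max "cM" => Continuous.aestronglyMeasurable
notation:max "cN" => Complex.norm_real
notation:max "dI" => div_eq_mul_inv
notation:max "mV" => Matrix.mulVec_mulVec
notation:max "fF" => Fintype.card_fin
notation:max "lD" => le_div_iff₀
notation:max "sL" => Finset.sum_le_sum
notation:max "oO" => ENNReal.ofReal_one
notation:max "pD" => Finset.prod_mul_distrib
notation:max "sI" => norm_setIntegral_le_of_norm_le_const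
notation:max "mO" => mul_le_of_le_one_right
notation:max "sC" => Finset.sum_congr
notation:max "sS" => Finset.single_le_sum
notation:max "pz" => (by positivity)

variable {d n k : ℕ} {ε T : ℝ}


def ee (t : ℝ) : ℂ := Complex.exp ((2 * Real.pi * t : ℝ) * Complex.I)

lemma ee_norm (t : ℝ) : ‖ee t‖ = 1 := by
  unfold ee; exact Complex.norm_exp_ofReal_mul_I _

lemma ee_add (s t : ℝ) : ee (s + t) = ee s * ee t := by
  unfold ee; rw [← Complex.exp_add]; congr 1; push_cast; ring

lemma ee_zero : ee 0 = 1 := by simp [ee]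

@[fun_prop]
lemma ee_cont : Continuous ee := by unfold ee; fun_prop

lemma ee_sum {ι : Type*} (s : Finset ι) (f : ι → ℝ) : ee (∑ i ∈ s, f i) = ∏ i ∈ s, ee (f i) := by
  classical
  induction s using Finset.induction_on with
  | empty => simp [ee_zero]
  | insert a s ha ih => rw [Finset.sum_insert ha, Finset.prod_insert ha, ee_add, ih]

lemma ee_int (n : ℤ) : ee n = 1 := by
  unfold ee
  rw [Complex.exp_eq_one_iff]
  exact ⟨n, by push_cast; ring⟩

lemma ee_sub_one (t : ℝ) : ‖ee t - 1‖ ≤ 2 * Real.pi * |t| := by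
  unfold ee
  have := Real.norm_exp_I_mul_ofReal_sub_one_le (x := 2 * Real.pi * t)
  rw [mul_comm Complex.I] at this
  refine this.trans (le_of_eq ?_)
  rw [nA, abs_mul, aP (by positivity : 0 < 2 * Real.pi)]

def chiB : ContDiffBump (0:ℝ) := ⟨1/2, 1, by norm_num, by norm_num⟩
def chi : ℝ → ℝ := chiB.normed volume

lemma chi_nonneg (x : ℝ) : 0 ≤ chi x := chiB.nonneg_normed x
lemma chi_integral : ∫ x, chi x = 1 := chiB.integral_normed
lemma chi_supp {x : ℝ} (h : 1 ≤ |x|) : chi x = 0 := by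
  by_contra hne
  have : x ∈ Function.support chi := hne
  unfold chi at this
  rw [chiB.support_normed_eq] at this
  simp [chiB, Metric.mem_ball] at this
  linarith
lemma chi_smooth : ContDiff ℝ ((⊤ : ℕ∞) : WithTop ℕ∞) chi := chiB.contDiff_normed
@[fun_prop]
lemma chi_cont : Continuous chi := chi_smooth.continuous
lemma chi_compact : HasCompactSupport chi := chiB.hasCompactSupport_normed
lemma chi_integrable : Integrable chi := chi_cont.integrable_of_hasCompactSupport chi_compact

def chiS : SchwartzMap ℝ ℂ :=
  HasCompactSupport.toSchwartzMap (f := fun x => (chi x : ℂ))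
    (chi_compact.comp_left (g := fun x : ℝ => (x : ℂ)) (by simp)) (Complex.ofRealCLM.contDiff.comp chi_smooth)

lemma chiS_apply (x : ℝ) : chiS x = chi x := rfl

def chihat (t : ℝ) : ℂ := ∫ s, ee (-(t * s)) * chi s

lemma chihat_eq (t : ℝ) : chihat t = 𝓕 chiS t := by
  have : 𝓕 chiS t = 𝓕 (chiS : ℝ → ℂ) t := by rw [SchwartzMap.fourier_coe]
  rw [this, Real.fourier_eq']
  unfold chihat ee
  congr 1
  ext s
  rw [chiS_apply, smul_eq_mul]
  simp only [RCLike.inner_apply, conj_trivial]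
  congr 3
  push_cast; ring

@[fun_prop]
lemma chihat_cont : Continuous chihat := by
  have : chihat = fun t => 𝓕 chiS t := by ext t; exact chihat_eq t
  rw [this]; exact (𝓕 chiS).continuous

lemma chihat_decay (N : ℕ) : ∃ C : ℝ, 1 ≤ C ∧ ∀ t, ‖chihat t‖ ≤ C * ((1 + |t|) ^ N)⁻¹ := by
  have h := (𝓕 chiS).one_add_le_sup_seminorm_apply (𝕜 := ℝ) (m := (N, 0)) (k := N) (n := 0) le_rfl le_rfl
  refine ⟨max 1 (2 ^ N * (((Finset.Iic (N, 0)).sup fun m => SchwartzMap.seminorm ℝ m.1 m.2) (𝓕 chiS))), le_max_left _ _, fun t => ?_⟩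
  have h2 := h t
  rw [norm_iteratedFDeriv_zero, nA, ← chihat_eq] at h2
  rw [← dI, lD pz, mul_comm]
  exact h2.trans (le_max_right _ _)

lemma chihat_integrable : Integrable chihat := by
  have : chihat = fun t => 𝓕 chiS t := by ext t; exact chihat_eq t
  rw [this]; exact (𝓕 chiS).integrable

lemma chihat_zero : chihat 0 = 1 := by
  unfold chihat
  simp only [zero_mul, neg_zero, ee_zero, one_mul]
  rw [integral_complex_ofReal, chi_integral]; simp

lemma chi_inversion (s : ℝ) : (chi s : ℂ) = ∫ t, chihat t * ee (t * s) := by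
  have h : 𝓕⁻ (𝓕 chiS) = chiS := by simp
  have h2 : (𝓕⁻ (𝓕 chiS)) s = (chi s : ℂ) := by rw [h, chiS_apply]
  rw [← h2, SchwartzMap.fourierInv_coe, Real.fourierInv_eq']
  congr 1
  ext t
  rw [chihat_eq, smul_eq_mul, mul_comm]
  unfold ee
  simp only [RCLike.inner_apply, conj_trivial]
  congr 3
  push_cast; ring

lemma summ_int (ρ u : ℝ) (hρ : 0 < ρ) : Summable (fun q : ℤ => ‖chihat (ρ * (q - u))‖) := by
  obtain ⟨C, hC, h⟩ := chihat_decay 2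
  have h1 : Summable (fun q : ℤ => C * ρ⁻¹ ^ 2 * |((q:ℝ) - u) ^ 2|⁻¹) := by
    apply Summable.mul_left
    have := Real.summable_abs_int_rpow (b := 2) (by norm_num)
    have h3 := EisensteinSeries.linear_right_summable (-u : ℂ) 1 (k := 2) (by norm_num)
    have h4 := h3.norm
    refine h4.congr fun q => ?_
    simp only [Int.cast_one, one_mul]
    rw [norm_inv, abs_pow, norm_zpow]
    congr 1
    have : (-(u:ℂ) + q) = ((q - u : ℝ) : ℂ) := by push_cast; ring
    rw [this, cN, nA]; norm_cast
  refine Summable.of_norm_bounded_eventually (g := fun q : ℤ => C * ρ⁻¹ ^ 2 * |((q:ℝ) - u) ^ 2|⁻¹) h1 ?_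
  have hf : {q : ℤ | (q : ℝ) = u}.Finite := by
    apply Set.Subsingleton.finite
    intro a ha b hb
    have : (a : ℝ) = b := by rw [ha, hb]
    exact_mod_cast this
  filter_upwards [hf.compl_mem_cofinite] with q hq
  rw [norm_norm]
  refine (h _).trans ?_
  rw [mul_assoc]
  gcongr
  have hne : (q:ℝ) - u ≠ 0 := sub_ne_zero.mpr hq
  rw [inv_pow, ← mul_inv, abs_pow, ← mul_pow]
  apply inv_anti₀
  · have := abs_pos.mpr hne; positivity
  · gcongr
    rw [abs_mul, aP hρ]; linarith

lemma poisson1 (ρ z u : ℝ) (hρ : 0 < ρ) :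
    ∑' v : ℤ, (chi (v / ρ - z) : ℂ) * ee (v * u) = ∑' q : ℤ, ρ * chihat (ρ * (q - u)) * ee (ρ * z * (u - q)) := by
  set f : ℝ → ℂ := fun v => (chi (v / ρ - z) : ℂ) * ee (v * u) with hf
  have hF : ∀ q : ℝ, 𝓕 f q = ρ * chihat (ρ * (q - u)) * ee (ρ * z * (u - q)) := by
    intro q
    rw [Real.fourier_eq']
    have h1 : ∀ v : ℝ, Complex.exp (((-2 * Real.pi * inner ℝ v q : ℝ)) * Complex.I) • f v =
        (fun s => ee (ρ * z * (u - q)) * (ee (-(ρ * (q - u) * s)) * chi s)) (v / ρ - z) := by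
      intro v
      have : Complex.exp (((-2 * Real.pi * inner ℝ v q : ℝ)) * Complex.I) = ee (-(v * q)) := by
        unfold ee; congr 2; simp; ring
      rw [this, smul_eq_mul, hf]
      simp only
      rw [mul_comm (chi _ : ℂ), ← mul_assoc, ← mul_assoc, ← ee_add, ← ee_add]
      congr 2
      field_simp
      ring
    simp_rw [h1]
    have h2 := integral_sub_right_eq_self (μ := volume) (fun s => ee (ρ * z * (u - q)) * (ee (-(ρ * (q - u) * s)) * chi s)) z
    have h3 := Measure.integral_comp_div (fun t => (fun s => ee (ρ * z * (u - q)) * (ee (-(ρ * (q - u) * s)) * chi s)) (t - z)) ρ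
    simp only [] at h3 h2 ⊢
    rw [h3, h2, integral_const_mul, aP hρ, Complex.real_smul]
    unfold chihat
    ring
  have hc : Continuous f := by fun_prop
  have hO : Asymptotics.IsBigO (Filter.cocompact ℝ) f (fun x : ℝ => |x| ^ (-2:ℝ)) := by
    have hz : f =ᶠ[Filter.cocompact ℝ] 0 := by
      rw [← Filter.coclosedCompact_eq_cocompact, ← hasCompactSupport_iff_eventuallyEq]
      apply HasCompactSupport.mul_right
      have : HasCompactSupport (fun v : ℝ => chi (v / ρ - z)) := by
        refine HasCompactSupport.intro (K := Metric.closedBall (ρ * z) ρ) (isCompact_closedBall _ _) ?_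
        intro v hv
        apply chi_supp
        rw [Metric.mem_closedBall, Real.dist_eq, not_le] at hv
        have : v / ρ - z = (v - ρ * z) / ρ := by field_simp
        rw [this, abs_div, aP hρ, lD hρ]; linarith
      exact this.comp_left (g := fun x : ℝ => (x : ℂ)) (by simp)
    exact (Asymptotics.isBigO_zero _ _).congr' hz.symm (Filter.EventuallyEq.refl _ _)
  have hS : Summable fun n : ℤ => 𝓕 f n := by
    apply Summable.of_norm
    have := (summ_int ρ u hρ).mul_left ρ
    refine this.congr fun q => ?_
    rw [hF, norm_mul, norm_mul, ee_norm, cN, nA, aP hρ, mul_one]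
  have := Real.tsum_eq_tsum_fourier_of_rpow_decay_of_summable hc (b := 2) (by norm_num) hO hS 0
  simp only [zero_add] at this
  rw [hf] at this
  simp only at this
  rw [this]
  refine tsum_congr fun q => ?_
  rw [← hf, hF]
  simp

lemma enorm2_eq (v : Vv d) : enorm2 v = ‖(WithLp.toLp 2 v : EuclideanSpace ℝ (Fin d))‖ := by
  rw [EuclideanSpace.norm_eq]; unfold enorm2; simp

lemma enorm2_add (v w : Vv d) : enorm2 (v + w) ≤ enorm2 v + enorm2 w := by
  simp only [enorm2_eq, WithLp.toLp_add]; exact norm_add_le _ _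

lemma enorm2_smul (c : ℝ) (v : Vv d) : enorm2 (c • v) = |c| * enorm2 v := by
  simp only [enorm2_eq, WithLp.toLp_smul, norm_smul, nA]

lemma enorm2_nonneg (v : Vv d) : 0 ≤ enorm2 v := Real.sqrt_nonneg _

@[fun_prop]
lemma enorm2_cont : Continuous (enorm2 : (Vv d) → ℝ) := by unfold enorm2; fun_prop

lemma norm_le_enorm2 (v : Vv d) : ‖v‖ ≤ enorm2 v := by
  rw [pN (enorm2_nonneg v)]
  intro i
  rw [nA, ← Real.sqrt_sq_eq_abs]
  exact Real.sqrt_le_sqrt (Finset.single_le_sum (f := fun i => (v i)^2) (fun i _ => sq_nonneg _) (Finset.mem_univ i))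

lemma enorm2_le (v : Vv d) : enorm2 v ≤ d * ‖v‖ := by
  unfold enorm2
  rw [Real.sqrt_le_left pz]
  have h : ∀ i ∈ Finset.univ, (v i)^2 ≤ ‖v‖^2 := fun i _ => by
    rw [← sq_abs]; gcongr; exact pI v i
  refine (sL h).trans ?_
  rw [Finset.sum_const, Finset.card_univ, fF, nsmul_eq_mul, mul_pow]
  gcongr
  rcases Nat.eq_zero_or_pos d with h0 | h0
  · subst h0; simp
  · have : (1:ℝ) ≤ d := by exact_mod_cast h0
    nlinarith

lemma hasSum_prod_pi (f : Fin d → ℤ → ℂ) (hf : ∀ i, Summable fun v => ‖f i v‖) :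
    Summable (fun v : Fin d → ℤ => ∏ i, ‖f i (v i)‖) ∧
    HasSum (fun v : Fin d → ℤ => ∏ i, f i (v i)) (∏ i, ∑' v, f i v) := by
  induction d with
  | zero =>
    simp only [Finset.univ_eq_empty, Finset.prod_empty]
    refine ⟨(hasSum_fintype _).summable, ?_⟩
    convert hasSum_fintype (fun v : Fin 0 → ℤ => (1:ℂ)) using 1
    simp
  | succ d ih =>
    obtain ⟨h1, h2⟩ := ih (fun i => f i.succ) (fun i => hf i.succ)
    have hs : Summable (fun p : ℤ × (Fin d → ℤ) => ‖f 0 p.1‖ * ∏ i, ‖f (Fin.succ i) (p.2 i)‖) :=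
      Summable.mul_of_nonneg (f := fun v : ℤ => ‖f 0 v‖) (g := fun p : Fin d → ℤ => ∏ i, ‖f (Fin.succ i) (p i)‖) (hf 0) h1
        (fun _ => norm_nonneg _) (fun _ => Finset.prod_nonneg fun _ _ => norm_nonneg _)
    constructor
    · rw [← (Fin.consEquiv (fun _ : Fin (d+1) => ℤ)).summable_iff]
      refine hs.congr fun p => ?_
      simp [Fin.consEquiv, Fin.prod_univ_succ]
    · rw [← (Fin.consEquiv (fun _ : Fin (d+1) => ℤ)).hasSum_iff]
      have h3 := (hf 0).of_norm.hasSum.mul h2 (by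
        refine Summable.of_norm ?_
        refine hs.congr fun p => ?_
        simp)
      rw [Fin.prod_univ_succ]
      have hc : (fun v : Fin (d+1) → ℤ => ∏ i, f i (v i)) ∘ (Fin.consEquiv (fun _ : Fin (d+1) => ℤ)) =
          fun x : ℤ × (Fin d → ℤ) => f 0 x.1 * ∏ i, f (Fin.succ i) (x.2 i) := by
        ext p
        simp [Fin.consEquiv, Fin.prod_univ_succ]
      rw [hc]
      exact h3

def decC (d : ℕ) : ℝ := (chihat_decay (2*d)).choose
lemma decC_one (d : ℕ) : 1 ≤ decC d := (chihat_decay (2*d)).choose_spec.1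
lemma decC_spec (d : ℕ) (t : ℝ) : ‖chihat t‖ ≤ decC d * ((1 + |t|) ^ (2*d))⁻¹ :=
  (chihat_decay (2*d)).choose_spec.2 t

lemma prod_chihat (x : Vv d) : ∏ i, ‖chihat (x i)‖ ≤ decC d ^ d * ((1 + ‖x‖) ^ (2*d))⁻¹ := by
  have h0 := decC_one d
  rcases Nat.eq_zero_or_pos d with hd | hd
  · subst hd; simp
  · have : Nonempty (Fin d) := ⟨⟨0, hd⟩⟩
    obtain ⟨j, hj⟩ := Finite.exists_max (fun i => ‖x i‖)
    have hx : ‖x‖ = |x j| := by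
      apply le_antisymm
      · rw [pN (abs_nonneg _)]; exact hj
      · exact pI x j
    rw [← Finset.mul_prod_erase _ _ (Finset.mem_univ j), hx]
    have h1 : ∏ i ∈ Finset.univ.erase j, ‖chihat (x i)‖ ≤ ∏ i ∈ Finset.univ.erase j, decC d := by
      apply Finset.prod_le_prod (fun _ _ => norm_nonneg _)
      intro i _
      refine (decC_spec d _).trans ?_
      apply mO (by linarith)
      apply iL
      apply oP
      linarith [abs_nonneg (x i)]
    rw [Finset.prod_const, Finset.card_erase_of_mem (Finset.mem_univ j), Finset.card_univ, fF] at h1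
    calc _ ≤ (decC d * ((1 + |x j|) ^ (2*d))⁻¹) * decC d ^ (d-1) := by
          apply mul_le_mul (decC_spec d _) h1 (Finset.prod_nonneg fun _ _ => norm_nonneg _)
          positivity
      _ = decC d ^ (d-1+1) * ((1 + |x j|) ^ (2*d))⁻¹ := by ring
      _ = _ := by rw [Nat.sub_add_cancel hd]

def ker (d : ℕ) (t : ℝ) : ℝ := ((1 + t) ^ (2*d))⁻¹

lemma chi_scaled_integral (ρ z u : ℝ) (hρ : 0 < ρ) :
    ∫ v, (chi (v / ρ - z) : ℂ) * ee (v * u) = ρ * chihat (-(ρ * u)) * ee (ρ * z * u) := by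
  have h1 : ∀ v : ℝ, (chi (v / ρ - z) : ℂ) * ee (v * u) =
      (fun s => ee (ρ * z * u) * (ee (-(-(ρ * u) * s)) * chi s)) (v / ρ - z) := by
    intro v
    simp only
    rw [mul_comm (chi _ : ℂ), ← mul_assoc, ← ee_add]
    congr 2
    field_simp
    ring
  simp_rw [h1]
  have h2 := integral_sub_right_eq_self (μ := volume) (fun s => ee (ρ * z * u) * (ee (-(-(ρ * u) * s)) * chi s)) z
  have h3 := Measure.integral_comp_div (fun t => (fun s => ee (ρ * z * u) * (ee (-(-(ρ * u) * s)) * chi s)) (t - z)) ρ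
  simp only [] at h3 h2 ⊢
  rw [h3, h2, integral_const_mul, aP hρ, Complex.real_smul]
  unfold chihat
  ring

lemma chi_lattice_summable (ρ z u : ℝ) (hρ : 0 < ρ) :
    Summable fun v : ℤ => ‖(chi (v / ρ - z) : ℂ) * ee (v * u)‖ := by
  apply summable_of_ne_finset_zero (s := Finset.Icc ⌈ρ * (z - 1)⌉ ⌊ρ * (z+1)⌋)
  intro v hv
  rw [norm_eq_zero, chi_supp, Complex.ofReal_zero, zero_mul]
  by_contra hlt
  rw [not_le, abs_lt] at hlt
  apply hv
  rw [Finset.mem_Icc, Int.ceil_le, Int.le_floor]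
  have : (v:ℝ) / ρ * ρ = v := by field_simp
  constructor <;> nlinarith

def dp (x y : Vv d) : ℝ := ∑ i, x i * y i

lemma summ_one (ρ u : ℝ) (hρ : 0 < ρ) : Summable (fun q : ℤ => ((1 + ρ * |(q:ℝ) - u|) ^ 2)⁻¹) := by
  have h1 : Summable (fun q : ℤ => ρ⁻¹ ^ 2 * |((q:ℝ) - u) ^ 2|⁻¹) := by
    apply Summable.mul_left
    have h3 := EisensteinSeries.linear_right_summable (-u : ℂ) 1 (k := 2) (by norm_num)
    refine h3.norm.congr fun q => ?_
    simp only [Int.cast_one, one_mul]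
    rw [norm_inv, abs_pow, norm_zpow]
    congr 1
    have : (-(u:ℂ) + q) = ((q - u : ℝ) : ℂ) := by push_cast; ring
    rw [this, cN, nA]; norm_cast
  refine Summable.of_norm_bounded_eventually h1 ?_
  have hf : {q : ℤ | (q : ℝ) = u}.Finite := by
    apply Set.Subsingleton.finite
    intro a ha b hb
    have : (a : ℝ) = b := by rw [ha, hb]
    exact_mod_cast this
  filter_upwards [hf.compl_mem_cofinite] with q hq
  have hne : (q:ℝ) - u ≠ 0 := sub_ne_zero.mpr hq
  rw [inv_pow, ← mul_inv, abs_pow, ← mul_pow, nA, abs_of_nonneg pz]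
  apply inv_anti₀
  · have := abs_pos.mpr hne; positivity
  · gcongr
    linarith

lemma ker_le_prod (x : Vv d) (ρ : ℝ) (hρ : 0 ≤ ρ) (s : Finset (Fin d)) :
    ker d (ρ * ‖x‖) ≤ ∏ i ∈ s, ((1 + ρ * |x i|) ^ 2)⁻¹ := by
  unfold ker
  rw [Finset.prod_inv_distrib]
  apply inv_anti₀ (Finset.prod_pos fun _ _ => by positivity)
  calc ∏ i ∈ s, (1 + ρ * |x i|) ^ 2 ≤ ∏ i ∈ s, (1 + ρ * ‖x‖) ^ 2 := by
        apply Finset.prod_le_prod (fun _ _ => by positivity)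
        intro i _
        gcongr
        exact pI x i
    _ = (1 + ρ * ‖x‖) ^ (2 * s.card) := by rw [Finset.prod_const, ← pow_mul]
    _ ≤ _ := by
        apply pow_le_pow_right₀ (by nlinarith [norm_nonneg x])
        have := Finset.card_le_univ s
        rw [fF] at this; omega

lemma ker_pos {t : ℝ} (ht : 0 ≤ t) : 0 < ker d t := by unfold ker; positivity

lemma ker_summable (ρ : ℝ) (hρ : 0 < ρ) (u : Vv d) :
    Summable (fun q : Fin d → ℤ => ker d (ρ * ‖(fun i => (q i : ℝ)) - u‖)) := by
  have h := (hasSum_prod_pi (fun i (q : ℤ) => ((((1 + ρ * |(q:ℝ) - u i|) ^ 2)⁻¹ : ℝ) : ℂ)) (fun i => by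
    refine (summ_one ρ (u i) hρ).congr fun q => ?_
    rw [cN, rN pz])).1
  refine Summable.of_nonneg_of_le (fun q => (ker_pos pz).le) (fun q => ?_) h
  refine (ker_le_prod _ ρ hρ.le Finset.univ).trans (le_of_eq ?_)
  apply Finset.prod_congr rfl
  intro i _
  rw [cN, rN pz]; rfl

def kerS (d : ℕ) (ρ : ℝ) (u : Vv d) (q : Fin d → ℤ) : ℝ :=
  if q = 0 then 0 else ker d (ρ * ‖(fun i => (q i : ℝ)) - u‖)

lemma kerS_nonneg {ρ : ℝ} (hρ : 0 < ρ) (u : Vv d) (q : Fin d → ℤ) : 0 ≤ kerS d ρ u q := by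
  unfold kerS; split_ifs
  · exact le_rfl
  · exact (ker_pos pz).le

lemma kerS_summable (ρ : ℝ) (hρ : 0 < ρ) (u : Vv d) : Summable (kerS d ρ u) := by
  refine Summable.of_nonneg_of_le (kerS_nonneg hρ u) (fun q => ?_) (ker_summable ρ hρ u)
  unfold kerS; split_ifs
  · exact (ker_pos pz).le
  · exact le_rfl

lemma chiD_integral (ρ : ℝ) (hρ : 0 < ρ) (z u : Vv d) :
    ∫ x : Vv d, (∏ i, (chi (x i / ρ - z i) : ℂ)) * ee (dp x u) =
      ∏ i, (ρ * chihat (-(ρ * u i)) * ee (ρ * z i * u i)) := by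
  simp_rw [← chi_scaled_integral ρ _ _ hρ]
  rw [← integral_fintype_prod_volume_eq_prod]
  congr 1; ext x
  rw [dp, ee_sum, ← pD]

lemma poissonD (ρ : ℝ) (hρ : 0 < ρ) (z u : Vv d) :
    ‖∑' v : Fin d → ℤ, (∏ i, (chi (v i / ρ - z i) : ℂ)) * ee (dp (fun i => (v i : ℝ)) u)
      - ∫ x : Vv d, (∏ i, (chi (x i / ρ - z i) : ℂ)) * ee (dp x u)‖ ≤
    ρ ^ d * (decC d ^ d * ∑' q : Fin d → ℤ, kerS d ρ u q) := by
  have h1 := (hasSum_prod_pi _ (fun i => chi_lattice_summable ρ (z i) (u i) hρ)).2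
  have hn : ∀ i : Fin d, Summable fun q : ℤ => ‖(ρ:ℂ) * chihat (ρ * (q - u i)) * ee (ρ * z i * (u i - q))‖ := by
    intro i
    refine ((summ_int ρ (u i) hρ).mul_left ρ).congr fun q => ?_
    rw [norm_mul, norm_mul, ee_norm, cN, nA, aP hρ, mul_one]
  have h2 := hasSum_prod_pi _ hn
  have e1 : ∑' v : Fin d → ℤ, (∏ i, (chi (v i / ρ - z i) : ℂ)) * ee (dp (fun i => (v i : ℝ)) u) =
      ∑' q : Fin d → ℤ, ∏ i, ((ρ:ℂ) * chihat (ρ * (q i - u i)) * ee (ρ * z i * (u i - q i))) := by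
    rw [h2.2.tsum_eq]
    simp_rw [← poisson1 ρ _ _ hρ]
    rw [← h1.tsum_eq]
    refine tsum_congr fun v => ?_
    rw [dp, ee_sum, ← pD]
  rw [e1, h2.2.summable.tsum_eq_add_tsum_ite 0, chiD_integral ρ hρ]
  have e0 : ∏ i, ((ρ:ℂ) * chihat (ρ * (((0 : Fin d → ℤ) i : ℤ) - u i)) * ee (ρ * z i * (u i - ((0 : Fin d → ℤ) i : ℤ)))) =
     ∏ i, (ρ * chihat (-(ρ * u i)) * ee (ρ * z i * u i)) := by
    apply Finset.prod_congr rfl; intro i _; simp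
  rw [e0, add_sub_cancel_left, ← mul_assoc, ← tsum_mul_left]
  apply tsum_of_norm_bounded ((kerS_summable ρ hρ u).mul_left _).hasSum
  intro q
  unfold kerS
  split_ifs
  · simp
  · rw [norm_prod]
    have : ∀ i : Fin d, ‖(ρ:ℂ) * chihat (ρ * (q i - u i)) * ee (ρ * z i * (u i - q i))‖ = ρ * ‖chihat (ρ * (q i - u i))‖ := by
      intro i
      rw [norm_mul, norm_mul, ee_norm, cN, nA, aP hρ, mul_one]
    simp_rw [this]
    rw [pD, Finset.prod_const, Finset.card_univ, fF, mul_assoc]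
    gcongr
    have := prod_chihat (ρ • ((fun i => (q i : ℝ)) - u))
    rw [norm_smul, nA, aP hρ] at this
    exact this

def ballB (d : ℕ) (ε : ℝ) : Set (Vv d) := {z | enorm2 z < 1 + d * ε}

def phi (d : ℕ) (ε : ℝ) (x : Vv d) : ℝ := ∫ z in ballB d ε, ∏ i, (ε⁻¹ * chi ((x i - z i) / ε))

def volC (d : ℕ) : ℝ := (2 * (1 + d)) ^ d

lemma ballB_meas (d : ℕ) (ε : ℝ) : MeasurableSet (ballB d ε) :=
  (isOpen_lt enorm2_cont continuous_const).measurableSet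

lemma ballB_sub (h1 : ε ≤ 1) : ballB d ε ⊆ Metric.ball 0 (1 + d) := by
  intro z hz
  rw [mem_ball_zero_iff]
  have h2 : enorm2 z < 1 + d * ε := hz
  have h3 : (d:ℝ) * ε ≤ d := mO pz h1
  linarith [norm_le_enorm2 z]

lemma ballB_vol (h1 : ε ≤ 1) : volume (ballB d ε) ≤ oR (volC d) := by
  refine (measure_mono (ballB_sub h1)).trans (le_of_eq ?_)
  rw [Real.volume_pi_ball _ pz, fF]
  rfl

lemma ballB_fin (h1 : ε ≤ 1) : volume (ballB d ε) < ⊤ :=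
  (ballB_vol h1).trans_lt ENNReal.ofReal_lt_top

lemma ballB_real (h1 : ε ≤ 1) : volume.real (ballB d ε) ≤ volC d :=
  ENNReal.toReal_le_of_le_ofReal (by unfold volC; positivity) (ballB_vol h1)

lemma cont_intOn_ballB (h1 : ε ≤ 1) {F : Type*} [NormedAddCommGroup F]
    {f : (Vv d) → F} (hf : Continuous f) : IntegrableOn f (ballB d ε) := by
  refine (hf.continuousOn.integrableOn_compact (isCompact_closedBall (0 : Vv d) (1+d))).mono_set ?_
  exact (ballB_sub h1).trans Metric.ball_subset_closedBall

lemma bump_cont (ε : ℝ) (x : Vv d) : Continuous (fun z : Vv d => ∏ i, (ε⁻¹ * chi ((x i - z i) / ε))) := by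
  fun_prop

lemma bump_nonneg (h0 : 0 < ε) (x z : Vv d) : 0 ≤ ∏ i, (ε⁻¹ * chi ((x i - z i) / ε)) :=
  Finset.prod_nonneg fun _ _ => mul_nonneg pz (chi_nonneg _)

lemma bump1_int (ε x : ℝ) (h0 : 0 < ε) : ∫ z : ℝ, ε⁻¹ * chi ((x - z) / ε) = 1 := by
  have h3 := Measure.integral_comp_div (fun t => chi t) ε
  have h2 := integral_sub_left_eq_self (fun s => chi (s / ε)) volume x
  rw [integral_const_mul, h2, h3, chi_integral, aP h0]
  simp; field_simp

lemma bump_int (ε : ℝ) (h0 : 0 < ε) (x : Vv d) : ∫ z : Vv d, ∏ i, (ε⁻¹ * chi ((x i - z i) / ε)) = 1 := by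
  rw [integral_fintype_prod_volume_eq_prod (fun i z => ε⁻¹ * chi ((x i - z) / ε))]
  simp [bump1_int ε _ h0]

lemma bump_zero (h0 : 0 < ε) {x z : Vv d} (h : (∏ i, (ε⁻¹ * chi ((x i - z i) / ε))) ≠ 0) :
    enorm2 (x - z) ≤ d * ε := by
  refine (enorm2_le _).trans ?_
  gcongr
  rw [pN h0.le]
  intro i
  by_contra hlt
  apply h
  apply Finset.prod_eq_zero (Finset.mem_univ i)
  rw [chi_supp, mul_zero]
  rw [abs_div, aP h0, lD h0]
  simp at hlt
  linarith

lemma bump_integrable (h0 : 0 < ε) (x : Vv d) :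
    Integrable (fun z : Vv d => ∏ i, (ε⁻¹ * chi ((x i - z i) / ε))) := by
  by_contra h
  have := integral_undef h
  rw [bump_int ε h0] at this
  norm_num at this

lemma phi_nonneg (h0 : 0 < ε) (x : Vv d) : 0 ≤ phi d ε x :=
  integral_nonneg fun z => bump_nonneg h0 x z

lemma phi_le_one (h0 : 0 < ε) (x : Vv d) : phi d ε x ≤ 1 := by
  rw [← bump_int ε h0 x]
  exact setIntegral_le_integral (bump_integrable h0 x) (eF fun z => bump_nonneg h0 x z)

lemma phi_eq_one (h0 : 0 < ε) {x : Vv d} (hx : enorm2 x < 1) : phi d ε x = 1 := by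
  rw [← bump_int ε h0 x]
  unfold phi
  apply setIntegral_eq_integral_of_forall_compl_eq_zero
  intro z hz
  by_contra hne
  apply hz
  have h1 := bump_zero h0 hne
  have h2 := enorm2_add x (-(x - z))
  have h3 : enorm2 (-(x-z)) = enorm2 (x - z) := by
    have := enorm2_smul (-1) (x - z)
    simpa using this
  have h4 : x + -(x - z) = z := by abel
  rw [h3, h4] at h2
  change enorm2 z < _
  linarith

lemma phi_supp (h0 : 0 < ε) {x : Vv d} (hx : phi d ε x ≠ 0) : enorm2 x < 1 + 2 * d * ε := by
  by_contra hlt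
  apply hx
  unfold phi
  apply setIntegral_eq_zero_of_forall_eq_zero
  intro z hz
  by_contra hne
  have h1 := bump_zero h0 hne
  have h2 := enorm2_add z (x - z)
  rw [add_sub_cancel] at h2
  have h3 : enorm2 z < 1 + d * ε := hz
  linarith

lemma phi_cont (h0 : 0 < ε) (h1 : ε ≤ 1) : Continuous (phi d ε) := by
  obtain ⟨M, hM⟩ := chi_cont.bounded_above_of_compact_support chi_compact
  unfold phi
  apply continuous_of_dominated (bound := fun _ => (ε⁻¹ * M) ^ d)
  · intro x
    exact (bump_cont ε x).aestronglyMeasurable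
  · intro x
    refine eF fun z => ?_
    rw [norm_prod]
    have : ∀ i ∈ Finset.univ, ‖ε⁻¹ * chi ((x i - z i) / ε)‖ ≤ ε⁻¹ * M := by
      intro i _
      rw [norm_mul, norm_inv, rN h0.le]
      gcongr
      exact hM _
    refine (Finset.prod_le_prod (fun _ _ => norm_nonneg _) this).trans ?_
    simp
  · exact integrableOn_const (ballB_fin h1).ne
  · refine eF fun z => ?_
    fun_prop

def jnt (d : ℕ) (ε T : ℝ) (u : Vv d) (x z : Vv d) : ℂ :=
  ((∏ i, (ε⁻¹ * chi ((x i / T - z i) / ε)) : ℝ) : ℂ) * ee (dp x u)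

@[fun_prop]
lemma dp_cont (u : Vv d) : Continuous (fun x => dp x u) := by unfold dp; fun_prop

lemma jnt_eq (h0 : 0 < ε) (hT : 0 < T) (u x z : Vv d) :
    jnt d ε T u x z = (ε⁻¹ ^ d : ℝ) * ((∏ i, (chi (x i / (ε * T) - z i / ε) : ℂ)) * ee (dp x u)) := by
  unfold jnt
  rw [← mul_assoc]
  congr 1
  push_cast
  rw [pD, Finset.prod_const, Finset.card_univ, fF]
  congr 1
  apply Finset.prod_congr rfl
  intro i _
  congr 2
  field_simp

lemma jnt_int_x (h0 : 0 < ε) (hT : 0 < T) (u z : Vv d) :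
    ∫ x, jnt d ε T u x z = (T ^ d : ℝ) * ∏ i, (chihat (-(ε * T * u i)) * ee (T * z i * u i)) := by
  simp_rw [jnt_eq h0 hT]
  rw [integral_const_mul, chiD_integral _ pz]
  simp_rw [mul_assoc, pD]
  rw [Finset.prod_const, Finset.card_univ, fF, ← mul_assoc]
  congr 1
  · push_cast
    rw [mul_pow, ← mul_assoc, ← mul_pow, inv_mul_cancel₀ (by exact_mod_cast h0.ne'), one_pow, one_mul]
  · congr 1
    apply Finset.prod_congr rfl
    intro i _
    congr 1
    field_simp

lemma jnt_norm (h0 : 0 < ε) (u x z : Vv d) : ‖jnt d ε T u x z‖ = ∏ i, (ε⁻¹ * chi ((x i / T - z i) / ε)) := by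
  unfold jnt
  rw [norm_mul, ee_norm, mul_one, cN, rN (bump_nonneg h0 (fun i => x i / T) z)]

lemma jnt_contx (ε T : ℝ) (u z : Vv d) : Continuous (fun x => jnt d ε T u x z) := by
  unfold jnt; fun_prop

lemma jnt_cont (ε T : ℝ) (u : Vv d) : Continuous (Function.uncurry (jnt d ε T u)) := by
  have : Function.uncurry (jnt d ε T u) = fun p : (Vv d) × (Vv d) => ((∏ i, (ε⁻¹ * chi ((p.1 i / T - p.2 i) / ε)) : ℝ) : ℂ) * ee (dp p.1 u) := rfl
  rw [this]
  have := (dp_cont u).comp (continuous_fst (X := Vv d) (Y := Vv d))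
  apply Continuous.mul
  · fun_prop
  · exact ee_cont.comp this

lemma jnt_norm_int (h0 : 0 < ε) (hT : 0 < T) (u z : Vv d) : ∫ x, ‖jnt d ε T u x z‖ = T ^ d := by
  have e := jnt_int_x h0 hT 0 z
  have e2 : ∫ x, jnt d ε T 0 x z = ((∫ x, ‖jnt d ε T u x z‖ : ℝ) : ℂ) := by
    rw [← integral_complex_ofReal]
    congr 1; ext x
    rw [jnt_norm h0]; unfold jnt; simp [dp, ee_zero]
  rw [e2] at e
  simp [chihat_zero, ee_zero] at e
  exact_mod_cast e

lemma jnt_integrable (h0 : 0 < ε) (h1 : ε ≤ 1) (hT : 0 < T) (u : Vv d) :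
    Integrable (Function.uncurry (jnt d ε T u)) ((volume : Measure (Vv d)).prod (volume.restrict (ballB d ε))) := by
  have : IsFiniteMeasure (volume.restrict (ballB d ε)) := ⟨by simpa using ballB_fin h1⟩
  rw [integrable_prod_iff' (jnt_cont ε T u).aestronglyMeasurable]
  constructor
  · refine eF fun z => ?_
    rw [← integrable_norm_iff (f := fun x => Function.uncurry (jnt d ε T u) (x, z)) (jnt_contx ε T u z).aestronglyMeasurable]
    by_contra h
    have := integral_undef h
    have h2 := jnt_norm_int h0 hT u z
    exact (pow_pos hT d).ne' (h2.symm.trans this)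
  · have : (fun z => ∫ x, ‖Function.uncurry (jnt d ε T u) (x, z)‖) = fun _ => T ^ d := by
      ext z; exact jnt_norm_int h0 hT u z
    rw [this]
    exact integrable_const _

lemma phi_jnt (u x : Vv d) :
    (phi d ε (fun i => x i / T) : ℂ) * ee (dp x u) = ∫ z in ballB d ε, jnt d ε T u x z := by
  unfold jnt
  rw [integral_mul_const, integral_complex_ofReal]
  rfl

lemma phi_hat (h0 : 0 < ε) (h1 : ε ≤ 1) (hT : 0 < T) (u : Vv d) :
    ∫ x, (phi d ε (fun i => x i / T) : ℂ) * ee (dp x u) =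
    ∫ z in ballB d ε, ∫ x, jnt d ε T u x z := by
  simp_rw [phi_jnt]
  exact integral_integral_swap (jnt_integrable h0 h1 hT u)

lemma phi_hat_bound (h0 : 0 < ε) (h1 : ε ≤ 1) (u : Vv d) :
    ‖∫ x, (phi d ε x : ℂ) * ee (dp x u)‖ ≤ volC d * decC d ^ d * ker d (ε * ‖u‖) := by
  have := phi_hat h0 h1 one_pos u
  simp only [div_one] at this
  rw [this]
  have hb : ∀ z ∈ ballB d ε, ‖∫ x, jnt d ε 1 u x z‖ ≤ decC d ^ d * ker d (ε * ‖u‖) := by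
    intro z _
    rw [jnt_int_x h0 one_pos, one_pow, Complex.ofReal_one, one_mul, norm_prod]
    have := prod_chihat ((-ε) • u)
    rw [norm_smul, norm_neg, rN h0.le] at this
    refine le_trans (le_of_eq ?_) this
    apply Finset.prod_congr rfl
    intro i _
    rw [norm_mul, ee_norm, mul_one]
    simp
  refine (sI (ballB_fin h1) hb).trans ?_
  rw [mul_comm, mul_assoc]
  gcongr
  · have := decC_one d
    have : 0 < ker d (ε * ‖u‖) := ker_pos pz
    positivity
  · exact ballB_real h1

lemma phi_int (h0 : 0 < ε) (h1 : ε ≤ 1) (hT : 0 < T) (u : Vv d) :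
    ‖∫ x, (phi d ε (fun i => x i / T) : ℂ) * ee (dp x u)‖ ≤ volC d * decC d ^ d * T ^ d := by
  have hb : ∀ z ∈ ballB d ε, ‖∫ x, jnt d ε T u x z‖ ≤ decC d ^ d * T ^ d := by
    intro z _
    rw [jnt_int_x h0 hT, norm_mul, norm_prod, cN, rN pz, mul_comm]
    gcongr
    refine (Finset.prod_le_prod (g := fun _ => decC d) (fun _ _ => norm_nonneg _) ?_).trans (by simp)
    intro i _
    rw [norm_mul, ee_norm, mul_one]
    refine (decC_spec d _).trans (mO (by linarith [decC_one d]) ?_)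
    apply iL
    apply oP
    linarith [abs_nonneg (-(ε * T * u i))]
  rw [phi_hat h0 h1 hT u]
  refine (sI (ballB_fin h1) hb).trans ?_
  rw [mul_comm, mul_assoc]
  gcongr
  · have := decC_one d
    positivity
  · exact ballB_real h1

lemma phi_lattice_zero {ε T M : ℝ} (h0 : 0 < ε) (h1 : ε ≤ 1) (hT : 0 < T) (hM : T * (1 + 2 * d) ≤ M) {x : Vv d}
    (hx : phi d ε (fun i => x i / T) ≠ 0) (i : Fin d) : |x i| < M := by
  have h2 := phi_supp h0 hx
  have h3 := norm_le_enorm2 (fun i => x i / T)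
  have h4 := pI (fun i => x i / T) i
  rw [norm_div, rN hT.le, nA, div_le_iff₀ hT] at h4
  have : (d:ℝ) * ε ≤ d := mO pz h1
  refine lt_of_lt_of_le ?_ hM
  refine lt_of_le_of_lt h4 ?_
  rw [mul_comm]
  gcongr
  nlinarith

lemma poissonPhi (h0 : 0 < ε) (h1 : ε ≤ 1) (hT : 0 < T) (u : Vv d) :
    ‖∑' v : Fin d → ℤ, (phi d ε (fun i => v i / T) : ℂ) * ee (dp (fun i => (v i : ℝ)) u)
      - ∫ x, (phi d ε (fun i => x i / T) : ℂ) * ee (dp x u)‖ ≤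
    volC d * decC d ^ d * T ^ d * ∑' q : Fin d → ℤ, kerS d (ε * T) u q := by
  set M : ℤ := ⌈T * (1 + 2 * d)⌉ with hM
  set V : Finset (Fin d → ℤ) := Fintype.piFinset (fun _ => Finset.Icc (-M) M) with hV
  have hMr : T * (1 + 2 * d) ≤ (M : ℝ) := Int.le_ceil _
  have hmem : ∀ v : Fin d → ℤ, v ∉ V → ∃ i, (M : ℝ) ≤ |(v i : ℝ)| := by
    intro v hv
    by_contra hcon
    push Not at hcon
    apply hv
    rw [hV, Fintype.mem_piFinset]
    intro i
    have := hcon i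
    rw [abs_lt] at this
    rw [Finset.mem_Icc]
    constructor
    · have h := this.1; exact_mod_cast h.le
    · have h := this.2; exact_mod_cast h.le
  have e1 : ∑' v : Fin d → ℤ, (phi d ε (fun i => v i / T) : ℂ) * ee (dp (fun i => (v i : ℝ)) u) =
      ∫ z in ballB d ε, ∑ v ∈ V, jnt d ε T u (fun i => (v i : ℝ)) z := by
    rw [tsum_eq_sum (s := V)]
    · rw [integral_finsetSum]
      · exact sC rfl fun v _ => phi_jnt u (fun i => (v i : ℝ))
      · intro v _
        apply cont_intOn_ballB h1
        unfold jnt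
        fun_prop
    · intro v hv
      obtain ⟨i, hi⟩ := hmem v hv
      by_contra hne
      have h5 : phi d ε (fun i => v i / T) ≠ 0 := by
        intro h; rw [h] at hne; simp at hne
      have := phi_lattice_zero h0 h1 hT hMr (x := fun i => (v i : ℝ)) h5 i
      linarith
  rw [e1, phi_hat h0 h1 hT u, ← integral_sub]
  rotate_left
  · apply cont_intOn_ballB h1
    unfold jnt
    fun_prop
  · exact (jnt_integrable h0 h1 hT u).integral_prod_right
  have hb : ∀ z ∈ ballB d ε, ‖∑ v ∈ V, jnt d ε T u (fun i => (v i : ℝ)) z - ∫ x, jnt d ε T u x z‖ ≤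
      decC d ^ d * T ^ d * ∑' q : Fin d → ℤ, kerS d (ε * T) u q := by
    intro z hz
    have e2 : ∑ v ∈ V, jnt d ε T u (fun i => (v i : ℝ)) z = ∑' v : Fin d → ℤ, jnt d ε T u (fun i => (v i : ℝ)) z := by
      rw [tsum_eq_sum (s := V)]
      intro v hv
      obtain ⟨i, hi⟩ := hmem v hv
      by_contra hne
      have h5 : (∏ i, (ε⁻¹ * chi ((v i / T - z i) / ε))) ≠ 0 := by
        intro h; unfold jnt at hne; rw [h] at hne; simp at hne
      have h6 := bump_zero h0 (x := fun i => v i / T) (z := z) h5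
      have h7 := enorm2_add z ((fun i => v i / T) - z)
      rw [add_sub_cancel] at h7
      have h8 : enorm2 z < 1 + d * ε := hz
      have h3 := norm_le_enorm2 (fun i => v i / T)
      have h4 := pI (fun i => v i / T) i
      rw [norm_div, rN hT.le, nA, div_le_iff₀ hT] at h4
      have : (d:ℝ) * ε ≤ d := mO pz h1
      have h9 : ‖fun i => v i / T‖ * T < (1 + 2 * d) * T := by
        gcongr
        linarith
      linarith
    rw [e2]
    simp_rw [jnt_eq h0 hT]
    rw [tsum_mul_left, integral_const_mul, ← mul_sub, norm_mul, cN, rN pz]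
    have := poissonD (ε * T) pz (fun i => z i / ε) u
    calc _ ≤ ε⁻¹ ^ d * ((ε * T) ^ d * (decC d ^ d * ∑' q : Fin d → ℤ, kerS d (ε * T) u q)) := by gcongr
      _ = _ := by
        rw [mul_pow, inv_pow]
        field_simp
  refine (sI (ballB_fin h1) hb).trans ?_
  rw [mul_comm, mul_assoc (volC d), mul_assoc (volC d)]
  have hnn : 0 ≤ decC d ^ d * T ^ d * ∑' q : Fin d → ℤ, kerS d (ε * T) u q := by
    have := decC_one d
    have h5 : 0 ≤ ∑' q : Fin d → ℤ, kerS d (ε * T) u q := tsum_nonneg (kerS_nonneg pz u)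
    positivity
  exact mR (ballB_real h1) hnn

instance instBorelMat (m : ℕ) : BorelSpace (Mm m) := inferInstanceAs (BorelSpace (Fin m → Vv m))
instance instBorelSL (m : ℕ) : BorelSpace (sG (Fin m) ℝ) := Subtype.borelSpace _
instance instSCMat (m : ℕ) : SecondCountableTopology (Mm m) := inferInstanceAs (SecondCountableTopology (Fin m → Vv m))
instance instLCMat (m : ℕ) : LocallyCompactSpace (Mm m) := inferInstanceAs (LocallyCompactSpace (Fin m → Vv m))
instance instSCSL (m : ℕ) : SecondCountableTopology (sG (Fin m) ℝ) := TopologicalSpace.Subtype.secondCountableTopology _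
instance instTGSL (m : ℕ) : IsTopologicalGroup (sG (Fin m) ℝ) := Matrix.SpecialLinearGroup.topologicalGroup

lemma sl_ce (m : ℕ) : Topology.IsClosedEmbedding (fun g : sG (Fin m) ℝ => (g : Mm m)) :=
  Matrix.SpecialLinearGroup.isClosedEmbedding_val

instance instLCSL (m : ℕ) : LocallyCompactSpace (sG (Fin m) ℝ) := (sl_ce m).locallyCompactSpace

@[fun_prop]
lemma sl_cont (m : ℕ) : Continuous (fun g : sG (Fin m) ℝ => (g : Mm m)) := (sl_ce m).continuous


def Ka (m : ℕ) (a : ℝ) : Set (sG (Fin m) ℝ) :=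
  {g | (∀ i j, |(g : Mm m) i j| ≤ a) ∧ ∀ i j, |((g⁻¹ : sG (Fin m) ℝ) : Mm m) i j| ≤ a}

lemma sl_entry (m : ℕ) (i j : Fin m) : Continuous (fun g : sG (Fin m) ℝ => (g : Mm m) i j) :=
  (sl_cont m).matrix_elem i j

lemma Ka_closed (m : ℕ) (a : ℝ) : IsClosed (Ka m a) := by
  unfold Ka
  rw [Set.ofPred_and]
  apply IsClosed.inter
  · simp only [Set.ofPred_forall]
    exact isClosed_iInter fun i => isClosed_iInter fun j => isClosed_le (sl_entry m i j).abs continuous_const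
  · simp only [Set.ofPred_forall]
    exact isClosed_iInter fun i => isClosed_iInter fun j => isClosed_le ((sl_entry m i j).comp continuous_inv).abs continuous_const

lemma Ka_compact (m : ℕ) (a : ℝ) : IsCompact (Ka m a) := by
  have h : IsCompact (Set.univ.pi fun _ : Fin m => Set.univ.pi fun _ : Fin m => Set.Icc (-a) a) :=
    isCompact_univ_pi fun _ => isCompact_univ_pi fun _ => isCompact_Icc
  have h2 := (sl_ce m).isCompact_preimage h
  refine h2.of_isClosed_subset (Ka_closed m a) ?_
  intro g hg
  exact fun i _ j _ => abs_le.mp (hg.1 i j)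

lemma Ka_meas (m : ℕ) (a : ℝ) : MeasurableSet (Ka m a) := (Ka_closed m a).measurableSet

lemma Ka_mono (m : ℕ) {a b : ℝ} (h : a ≤ b) : Ka m a ⊆ Ka m b :=
  fun _ hg => ⟨fun i j => (hg.1 i j).trans h, fun i j => (hg.2 i j).trans h⟩

lemma Ka_union (m : ℕ) : ⋃ a : ℕ, Ka m (a + 1) = Set.univ := by
  ext g
  simp only [Set.mem_iUnion, Set.mem_univ, iff_true]
  obtain ⟨N, hN⟩ := exists_nat_ge (∑ i, ∑ j, |(g : Mm m) i j| + ∑ i, ∑ j, |((g⁻¹ : sG (Fin m) ℝ) : Mm m) i j|)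
  have key : ∀ (A : Mm m) (i j : Fin m), |A i j| ≤ ∑ i, ∑ j, |A i j| := by
    intro A i j
    refine (Finset.single_le_sum (f := fun j => |A i j|) (fun _ _ => abs_nonneg _) (Finset.mem_univ j)).trans ?_
    exact Finset.single_le_sum (f := fun i => ∑ j, |A i j|) (fun _ _ => Finset.sum_nonneg fun _ _ => abs_nonneg _) (Finset.mem_univ i)
  have pos : ∀ (A : Mm m), 0 ≤ ∑ i, ∑ j, |A i j| := fun A => Finset.sum_nonneg fun _ _ => Finset.sum_nonneg fun _ _ => abs_nonneg _
  refine ⟨N, fun i j => ?_, fun i j => ?_⟩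
  · linarith [key (g : Mm m) i j, pos ((g⁻¹ : sG (Fin m) ℝ) : Mm m)]
  · linarith [key ((g⁻¹ : sG (Fin m) ℝ) : Mm m) i j, pos (g : Mm m)]

lemma mulVec_bound {m : ℕ} {A : Mm m} {a : ℝ} (h : ∀ i j, |A i j| ≤ a) (ha : 0 ≤ a) (x : Vv m) : ‖A *ᵥ x‖ ≤ m * a * ‖x‖ := by
  rw [pN pz]
  intro i
  rw [nA]
  unfold mulVec dotProduct
  refine (Finset.abs_sum_le_sum_abs _ _).trans ?_
  have : ∀ j ∈ Finset.univ, |A i j * x j| ≤ a * ‖x‖ := by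
    intro j _
    rw [abs_mul]
    gcongr
    · exact h i j
    · exact pI x j
  refine (sL this).trans ?_
  simp [mul_assoc]

def hm (m : ℕ) (j : Fin m) (s : Vv m) : Mm m :=
  1 + replicateCol Unit (Function.update s j 0) * replicateRow Unit (Pi.single j (1:ℝ))

lemma hm_apply {m : ℕ} (j : Fin m) (s : Vv m) (i l : Fin m) : hm m j s i l = (if i = l then 1 else 0) + (if l = j then (if i = j then 0 else s i) else 0) := by
  simp [hm, Matrix.mul_apply, Matrix.one_apply, Pi.single_apply, Function.update_apply]

lemma hm_det {m : ℕ} (j : Fin m) (s : Vv m) : (hm m j s).det = 1 := by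
  unfold hm
  rw [det_one_add_replicateCol_mul_replicateRow]
  simp

def hs (m : ℕ) (j : Fin m) (s : Vv m) : sG (Fin m) ℝ := ⟨hm m j s, hm_det j s⟩

lemma hs_coe {m : ℕ} (j : Fin m) (s : Vv m) : ((hs m j s : sG (Fin m) ℝ) : Mm m) = hm m j s := rfl

lemma hs_cont {m : ℕ} (j : Fin m) : Continuous (hs m j) := by
  apply Continuous.subtype_mk
  apply continuous_matrix
  intro i l
  simp only [hm_apply]
  split_ifs <;> fun_prop

lemma hm_mulVec {m : ℕ} (j : Fin m) (s x : Vv m) (i : Fin m) : (hm m j s *ᵥ x) i = x i + (if i = j then 0 else x j * s i) := by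
  simp only [mulVec, dotProduct, hm_apply, add_mul, Finset.sum_add_distrib]
  simp
  split_ifs <;> ring

lemma hs_mul_neg {m : ℕ} (j : Fin m) (s : Vv m) : hs m j s * hs m j (-s) = 1 := by
  apply Subtype.ext
  change (hm m j s * hm m j (-s)) = (1 : Mm m)
  apply Matrix.toLin'.injective
  apply LinearMap.ext
  intro x
  simp only [Matrix.toLin'_apply, ← mV, Matrix.one_mulVec]
  ext i
  rw [hm_mulVec, hm_mulVec, hm_mulVec]
  by_cases h : i = j <;> simp [h]

lemma hs_inv {m : ℕ} (j : Fin m) (s : Vv m) : (hs m j s)⁻¹ = hs m j (-s) := inv_eq_of_mul_eq_one_right (hs_mul_neg j s)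

lemma hm_bd {m : ℕ} (j : Fin m) (s : Vv m) (hs : ∀ i, |s i| ≤ 1) (i l : Fin m) : |hm m j s i l| ≤ 2 := by
  rw [hm_apply]
  refine (abs_add_le _ _).trans ?_
  have h1 : |(if i = l then (1:ℝ) else 0)| ≤ 1 := by split_ifs <;> simp
  have h2 : |(if l = j then (if i = j then 0 else s i) else 0)| ≤ 1 := by
    split_ifs
    · simp
    · exact hs i
    · simp
  linarith

lemma hm_mulVec_self {m : ℕ} (j : Fin m) (s x : Vv m) : (hm m j s *ᵥ x) j = x j := by
  rw [hm_mulVec]; simp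

lemma hmT_mulVec {m : ℕ} (j : Fin m) (s x : Vv m) (i : Fin m) (hi : i ≠ j) : ((hm m j s)ᵀ *ᵥ x) i = x i := by
  simp only [mulVec, dotProduct, transpose_apply, hm_apply, add_mul, Finset.sum_add_distrib]
  simp [hi]

lemma mul_bd {m : ℕ} {A B : Mm m} {a b : ℝ} (ha : ∀ i j, |A i j| ≤ a) (hb : ∀ i j, |B i j| ≤ b) (i j : Fin m) : |(A * B) i j| ≤ m * (a * b) := by
  rw [Matrix.mul_apply]
  refine (Finset.abs_sum_le_sum_abs _ _).trans ?_
  have : ∀ l ∈ Finset.univ, |A i l * B l j| ≤ a * b := by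
    intro l _
    rw [abs_mul]
    have := (abs_nonneg _).trans (ha i l)
    gcongr
    · exact ha i l
    · exact hb l j
  refine (sL this).trans ?_
  simp

lemma hs_Ka {m : ℕ} (j : Fin m) (s : Vv m) (h : ∀ i, |s i| ≤ 1) {a : ℝ} {g : sG (Fin m) ℝ} (hg : hs m j s * g ∈ Ka m a) :
    g ∈ Ka m (m * (2 * a)) := by
  have h' : ∀ i, |(-s) i| ≤ 1 := by simpa using h
  have e1 : g = hs m j (-s) * (hs m j s * g) := by rw [← hs_inv]; group
  have e2 : g⁻¹ = (hs m j s * g)⁻¹ * hs m j s := by group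
  constructor
  · intro i l
    rw [e1]
    exact mul_bd (hm_bd j (-s) h') hg.1 i l
  · intro i l
    rw [e2, mul_comm 2 a]
    exact mul_bd hg.2 (hm_bd j s h) i l

def I1 : ℝ := ∫ x : ℝ, ((1 + |x|) ^ 2)⁻¹

lemma i1_integrable : Integrable (fun x : ℝ => ((1 + |x|) ^ 2)⁻¹) := by
  have := integrable_one_add_norm (E := ℝ) (μ := volume) (r := 2) (by simp)
  refine this.congr (eF fun x => ?_)
  simp only [nA]
  rw [Real.rpow_neg pz]
  norm_cast

lemma I1_nonneg : 0 ≤ I1 := integral_nonneg fun x => by positivity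

lemma i1_comp (ρ β γ : ℝ) (hρ : 0 < ρ) (hγ : γ ≠ 0) :
    Integrable (fun s : ℝ => ((1 + ρ * |β - γ * s|) ^ 2)⁻¹) ∧ ∫ s : ℝ, ((1 + ρ * |β - γ * s|) ^ 2)⁻¹ = I1 / (ρ * |γ|) := by
  have e : (fun s : ℝ => ((1 + ρ * |β - γ * s|) ^ 2)⁻¹) = fun s => (fun x : ℝ => (fun y : ℝ => ((1 + |y|) ^ 2)⁻¹) (ρ * β - x)) ((ρ * γ) * s) := by
    ext s
    have : |ρ * β - ρ * γ * s| = ρ * |β - γ * s| := by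
      rw [show ρ * β - ρ * γ * s = ρ * (β - γ * s) by ring, abs_mul, aP hρ]
    simp only [this]
  rw [e]
  constructor
  · exact (i1_integrable.comp_sub_left (ρ * β)).comp_mul_left' (mul_ne_zero hρ.ne' hγ)
  · rw [Measure.integral_comp_mul_left (fun x : ℝ => (fun y : ℝ => ((1 + |y|) ^ 2)⁻¹) (ρ * β - x)), integral_sub_left_eq_self (fun y : ℝ => ((1 + |y|) ^ 2)⁻¹)]
    rw [abs_inv, abs_mul, aP hρ, smul_eq_mul, I1]
    ring

lemma i1_box (ρ β γ c : ℝ) (hρ : 0 < ρ) (hc : 0 < c) (hγ : c ≤ |γ|) :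
    ∫ s in Set.Icc (0:ℝ) 1, ((1 + ρ * |β - γ * s|) ^ 2)⁻¹ ≤ I1 / (ρ * c) := by
  have hγ0 : γ ≠ 0 := by rintro rfl; simp at hγ; linarith
  obtain ⟨h1, h2⟩ := i1_comp ρ β γ hρ hγ0
  refine (setIntegral_le_integral h1 (eF fun s => by positivity)).trans ?_
  rw [h2]
  have := I1_nonneg
  gcongr

abbrev cube (d : ℕ) : Measure (Vv d) := Measure.pi (fun _ => volume.restrict (Set.Icc (0:ℝ) 1))

instance instProbI : IsProbabilityMeasure (volume.restrict (Set.Icc (0:ℝ) 1)) := ⟨by simp⟩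

lemma cube_prod (F : Finset (Fin d)) (ρ c : ℝ) (hρ : 0 < ρ) (hc : 0 < c) (β γ : Vv d) (hγ : ∀ i ∈ F, c ≤ |γ i|) :
    ∫⁻ s, oR (∏ i ∈ F, ((1 + ρ * |β i - γ i * s i|) ^ 2)⁻¹) ∂(cube d) ≤ oR ((I1 / (ρ * c)) ^ F.card) := by
  have hcont : Continuous (fun s : Vv d => ∏ i ∈ F, ((1 + ρ * |β i - γ i * s i|) ^ 2)⁻¹) := by
    apply continuous_finsetProd
    intro i _
    apply Continuous.inv₀ (by fun_prop)
    intro s; positivity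
  have h1 : ∀ s : Vv d, ∀ i, ((1 + ρ * |β i - γ i * s i|) ^ 2)⁻¹ ≤ 1 := by
    intro s i
    apply iL
    apply oP
    have : 0 ≤ ρ * |β i - γ i * s i| := by positivity
    linarith
  have hint : Integrable (fun s : Vv d => ∏ i ∈ F, ((1 + ρ * |β i - γ i * s i|) ^ 2)⁻¹) (cube d) := by
    apply Integrable.of_bound hcont.aestronglyMeasurable 1
    refine eF fun s => ?_
    rw [rN (Finset.prod_nonneg fun i _ => by positivity)]
    exact Finset.prod_le_one (fun i _ => by positivity) fun i _ => h1 s i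
  rw [← ofReal_integral_eq_lintegral_ofReal hint (eF fun s => Finset.prod_nonneg fun i _ => by positivity)]
  apply oL
  have e : (fun s : Vv d => ∏ i ∈ F, ((1 + ρ * |β i - γ i * s i|) ^ 2)⁻¹) = fun s => ∏ i, (fun i t => if i ∈ F then ((1 + ρ * |β i - γ i * t|) ^ 2)⁻¹ else 1) i (s i) := by
    ext s
    simp
  rw [e, integral_fintype_prod_eq_prod (fun i t => if i ∈ F then ((1 + ρ * |β i - γ i * t|) ^ 2)⁻¹ else 1)]
  have : ∏ i : Fin d, ∫ t in Set.Icc (0:ℝ) 1, (if i ∈ F then ((1 + ρ * |β i - γ i * t|) ^ 2)⁻¹ else 1) ≤ ∏ i : Fin d, (if i ∈ F then I1 / (ρ * c) else 1) := by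
    apply Finset.prod_le_prod
    · intro i _
      apply integral_nonneg
      intro t
      simp only
      split_ifs <;> simp
      positivity
    · intro i _
      split_ifs with h
      · exact i1_box ρ _ _ c hρ hc (hγ i h)
      · simp
  refine this.trans (le_of_eq ?_)
  simp [div_pow]

def st (n : ℕ) (i : Fin (2*n)) : Fin (2*n) := if h : (i:ℕ) < n then ⟨i + n, by omega⟩ else ⟨i - n, by omega⟩

def sg (n : ℕ) (i : Fin (2*n)) : ℝ := if (i:ℕ) < n then 1 else -1

lemma st_val (n : ℕ) (i : Fin (2*n)) : (st n i : ℕ) = if (i:ℕ) < n then i + n else i - n := by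
  unfold st; split_ifs <;> rfl

lemma st_st (n : ℕ) (i : Fin (2*n)) : st n (st n i) = i := by
  have := i.2
  rw [Fin.ext_iff, st_val, st_val]
  split_ifs <;> omega

lemma st_ne (n : ℕ) (i : Fin (2*n)) : st n i ≠ i := by
  have := i.2
  rw [Ne, Fin.ext_iff, st_val]
  split_ifs <;> omega

lemma sg_abs (n : ℕ) (i : Fin (2*n)) : |sg n i| = 1 := by unfold sg; split_ifs <;> simp

lemma Jmat_apply (n : ℕ) (i j : Fin (2*n)) : Jmat n i j = if j = st n i then sg n i else 0 := by
  have := i.2; have := j.2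
  simp only [Fin.ext_iff, st_val]
  unfold Jmat sg
  by_cases h : (i:ℕ) < n
  · rw [if_pos h, if_pos h]
    by_cases h2 : (i:ℕ) + n = j
    · rw [if_pos h2, if_pos h2.symm]
    · rw [if_neg h2, if_neg (by omega), if_neg (by omega)]
  · rw [if_neg h, if_neg h, if_neg (by omega)]
    by_cases h2 : (j:ℕ) + n = i
    · rw [if_pos h2, if_pos (by omega)]
    · rw [if_neg h2, if_neg (by omega)]

lemma J_mulVec (n : ℕ) (x : Vv (2*n)) (i : Fin (2*n)) : (Jmat n *ᵥ x) i = sg n i * x (st n i) := by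
  simp [mulVec, dotProduct, Jmat_apply]

def Ag (n : ℕ) (g : SL2n n) : Mm (2*n) := (g : Mm (2*n))ᵀ * Jmat n * (g : Mm (2*n))

lemma form_eq {m : ℕ} (G J : Mm m) (v w : Vv m) : (G *ᵥ v) ⬝ᵥ (J *ᵥ (G *ᵥ w)) = v ⬝ᵥ ((Gᵀ * J * G) *ᵥ w) := by
  rw [← mV, ← mV, Matrix.dotProduct_mulVec v, vecMul_transpose]

lemma sympG_eq (n : ℕ) (g : SL2n n) (v w : Vv (2*n)) : sympG n g v w = dp v (Ag n g *ᵥ w) :=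
  form_eq _ _ _ _

lemma Ag_cont (n : ℕ) (w : Vv (2*n)) : Continuous (fun g : SL2n n => Ag n g *ᵥ w) := by
  unfold Ag
  have := sl_cont (2*n)
  apply Continuous.matrix_mulVec _ continuous_const
  exact ((this.matrix_transpose).matrix_mul continuous_const).matrix_mul this

lemma ker_anti {s t : ℝ} (hs : 0 ≤ s) (h : s ≤ t) : ker d t ≤ ker d s := by
  unfold ker; gcongr

lemma ker_contOn {X : Type*} [TopologicalSpace X] {f : X → ℝ} (hf : Continuous f) (h0 : ∀ x, 0 ≤ f x) : Continuous (fun x => ker d (f x)) := by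
  unfold ker
  apply Continuous.inv₀ (by fun_prop)
  intro x; have := h0 x; positivity

lemma pert_bound {a R : ℝ} (ha : 0 < a) (hR : 0 < R) {g : SL2n n} (hg : g ∈ Ka (2*n) a) (j : Fin (2*n)) (q w : Vv (2*n)) :
    ∃ β γ : Vv (2*n), (∀ i, |γ i| = |((g : Mm (2*n)) *ᵥ w) j|) ∧ ∀ s,
    ker (2*n) (R * ‖q - Ag n (hs (2*n) j s * g) *ᵥ w‖) ≤ ∏ i ∈ Finset.univ \ {j, st n j}, ((1 + R * ((2*n:ℕ) * a)⁻¹ * |β i - γ i * s i|)^2)⁻¹ := by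
  set G := (g : Mm (2*n)) with hG
  set Gi := ((g⁻¹ : SL2n n) : Mm (2*n)) with hGi
  have hGG : G * Gi = 1 := by
    have : g * g⁻¹ = 1 := mul_inv_cancel g
    exact congrArg (fun x : SL2n n => (x : Mm (2*n))) this
  have hGT : Giᵀ * Gᵀ = 1 := by rw [← Matrix.transpose_mul, hGG, Matrix.transpose_one]
  set w' := G *ᵥ w with hw'
  set q' := Giᵀ *ᵥ q with hq'
  have hn : 0 < 2 * n := j.pos
  refine ⟨fun i => q' (st n i) - sg n (st n i) * w' i, fun i => sg n (st n i) * w' j, fun i => by rw [abs_mul, sg_abs, one_mul], fun s => ?_⟩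
  set h := hm (2*n) j s with hh
  set y := hᵀ *ᵥ Jmat n *ᵥ h *ᵥ w' with hy
  have e1 : Ag n (hs (2*n) j s * g) *ᵥ w = Gᵀ *ᵥ y := by
    unfold Ag
    change ((h * G)ᵀ * Jmat n * (h * G)) *ᵥ w = _
    rw [Matrix.transpose_mul, hy, hw']
    simp only [mV, Matrix.mul_assoc]
  have e2 : q' - y = Giᵀ *ᵥ (q - Gᵀ *ᵥ y) := by
    rw [Matrix.mulVec_sub, mV, hGT, Matrix.one_mulVec]
  have e3 : ‖q' - y‖ ≤ (2*n:ℕ) * a * ‖q - Gᵀ *ᵥ y‖ := by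
    rw [e2]
    exact mulVec_bound (fun i l => hg.2 l i) ha.le _
  set z : Vv (2*n) := fun i => (q' - y) (st n i) with hz
  have e4 : ‖z‖ ≤ ‖q' - y‖ := by
    rw [pN (norm_nonneg _)]
    intro i
    exact pI (q' - y) _
  have hda : 0 < ((2*n:ℕ):ℝ) * a := by positivity
  have e5 : R * ((2*n:ℕ) * a)⁻¹ * ‖z‖ ≤ R * ‖q - Ag n (hs (2*n) j s * g) *ᵥ w‖ := by
    rw [e1, mul_assoc]
    gcongr
    rw [inv_mul_le_iff₀ hda]
    exact e4.trans e3
  refine (ker_anti pz e5).trans ?_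
  refine (ker_le_prod z _ pz (Finset.univ \ {j, st n j})).trans (le_of_eq ?_)
  apply Finset.prod_congr rfl
  intro i hi
  simp only [Finset.mem_sdiff, Finset.mem_univ, Finset.mem_insert, Finset.mem_singleton, not_or, true_and] at hi
  have hij : st n i ≠ j := by
    intro h; apply hi.2; rw [← h, st_st]
  have : z i = q' (st n i) - sg n (st n i) * w' i - sg n (st n i) * w' j * s i := by
    rw [hz]
    simp only [Pi.sub_apply, hy]
    rw [hh, hmT_mulVec j s _ _ hij, J_mulVec, st_st, hm_mulVec, if_neg hi.1]
    ring
  rw [this]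

def Kaj (n : ℕ) (a : ℝ) (w : Vv (2*n)) (j : Fin (2*n)) : Set (SL2n n) :=
  Ka (2*n) a ∩ {g | ‖w‖ ≤ (2*n:ℕ) * a * |((g : Mm (2*n)) *ᵥ w) j|}

lemma gw_cont (n : ℕ) (w : Vv (2*n)) (j : Fin (2*n)) : Continuous (fun g : SL2n n => ((g : Mm (2*n)) *ᵥ w) j) :=
  (continuous_apply j).comp ((sl_cont (2*n)).matrix_mulVec continuous_const)

lemma Kaj_meas (n : ℕ) (a : ℝ) (w : Vv (2*n)) (j : Fin (2*n)) : MeasurableSet (Kaj n a w j) := by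
  apply (Ka_meas _ _).inter
  exact (isClosed_le continuous_const (continuous_const.mul (gw_cont n w j).abs)).measurableSet

lemma Ka_sub_Kaj (hn : 0 < n) {a : ℝ} (ha : 0 < a) (w : Vv (2*n)) : Ka (2*n) a ⊆ ⋃ j, Kaj n a w j := by
  intro g hg
  set G := (g : Mm (2*n)) with hG
  have hGG : ((g⁻¹ : SL2n n) : Mm (2*n)) * G = 1 := by
    have : g⁻¹ * g = 1 := inv_mul_cancel g
    exact congrArg (fun x : SL2n n => (x : Mm (2*n))) this
  have h1 : ‖w‖ ≤ (2*n:ℕ) * a * ‖G *ᵥ w‖ := by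
    have := mulVec_bound hg.2 ha.le (G *ᵥ w)
    rwa [mV, hGG, Matrix.one_mulVec] at this
  have : Nonempty (Fin (2*n)) := ⟨⟨0, by omega⟩⟩
  obtain ⟨j, hj⟩ := Finite.exists_max (fun j => |(G *ᵥ w) j|)
  have h2 : ‖G *ᵥ w‖ ≤ |(G *ᵥ w) j| := by
    rw [pN (abs_nonneg _)]
    exact hj
  rw [Set.mem_iUnion]
  refine ⟨j, hg, h1.trans ?_⟩
  gcongr

lemma C1j {a R : ℝ} (ha : 0 < a) (hR : 0 < R) (μ : Measure (SL2n n)) [μ.IsHaarMeasure] (q w : Vv (2*n)) (hw : w ≠ 0) (j : Fin (2*n)) :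
    ∫⁻ g in Kaj n a w j, oR (ker (2*n) (R * ‖q - Ag n g *ᵥ w‖)) ∂μ ≤
    μ (Ka (2*n) ((2*n:ℕ) * (2*a))) * oR ((I1 * (2 * (2*n:ℕ)^3 * a^2) / (R * ‖w‖)) ^ (2*n-2)) := by
  have hn : 0 < ((2*n:ℕ):ℝ) := by exact_mod_cast j.pos
  have hw0 : 0 < ‖w‖ := norm_pos_iff.mpr hw
  set a' : ℝ := (2*n:ℕ) * (2*a) with ha'
  have ha'0 : 0 < a' := by positivity
  set f : SL2n n → ENNReal := fun g => (Kaj n a w j).indicator (fun g => oR (ker (2*n) (R * ‖q - Ag n g *ᵥ w‖))) g with hf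
  have hfc : Continuous (fun g : SL2n n => ker (2*n) (R * ‖q - Ag n g *ᵥ w‖)) :=
    ker_contOn (continuous_const.mul (continuous_const.sub (Ag_cont n w)).norm) (fun x => by positivity)
  have hfm : Measurable f := (hfc.measurable.ennreal_ofReal).indicator (Kaj_meas n a w j)
  have e0 : ∫⁻ g in Kaj n a w j, oR (ker (2*n) (R * ‖q - Ag n g *ᵥ w‖)) ∂μ = ∫⁻ g, f g ∂μ :=
    (lintegral_indicator (Kaj_meas n a w j) _).symm
  have e1 : ∫⁻ g, f g ∂μ = ∫⁻ s, ∫⁻ g, f (hs (2*n) j s * g) ∂μ ∂(cube (2*n)) := by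
    simp_rw [lintegral_mul_left_eq_self f]
    simp
  have hm2 : Measurable (Function.uncurry fun s g => f (hs (2*n) j s * g)) :=
    hfm.comp (((hs_cont j).comp continuous_fst).mul continuous_snd).measurable
  rw [e0, e1, lintegral_lintegral_swap hm2.aemeasurable]
  have hcube : ∀ᵐ s ∂(cube (2*n)), ∀ i, |s i| ≤ 1 := by
    rw [ae_all_iff]
    intro i
    have : ∀ᵐ t ∂(volume.restrict (Set.Icc (0:ℝ) 1)), |t| ≤ 1 := by
      filter_upwards [ae_restrict_mem measurableSet_Icc] with t ht
      rw [abs_le]; constructor <;> linarith [ht.1, ht.2]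
    exact (Measure.quasiMeasurePreserving_eval (μ := fun _ : Fin (2*n) => volume.restrict (Set.Icc (0:ℝ) 1)) i).ae this
  have key : ∀ g, ∫⁻ s, f (hs (2*n) j s * g) ∂(cube (2*n)) ≤ (Ka (2*n) a').indicator (fun _ => oR ((I1 * (2 * (2*n:ℕ)^3 * a^2) / (R * ‖w‖)) ^ (2*n-2))) g := by
    intro g
    by_cases hg : g ∈ Ka (2*n) a' ∧ ‖w‖ ≤ (2*n:ℕ) * a * |((g : Mm (2*n)) *ᵥ w) j|
    · rw [iM hg.1]
      obtain ⟨β, γ, h1, h2⟩ := pert_bound ha'0 hR hg.1 j q w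
      have hc : 0 < ((2*n:ℕ) * a)⁻¹ * ‖w‖ := by positivity
      have := cube_prod (Finset.univ \ {j, st n j}) (R * ((2*n:ℕ) * a')⁻¹) (((2*n:ℕ) * a)⁻¹ * ‖w‖) pz hc β γ (by
        intro i _
        rw [h1, inv_mul_le_iff₀ pz]
        exact hg.2)
      refine (lintegral_mono fun s => ?_).trans (this.trans (le_of_eq ?_))
      · rw [hf]
        refine (Set.indicator_le_self _ _ _).trans ?_
        exact oL (h2 s)
      · have hcard : (Finset.univ \ {j, st n j} : Finset (Fin (2*n))).card = 2*n-2 := by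
          rw [Finset.card_sdiff_of_subset (Finset.subset_univ _), Finset.card_pair (st_ne n j).symm]
          simp
        rw [hcard]
        congr 2
        rw [ha']
        field_simp
    · refine (lintegral_mono_ae (g := fun _ => 0) ?_).trans (by simp)
      filter_upwards [hcube] with s hs1
      rw [nonpos_iff_eq_zero, hf]
      apply iN
      intro hmem
      apply hg
      refine ⟨hs_Ka j s hs1 hmem.1, ?_⟩
      have := hmem.2
      have e : (((hs (2*n) j s * g : SL2n n) : Mm (2*n)) *ᵥ w) j = ((g : Mm (2*n)) *ᵥ w) j := by
        change ((hm (2*n) j s * (g : Mm (2*n))) *ᵥ w) j = _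
        rw [← mV, hm_mulVec_self]
      rw [← e]
      exact this
  refine (lintegral_mono key).trans ?_
  rw [lintegral_indicator_const (Ka_meas _ _), mul_comm]

lemma C1 (hn : 0 < n) {a : ℝ} (ha : 0 < a) (μ : Measure (SL2n n)) [μ.IsHaarMeasure] : ∃ C : ℝ, 0 < C ∧ ∀ R : ℝ, 0 < R → ∀ q w : Vv (2*n), w ≠ 0 →
    ∫⁻ g in Ka (2*n) a, oR (ker (2*n) (R * ‖q - Ag n g *ᵥ w‖)) ∂μ ≤ oR (C * ((R * ‖w‖)⁻¹) ^ (2*n-2)) := by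
  set a' : ℝ := (2*n:ℕ) * (2*a) with ha'
  have hfin : μ (Ka (2*n) a') < ⊤ := (Ka_compact _ _).measure_lt_top
  set c := I1 * (2 * (2*n:ℕ)^3 * a^2)
  have hc : 0 ≤ c := mul_nonneg I1_nonneg pz
  refine ⟨(2*n:ℕ) * ((μ (Ka (2*n) a')).toReal * c ^ (2*n-2)) + 1, by positivity, fun R hR q w hw => ?_⟩
  have hw0 : 0 < ‖w‖ := norm_pos_iff.mpr hw
  refine (lintegral_mono_set (Ka_sub_Kaj hn ha w)).trans ?_
  refine (lintegral_iUnion_le _ _).trans ?_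
  rw [tsum_fintype]
  refine (sL fun j _ => C1j ha hR μ q w hw j).trans ?_
  rw [Finset.sum_const, Finset.card_univ, fF, ← ENNReal.ofReal_toReal hfin.ne, ← oM pz, nsmul_eq_mul, ← ENNReal.ofReal_natCast, ← oM pz]
  apply oL
  rw [dI, mul_pow, add_mul]
  have : 0 ≤ 1 * ((R * ‖w‖)⁻¹) ^ (2*n-2) := by positivity
  have e : ((2*n:ℕ):ℝ) * ((μ (Ka (2*n) a')).toReal * (c ^ (2*n-2) * ((R * ‖w‖)⁻¹) ^ (2*n-2))) = (2*n:ℕ) * ((μ (Ka (2*n) a')).toReal * c ^ (2*n-2)) * ((R * ‖w‖)⁻¹) ^ (2*n-2) := by ring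
  rw [e, ENNReal.toReal_ofReal ENNReal.toReal_nonneg]
  linarith

lemma Ag_bound {a : ℝ} (ha : 0 < a) {g : SL2n n} (hg : g ∈ Ka (2*n) a) (w : Vv (2*n)) :
    ‖Ag n g *ᵥ w‖ ≤ (((2*n:ℕ):ℝ) * a)^2 * ‖w‖ := by
  unfold Ag
  rw [← mV, ← mV]
  refine (mulVec_bound (fun i l => hg.1 l i) ha.le _).trans ?_
  have h1 : ∀ x : Vv (2*n), ‖Jmat n *ᵥ x‖ ≤ ‖x‖ := by
    intro x
    rw [pN (norm_nonneg _)]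
    intro i
    rw [J_mulVec, norm_mul, nA (sg n i), sg_abs, one_mul]
    exact pI x _
  have h2 := (h1 ((g : Mm (2*n)) *ᵥ w)).trans (mulVec_bound hg.1 ha.le w)
  calc _ ≤ ((2*n:ℕ):ℝ) * a * (((2*n:ℕ):ℝ) * a * ‖w‖) := by gcongr
    _ = _ := by ring

lemma ker_scale {r t : ℝ} (hr : 0 < r) (ht : 1 ≤ t) : ker d (r * t) ≤ (2 / r) ^ (2*d) * ker d t := by
  unfold ker
  rw [← inv_pow, ← inv_pow, ← mul_pow]
  gcongr
  rw [inv_le_comm₀ pz pz, mul_inv, inv_inv, inv_div]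
  nlinarith

lemma int_norm_one {q : Fin d → ℤ} (hq : q ≠ 0) : 1 ≤ ‖fun i => (q i : ℝ)‖ := by
  obtain ⟨i, hi⟩ := Function.ne_iff.mp hq
  refine le_trans ?_ (pI _ i)
  rw [nA]
  have := Int.one_le_abs hi
  exact_mod_cast this

def kerT (d : ℕ) : ℝ := ∑' q : Fin d → ℤ, kerS d 1 0 q

lemma countV (d : ℕ) (X : ℝ) (hX0 : 0 ≤ X) : ∃ W : Finset (Fin d → ℤ), (∀ q, q ∈ W ↔ q ≠ 0 ∧ ‖fun i => (q i : ℝ)‖ ≤ X) ∧ (W.card : ℝ) ≤ (3 * X) ^ d := by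
  set V : Finset (Fin d → ℤ) := Fintype.piFinset (fun _ => Finset.Icc (-⌊X⌋) ⌊X⌋) with hV
  have hcard : (((V \ {0}).card : ℕ) : ℝ) ≤ (3 * X) ^ (d) := by
    by_cases hX1 : X < 1
    · have : V \ {0} = ∅ := by
        have h0 : ⌊X⌋ = 0 := by rw [Int.floor_eq_iff]; simp; exact ⟨hX0, hX1⟩
        rw [Finset.sdiff_eq_empty_iff_subset]
        intro q hq
        rw [hV, Fintype.mem_piFinset] at hq
        rw [Finset.mem_singleton]
        ext i
        have := hq i
        rw [h0, Finset.mem_Icc] at this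
        simp at this ⊢
        omega
      rw [this]; simp; positivity
    · push Not at hX1
      have h1 : (V \ {0}).card ≤ V.card := Finset.card_le_card Finset.sdiff_subset
      have h2 : V.card = (2 * ⌊X⌋ + 1).toNat ^ (d) := by
        rw [hV, Fintype.card_piFinset]; simp; congr 1; omega
      have h3 : (((2 * ⌊X⌋ + 1).toNat : ℕ) : ℝ) ≤ 3 * X := by
        have h4 : 0 ≤ ⌊X⌋ := Int.floor_nonneg.mpr hX0
        have h5 : (((2 * ⌊X⌋ + 1).toNat : ℤ)) = 2 * ⌊X⌋ + 1 := Int.toNat_of_nonneg (by omega)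
        have h6 : (((2 * ⌊X⌋ + 1).toNat : ℕ) : ℝ) = 2 * ⌊X⌋ + 1 := by exact_mod_cast h5
        rw [h6]
        linarith [Int.floor_le X]
      calc (((V \ {0}).card : ℕ) : ℝ) ≤ V.card := by exact_mod_cast h1
        _ = (((2 * ⌊X⌋ + 1).toNat : ℕ) : ℝ) ^ (d) := by rw [h2]; push_cast; rfl
        _ ≤ _ := by gcongr
  refine ⟨V \ {0}, fun q => ?_, hcard⟩
  rw [Finset.mem_sdiff, hV, Fintype.mem_piFinset, Finset.mem_singleton, and_comm, pN hX0]
  apply and_congr Iff.rfl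
  apply forall_congr'
  intro i
  rw [Finset.mem_Icc, ← abs_le, Int.le_floor, nA]
  push_cast
  rfl

lemma kerS_contu {ρ : ℝ} (hρ : 0 < ρ) (q : Fin d → ℤ) : Continuous (fun u : Vv d => kerS d ρ u q) := by
  unfold kerS
  split_ifs
  · exact continuous_const
  · apply ker_contOn
    · fun_prop
    · intro u; positivity

lemma kerS_cont {ρ : ℝ} (hρ : 0 < ρ) (m : ℝ) (w : Vv (2*n)) (q : Fin (2*n) → ℤ) : Continuous (fun g : SL2n n => kerS (2*n) ρ (m • (Ag n g *ᵥ w)) q) :=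
  (kerS_contu hρ q).comp ((Ag_cont n w).const_smul m)

lemma pow_canc {x : ℝ} (hx : 0 ≤ x) (hd : 2 ≤ d) : x ^ d * x⁻¹ ^ (d-2) ≤ x ^ 2 := by
  obtain ⟨e, rfl⟩ := Nat.exists_eq_add_of_le hd
  rw [pow_add, Nat.add_sub_cancel_left, mul_assoc, ← mul_pow]
  by_cases hw : x = 0
  · simp [hw]
  · rw [mul_inv_cancel₀ hw]; simp

lemma C2 (hn : 0 < n) {a : ℝ} (ha : 0 < a) (μ : Measure (SL2n n)) [μ.IsHaarMeasure] : ∃ C : ℝ, 0 < C ∧ ∀ R : ℝ, 0 < R → ∀ m : ℕ, 0 < m → ∀ w : Vv (2*n),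
    ∫⁻ g in Ka (2*n) a, ∑' q : Fin (2*n) → ℤ, oR (kerS (2*n) (R/m) ((m:ℝ) • (Ag n g *ᵥ w)) q) ∂μ ≤
      oR (C * (m ^ (2*n) * ‖w‖^2 * R⁻¹ ^ (2*n-2) + (m / R) ^ (2*(2*n)))) := by
  obtain ⟨C, hC, hC1⟩ := C1 hn ha μ
  have hnr : 0 < ((2*n:ℕ):ℝ) := by exact_mod_cast (by omega : 0 < 2*n)
  set a₂ : ℝ := (((2*n:ℕ):ℝ) * a)^2 with ha₂
  have ha₂0 : 0 < a₂ := by positivity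
  set K := Ka (2*n) a with hK
  have hfin : μ K < ⊤ := (Ka_compact _ _).measure_lt_top
  have hkT : 0 ≤ kerT (2*n) := tsum_nonneg (kerS_nonneg one_pos 0)
  refine ⟨C * (6 * a₂) ^ (2*n) + (μ K).toReal * 4 ^ (2*(2*n)) * kerT (2*n), by positivity, fun R hR m hm w => ?_⟩
  have hmr : (0:ℝ) < m := by exact_mod_cast hm
  set X : ℝ := 2 * a₂ * m * ‖w‖ with hX
  have hX0 : 0 ≤ X := by positivity
  obtain ⟨V, hV, hcard⟩ := countV (2*n) X hX0
  rw [lintegral_tsum]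
  swap
  · intro q
    exact (kerS_cont pz _ w q).measurable.ennreal_ofReal.aemeasurable
  have hterm : ∀ q : Fin (2*n) → ℤ, ∫⁻ g in K, oR (kerS (2*n) (R/m) ((m:ℝ) • (Ag n g *ᵥ w)) q) ∂μ ≤
      (if q ∈ V then oR (C * ((R * ‖w‖)⁻¹) ^ (2*n-2)) else 0) + μ K * oR ((4 * m / R) ^ (2*(2*n)) * kerS (2*n) 1 0 q) := by
    intro q
    by_cases hq : q = 0
    · have : ∀ u, kerS (2*n) (R/m) u q = 0 := fun u => if_pos hq
      simp_rw [this]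
      simp
    by_cases hqV : q ∈ V
    · rw [if_pos hqV]
      refine le_add_right ?_
      have hw : w ≠ 0 := by
        rintro rfl
        have h3 := ((hV q).mp hqV).2
        have h4 := int_norm_one hq
        have : X = 0 := by simp [hX]
        linarith
      refine le_trans (le_of_eq ?_) (hC1 R hR (fun i => q i / m) w hw)
      congr 1; ext g
      unfold kerS
      rw [if_neg hq]
      congr 2
      have : (fun i => (q i : ℝ)) - (m:ℝ) • Ag n g *ᵥ w = (m:ℝ) • ((fun i => (q i : ℝ) / m) - Ag n g *ᵥ w) := by
        rw [smul_sub]; congr 1; ext i; simp; field_simp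
      rw [this, norm_smul, rN hmr.le]
      field_simp
    · rw [if_neg hqV, zero_add, mul_comm (μ K), ← setLIntegral_const]
      refine setLIntegral_mono' (Ka_meas _ _) fun g hg => ?_
      apply oL
      unfold kerS
      rw [if_neg hq, if_neg hq, sub_zero, one_mul]
      set Q : Vv (2*n) := fun i => (q i : ℝ) with hQ
      have h1 := Ag_bound ha hg w
      have h2 : X < ‖Q‖ := by
        by_contra hcon
        push Not at hcon
        exact hqV ((hV q).mpr ⟨hq, hcon⟩)
      have h3 : ‖Q‖ / 2 ≤ ‖Q - (m:ℝ) • Ag n g *ᵥ w‖ := by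
        have h4 := norm_sub_norm_le Q ((m:ℝ) • Ag n g *ᵥ w)
        rw [norm_smul, rN hmr.le] at h4
        have h5 : (m:ℝ) * ‖Ag n g *ᵥ w‖ ≤ X / 2 := by
          calc _ ≤ (m:ℝ) * (a₂ * ‖w‖) := by gcongr
            _ = _ := by rw [hX]; ring
        linarith
      have h6 := ker_scale (d := 2*n) (r := R / m / 2) pz (int_norm_one hq)
      calc _ ≤ ker (2*n) (R / m / 2 * ‖Q‖) := by
            apply ker_anti pz
            calc R / m / 2 * ‖Q‖ = R / m * (‖Q‖ / 2) := by ring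
              _ ≤ _ := by gcongr
        _ ≤ _ := h6
        _ = _ := by congr 2; field_simp; norm_num
  refine (ENNReal.tsum_le_tsum hterm).trans ?_
  rw [ENNReal.tsum_add, ENNReal.tsum_mul_left, tsum_eq_sum (s := V) (by intro q hq; rw [if_neg hq]), sC rfl (fun q hq => if_pos hq), Finset.sum_const]
  rw [← ENNReal.ofReal_tsum_of_nonneg (fun q => mul_nonneg pz (kerS_nonneg one_pos 0 q)) ((kerS_summable 1 one_pos 0).mul_left _), tsum_mul_left]
  change _ + _ * oR (_ * kerT (2*n)) ≤ _
  rw [nsmul_eq_mul, ← ENNReal.ofReal_natCast, ← oM pz, ← ENNReal.ofReal_toReal hfin.ne, ← oM pz, ← ENNReal.ofReal_add pz pz, ENNReal.toReal_ofReal ENNReal.toReal_nonneg]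
  apply oL
  have hA : ((V).card : ℝ) * (C * ((R * ‖w‖)⁻¹) ^ (2*n-2)) ≤ C * (6 * a₂) ^ (2*n) * (m ^ (2*n) * ‖w‖^2 * R⁻¹ ^ (2*n-2)) := by
    calc _ ≤ (3 * X) ^ (2*n) * (C * ((R * ‖w‖)⁻¹) ^ (2*n-2)) := by gcongr
      _ = C * (6 * a₂) ^ (2*n) * (m ^ (2*n) * (‖w‖^(2*n) * ‖w‖⁻¹ ^ (2*n-2)) * R⁻¹ ^ (2*n-2)) := by
        rw [hX, mul_inv, mul_pow R⁻¹]
        ring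
      _ ≤ _ := by
        gcongr
        exact pow_canc (norm_nonneg w) (by omega)
  have hB : (μ K).toReal * ((4 * m / R) ^ (2*(2*n)) * kerT (2*n)) = (μ K).toReal * 4 ^ (2*(2*n)) * kerT (2*n) * (m / R) ^ (2*(2*n)) := by
    rw [mul_div_assoc, mul_pow]; ring
  rw [hB]
  have p1 : 0 ≤ (m:ℝ) ^ (2*n) * ‖w‖^2 * R⁻¹ ^ (2*n-2) := by positivity
  have p2 : 0 ≤ ((m:ℝ) / R) ^ (2*(2*n)) := by positivity
  have p3 : 0 ≤ C * (6 * a₂) ^ (2*n) := by positivity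
  have p4 : 0 ≤ (μ K).toReal * 4 ^ (2*(2*n)) * kerT (2*n) := by positivity
  nlinarith [mul_nonneg p3 p2, mul_nonneg p4 p1]

def Mt (d : ℕ) (T : ℝ) : ℕ := ⌈T * (1 + 2 * d)⌉₊

lemma Mt_ge (d : ℕ) (T : ℝ) : T * (1 + 2 * d) ≤ Mt d T := Nat.le_ceil _

lemma Mt_le (d : ℕ) (hT : 1 ≤ T) : (Mt d T : ℝ) ≤ T * (2 + 2 * d) := by
  have := Nat.ceil_lt_add_one (a := T * (1 + 2 * d)) pz
  unfold Mt
  linarith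

def Vt (d : ℕ) (T : ℝ) : Finset (Fin d → ℤ) := Fintype.piFinset (fun _ => Finset.Icc (-(Mt d T : ℤ)) (Mt d T : ℤ))

lemma mem_Vt {v : Fin d → ℤ} : v ∈ Vt d T ↔ ∀ i, |v i| ≤ (Mt d T : ℤ) := by
  unfold Vt; simp [abs_le]

def Fv (d : ℕ) (ε T : ℝ) (y : Vv d) (v : Fin d → ℤ) : ℂ := (phi d ε (fun i => v i / T) : ℂ) * ee (dp (fun i => (v i : ℝ)) y)

def Ih (d : ℕ) (ε T : ℝ) (y : Vv d) : ℂ := ∫ x, (phi d ε (fun i => x i / T) : ℂ) * ee (dp x y)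

lemma phi_Vt (h0 : 0 < ε) (h1 : ε ≤ 1) (hT : 0 < T) {v : Fin d → ℤ} (hv : v ∉ Vt d T) : phi d ε (fun i => v i / T) = 0 := by
  by_contra hne
  apply hv
  rw [mem_Vt]
  intro i
  have := phi_lattice_zero h0 h1 hT (Mt_ge d T) (x := fun i => (v i : ℝ)) hne i
  have h2 : ((|v i| : ℤ) : ℝ) ≤ ((Mt d T : ℤ) : ℝ) := by push_cast; exact this.le
  exact_mod_cast h2

lemma Fv_Vt (h0 : 0 < ε) (h1 : ε ≤ 1) (hT : 0 < T) (y : Vv d) {v : Fin d → ℤ} (hv : v ∉ Vt d T) : Fv d ε T y v = 0 := by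
  unfold Fv; rw [phi_Vt h0 h1 hT hv]; simp

lemma Fv_norm (h0 : 0 < ε) (y : Vv d) (v : Fin d → ℤ) : ‖Fv d ε T y v‖ ≤ 1 := by
  unfold Fv
  rw [norm_mul, ee_norm, mul_one, cN, rN (phi_nonneg h0 _)]
  exact phi_le_one h0 _

def perr (d : ℕ) (ε T : ℝ) (y : Vv d) : ℝ := ∑ m ∈ Finset.Icc 1 (Mt d T), (T / m) ^ d * ∑' q : Fin d → ℤ, kerS d (ε * T / m) ((m:ℝ) • y) q

lemma perr_term_nonneg (d : ℕ) (h0 : 0 < ε) (hT : 0 < T) (y : Vv d) {m : ℕ} (hm : 0 < m) :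
    0 ≤ (T / m) ^ d * ∑' q : Fin d → ℤ, kerS d (ε * T / m) ((m:ℝ) • y) q := by
  have : (0:ℝ) < m := by exact_mod_cast hm
  exact mul_nonneg pz (tsum_nonneg (kerS_nonneg pz _))

lemma det_univ (h0 : 0 < ε) (h1 : ε ≤ 1) (hT : 1 ≤ T) (y : Vv d) :
    ‖∑ v ∈ Vt d T, Fv d ε T y v - Ih d ε T y‖ ≤ volC d * decC d ^ d * perr d ε T y := by
  have hT0 : 0 < T := by linarith
  have hts : ∑' v, Fv d ε T y v = ∑ v ∈ Vt d T, Fv d ε T y v := tsum_eq_sum (fun v hv => Fv_Vt h0 h1 hT0 y hv)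
  rw [← hts]
  refine (poissonPhi h0 h1 hT0 y).trans ?_
  have hM : 1 ≤ Mt d T := by
    have := Mt_ge d T
    have h2 : (1:ℝ) ≤ Mt d T := by
      refine le_trans ?_ this
      have : 0 ≤ T * (2 * d) := by positivity
      linarith
    exact_mod_cast h2
  have := Finset.single_le_sum (f := fun m : ℕ => (T / m) ^ d * ∑' q : Fin d → ℤ, kerS d (ε * T / m) ((m:ℝ) • y) q) (s := Finset.Icc 1 (Mt d T)) (fun m hm => perr_term_nonneg d h0 hT0 y (by simp at hm; omega)) (Finset.mem_Icc.mpr ⟨le_refl 1, hM⟩)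
  simp only [Nat.cast_one, div_one, one_smul] at this
  rw [mul_assoc]
  have hc := decC_one d
  apply mL this
  unfold volC; positivity

lemma moeb_scale (hT : 0 < T) (y : Vv d) {m : ℕ} (hm : 0 < m) :
    ∫ x, (phi d ε (fun i => x i / (T / m)) : ℂ) * ee (dp x ((m:ℝ) • y)) = ((m:ℂ) ^ d)⁻¹ * Ih d ε T y := by
  have hm0 : (0:ℝ) < m := by exact_mod_cast hm
  have := Measure.integral_comp_smul (volume : Measure (Vv d)) (fun x => (phi d ε (fun i => x i / T) : ℂ) * ee (dp x y)) (m:ℝ)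
  unfold Ih
  rw [Module.finrank_fintype_fun_eq_card, fF, abs_of_nonneg pz] at this
  rw [show ((m:ℂ) ^ d)⁻¹ * ∫ x, (phi d ε (fun i => x i / T) : ℂ) * ee (dp x y) = ((m:ℝ) ^ d)⁻¹ • ∫ x, (phi d ε (fun i => x i / T) : ℂ) * ee (dp x y) by simp, ← this]
  congr 1
  ext x
  congr 2
  · congr 2; ext i; simp; field_simp
  · unfold dp; apply sC rfl; intro i _; simp; ring

lemma Fv_scale (hT : 0 < T) (y : Vv d) {m : ℕ} (hm : 0 < m) (v : Fin d → ℤ) :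
    Fv d ε T y ((m:ℤ) • v) = (phi d ε (fun i => v i / (T / m)) : ℂ) * ee (dp (fun i => (v i : ℝ)) ((m:ℝ) • y)) := by
  have hm0 : (0:ℝ) < m := by exact_mod_cast hm
  unfold Fv
  congr 2
  · congr 2; ext i; simp; field_simp
  · unfold dp; apply sC rfl; intro i _; simp; ring

lemma Fv_dvd_sum (h0 : 0 < ε) (h1 : ε ≤ 1) (hT : 0 < T) (y : Vv d) {m : ℕ} (hm : 0 < m) :
    ∑ v ∈ Vt d T, (if ∀ i, (m:ℤ) ∣ v i then Fv d ε T y v else 0) = ∑' v, Fv d ε T y ((m:ℤ) • v) := by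
  have hm0 : (m:ℤ) ≠ 0 := by exact_mod_cast hm.ne'
  have hts : ∑' v, (if ∀ i, (m:ℤ) ∣ v i then Fv d ε T y v else 0) = ∑ v ∈ Vt d T, (if ∀ i, (m:ℤ) ∣ v i then Fv d ε T y v else 0) :=
    tsum_eq_sum (fun v hv => by simp [Fv_Vt h0 h1 hT y hv])
  rw [← hts]
  have hinj : Function.Injective (fun v : Fin d → ℤ => (m:ℤ) • v) := smul_right_injective _ hm0
  rw [← hinj.tsum_eq]
  · congr 1; ext v
    rw [if_pos]
    intro i; simp
  · intro v hv
    have h : ∀ i, (m:ℤ) ∣ v i := by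
      by_contra hc
      simp [hc] at hv
    choose u hu using h
    exact ⟨u, by ext i; simp [hu i]⟩

lemma moeb_sum {v : Fin d → ℤ} (hv : v ∈ Vt d T) (hv0 : v ≠ 0) :
    ∑ m ∈ Finset.Icc 1 (Mt d T), (if ∀ i, (m:ℤ) ∣ v i then ((mb m : ℤ) : ℂ) else 0) = if Finset.univ.gcd v = 1 then 1 else 0 := by
  set g := (Finset.univ.gcd v).natAbs with hg
  have hnn : 0 ≤ Finset.univ.gcd v := by
    have := Finset.normalize_gcd (s := Finset.univ) (f := v)
    rw [← this]; exact Int.nonneg_of_normalize_eq_self (by simp)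
  have hgi : (g : ℤ) = Finset.univ.gcd v := Int.natAbs_of_nonneg hnn
  have hg0 : g ≠ 0 := by
    rw [hg, Int.natAbs_ne_zero]
    intro h
    rw [Finset.gcd_eq_zero_iff] at h
    exact hv0 (funext fun i => h i (Finset.mem_univ i))
  have hgM : g ≤ Mt d T := by
    obtain ⟨i, hi⟩ := Function.ne_iff.mp hv0
    have h2 : (g:ℤ) ∣ v i := hgi ▸ Finset.gcd_dvd (Finset.mem_univ i)
    have h3 := Int.le_of_dvd (abs_pos.mpr hi) ((dvd_abs _ _).mpr h2)
    have := mem_Vt.mp hv i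
    omega
  have hdvd : ∀ m : ℕ, (∀ i, (m:ℤ) ∣ v i) ↔ m ∣ g := by
    intro m
    rw [← Int.natCast_dvd_natCast, hgi, Finset.dvd_gcd_iff]
    simp
  simp_rw [hdvd]
  rw [← Finset.sum_filter]
  have e : Finset.filter (fun m => m ∣ g) (Finset.Icc 1 (Mt d T)) = g.divisors := by
    ext m
    simp only [Finset.mem_filter, Finset.mem_Icc, Nat.mem_divisors]
    constructor
    · rintro ⟨_, h⟩; exact ⟨h, hg0⟩
    · rintro ⟨h, _⟩
      exact ⟨⟨Nat.pos_of_dvd_of_pos h (Nat.pos_of_ne_zero hg0), (Nat.le_of_dvd (Nat.pos_of_ne_zero hg0) h).trans hgM⟩, h⟩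
  rw [e]
  have h5 := ArithmeticFunction.coe_mul_zeta_apply (f := (mb)) (x := g)
  rw [ArithmeticFunction.moebius_mul_coe_zeta] at h5
  rw [← Int.cast_sum, ← h5, ArithmeticFunction.one_apply, ← hgi]
  norm_cast

lemma zeta_moeb (hd : 2 ≤ d) : HasSum (fun m : ℕ => (mb m : ℝ) / (m:ℝ) ^ d) (zetaval d)⁻¹ ∧ 0 < zetaval d ∧ 1 ≤ zetaval d := by
  have hre : 1 < ((d:ℂ)).re := by simp; omega
  have hs := ArithmeticFunction.LSeriesSummable_moebius_iff.mpr hre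
  have hprod := ArithmeticFunction.LSeries_zeta_mul_Lseries_moebius hre
  rw [ArithmeticFunction.LSeries_zeta_eq_riemannZeta hre, zeta_nat_eq_tsum_of_gt_one (by omega)] at hprod
  have hsum : Summable (fun m : ℕ => (1:ℝ) / (m:ℝ)^d) := Real.summable_one_div_nat_pow.mpr (by omega)
  have e1 : ∑' m : ℕ, 1 / (m : ℂ) ^ d = ((zetaval d : ℝ) : ℂ) := by
    have : ∑' m : ℕ, (1:ℝ) / (m:ℝ)^d = zetaval d := by
      rw [hsum.tsum_eq_zero_add]
      unfold zetaval
      rw [Nat.cast_zero, zero_pow (by omega), div_zero, zero_add]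
      push_cast; rfl
    rw [← this]; push_cast; rfl
  have e2 : LSeries.term (fun m => ((mb m : ℤ) : ℂ)) (d:ℂ) = fun m : ℕ => (((mb m : ℝ) / (m:ℝ) ^ d : ℝ) : ℂ) := by
    funext m
    rw [LSeries.term_def]
    split_ifs with h
    · simp [h]
    · push_cast; rw [Complex.cpow_natCast]
  have hs' := hs.hasSum
  unfold LSeries at hprod
  rw [e2] at hs' hprod
  rw [← Complex.ofReal_tsum] at hs' hprod
  rw [Complex.hasSum_ofReal] at hs'
  rw [e1] at hprod
  have hprod' : zetaval d * ∑' m : ℕ, (mb m : ℝ) / (m:ℝ) ^ d = 1 := by exact_mod_cast hprod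
  have hz1 : 1 ≤ zetaval d := by
    unfold zetaval
    have hs2 := (summable_nat_add_iff 1).mpr hsum
    push_cast at hs2
    have := hs2.le_tsum 0 (fun j _ => by positivity)
    simpa using this
  refine ⟨?_, by linarith, hz1⟩
  rw [eq_inv_of_mul_eq_one_right hprod'] at hs'
  exact hs'

def Z2 : ℝ := ∑' m : ℕ, 1 / (m:ℝ) ^ 2

lemma moeb_abs (m : ℕ) : |(mb m : ℝ)| ≤ 1 := by
  have := ArithmeticFunction.abs_moebius_le_one (n := m)
  exact_mod_cast this

lemma pow_tail (e : ℕ) {M x : ℝ} (hM : 0 < M) (hx : M ≤ x) : 1 / x ^ (e + 2) ≤ M⁻¹ ^ e * (1 / x ^ 2) := by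
  have hx0 : 0 < x := hM.trans_le hx
  rw [pow_add, one_div, mul_inv, ← inv_pow, one_div]
  apply mR _ pz
  exact pL pz (inv_anti₀ hM hx) e

lemma tail_gen {f h : ℕ → ℝ} {z c : ℝ} (N : ℕ) (hc : 0 ≤ c) (h1 : HasSum f z) (h2 : Summable h) (h0 : ∀ m, 0 ≤ h m) (hb : ∀ m, N ≤ m → |f m| ≤ c * h m) :
    |∑ m ∈ Finset.range N, f m - z| ≤ c * ∑' m, h m := by
  have h3 := h1.summable.sum_add_tsum_nat_add N
  rw [h1.tsum_eq] at h3
  rw [← h3, sub_add_cancel_left, abs_neg]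
  have hs3 : Summable (fun i : ℕ => h (i + N)) := (summable_nat_add_iff N).mpr h2
  refine (tsum_of_norm_bounded (hs3.mul_left c).hasSum (f := fun i => f (i + N)) (fun i => hb (i + N) (by omega))).trans ?_
  rw [tsum_mul_left]
  apply mL _ hc
  rw [← h2.sum_add_tsum_nat_add N]
  have : 0 ≤ ∑ i ∈ Finset.range N, h i := Finset.sum_nonneg fun i _ => h0 i
  linarith

lemma moeb_tail (e : ℕ) {M : ℕ} (hM : 0 < M) :
    |∑ m ∈ Finset.Icc 1 M, (mb m : ℝ) / (m:ℝ) ^ (e+2) - (zetaval (e+2))⁻¹| ≤ (M:ℝ)⁻¹ ^ e * Z2 := by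
  have hM0 : (0:ℝ) < M := by exact_mod_cast hM
  have e1 : ∑ m ∈ Finset.Icc 1 M, (mb m : ℝ) / (m:ℝ) ^ (e+2) = ∑ m ∈ Finset.range (M+1), (mb m : ℝ) / (m:ℝ) ^ (e+2) := by
    apply Finset.sum_subset
    · intro m hm; rw [Finset.mem_Icc] at hm; rw [Finset.mem_range]; omega
    · intro m hm1 hm2
      rw [Finset.mem_range] at hm1
      rw [Finset.mem_Icc] at hm2
      have : m = 0 := by omega
      subst this
      rw [ArithmeticFunction.map_zero, Int.cast_zero, zero_div]
  rw [e1]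
  unfold Z2
  refine tail_gen (M+1) pz (zeta_moeb (by omega)).1 (Real.summable_one_div_nat_pow.mpr (by omega)) (fun m => by positivity) ?_
  intro m hm
  have hi : (M:ℝ) ≤ (m:ℝ) := Nat.cast_le.mpr (by omega)
  refine le_trans ?_ (pow_tail e hM0 hi)
  rw [abs_div, abs_of_nonneg (a := (m:ℝ)^(e+2)) pz]
  exact div_le_div_of_nonneg_right (moeb_abs _) pz

open Classical in
def Sf (d : ℕ) (L : Set (Fin d → ℤ)) (κ ε T : ℝ) (y : Vv d) : ℂ :=
  ∑ v ∈ Vt d T, (if v ∈ L then Fv d ε T y v else 0) - (κ : ℂ) * Ih d ε T y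

lemma Z2_nonneg : 0 ≤ Z2 := tsum_nonneg fun m => by positivity

def c0 (d : ℕ) : ℝ := volC d * decC d ^ d * (1 + Z2) + (2 + 2 * d)

lemma volC_pos (d : ℕ) : 0 < volC d := by unfold volC; positivity

lemma vd_pos (d : ℕ) : 0 < volC d * decC d ^ d := by
  have := volC_pos d
  have := decC_one d
  positivity

lemma c0_pos (d : ℕ) : 0 < c0 d := by
  have := vd_pos d
  have := Z2_nonneg
  unfold c0; positivity

lemma perr_nonneg (d : ℕ) (h0 : 0 < ε) (hT : 0 < T) (y : Vv d) : 0 ≤ perr d ε T y :=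
  Finset.sum_nonneg fun m hm => perr_term_nonneg d h0 hT y (by simp at hm; omega)

lemma Sf_univ (h0 : 0 < ε) (h1 : ε ≤ 1) (hT : 1 ≤ T) (y : Vv d) :
    ‖Sf d Set.univ 1 ε T y‖ ≤ c0 d * (perr d ε T y + T ^ 2) := by
  have := det_univ h0 h1 hT y
  unfold Sf
  simp only [Set.mem_univ, if_true, Complex.ofReal_one, one_mul]
  refine this.trans ?_
  have hp := perr_nonneg d h0 (by linarith) y (T := T)
  have hv := vd_pos d
  have hz := Z2_nonneg
  have : volC d * decC d ^ d ≤ c0 d := by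
    unfold c0
    nlinarith [mul_nonneg hv.le hz, (Nat.cast_nonneg d : (0:ℝ) ≤ d)]
  calc _ ≤ c0 d * perr d ε T y := mR this hp
    _ ≤ _ := mL (by nlinarith) (c0_pos d).le

lemma prim_sum (h0 : 0 < ε) (h1 : ε ≤ 1) (hT : 0 < T) (y : Vv d) (L : Set (Fin d → ℤ)) (hL : ∀ v, v ∈ L ↔ IsPrimitiveVec v) [DecidablePred (· ∈ L)] :
    ∑ v ∈ Vt d T, (if v ∈ L then Fv d ε T y v else 0) = ∑ m ∈ Finset.Icc 1 (Mt d T), ((mb m : ℤ) : ℂ) * (∑' v, Fv d ε T y ((m:ℤ) • v) - Fv d ε T y 0) := by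
  have hz : (0 : Fin d → ℤ) ∈ Vt d T := by rw [mem_Vt]; intro i; simp
  have e1 : ∀ m ∈ Finset.Icc 1 (Mt d T), ((mb m : ℤ) : ℂ) * (∑' v, Fv d ε T y ((m:ℤ) • v) - Fv d ε T y 0) =
      ∑ v ∈ (Vt d T).erase 0, Fv d ε T y v * (if ∀ i, (m:ℤ) ∣ v i then ((mb m : ℤ) : ℂ) else 0) := by
    intro m hm
    have hm0 : 0 < m := by rw [Finset.mem_Icc] at hm; omega
    rw [← Fv_dvd_sum h0 h1 hT y hm0, ← Finset.add_sum_erase _ _ hz, if_pos (by simp), add_sub_cancel_left, Finset.mul_sum]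
    apply sC rfl
    intro v _
    split_ifs <;> ring
  rw [sC rfl e1, Finset.sum_comm, ← Finset.add_sum_erase _ _ hz]
  have h00 : (0 : Fin d → ℤ) ∉ L := by rw [hL]; intro h; exact h.1 rfl
  rw [if_neg h00, zero_add]
  apply sC rfl
  intro v hv
  rw [Finset.mem_erase] at hv
  rw [← Finset.mul_sum, moeb_sum hv.2 hv.1]
  by_cases hp : v ∈ L
  · rw [if_pos hp, if_pos ((hL v).mp hp).2, mul_one]
  · rw [if_neg hp, if_neg, mul_zero]
    intro h; exact hp ((hL v).mpr ⟨hv.1, h⟩)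

lemma Sf_prim {e : ℕ} (h0 : 0 < ε) (h1 : ε ≤ 1) (hT : 1 ≤ T) (y : Fin (e+2) → ℝ) (L : Set (Fin (e+2) → ℤ)) (hL : ∀ v, v ∈ L ↔ IsPrimitiveVec v) :
    ‖Sf (e+2) L (zetaval (e+2))⁻¹ ε T y‖ ≤ c0 (e+2) * (perr (e+2) ε T y + T ^ 2) := by
  have hT0 : 0 < T := by linarith
  classical
  unfold Sf
  rw [prim_sum h0 h1 hT0 y L hL]
  set M := Mt (e+2) T with hMd
  have hMT : T ≤ (M:ℝ) := by
    refine le_trans ?_ (Mt_ge (e+2) T)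
    have : 0 ≤ T * (2 * ((e+2:ℕ):ℝ)) := by positivity
    linarith
  have hM : 0 < M := by
    have : (0:ℝ) < M := by linarith
    exact_mod_cast this
  have hId : ‖Ih (e+2) ε T y‖ ≤ volC (e+2) * decC (e+2) ^ (e+2) * T ^ (e+2) := phi_int h0 h1 hT0 y
  set W := volC (e+2) * decC (e+2) ^ (e+2) with hW
  have hW0 : 0 < W := vd_pos (e+2)
  have key : ∑ m ∈ Finset.Icc 1 M, ((mb m : ℤ) : ℂ) * (∑' v, Fv (e+2) ε T y ((m:ℤ) • v) - Fv (e+2) ε T y 0) - (((zetaval (e+2))⁻¹ : ℝ) : ℂ) * Ih (e+2) ε T y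
    = ∑ m ∈ Finset.Icc 1 M, ((mb m : ℤ) : ℂ) * ((∑' v, Fv (e+2) ε T y ((m:ℤ) • v) - ((m:ℂ) ^ (e+2))⁻¹ * Ih (e+2) ε T y) - Fv (e+2) ε T y 0)
     + ((∑ m ∈ Finset.Icc 1 M, (mb m : ℝ) / (m:ℝ) ^ (e+2) - (zetaval (e+2))⁻¹ : ℝ) : ℂ) * Ih (e+2) ε T y := by
    rw [Complex.ofReal_sub, Complex.ofReal_sum, sub_mul, Finset.sum_mul, ← add_sub_assoc, ← Finset.sum_add_distrib]
    congr 1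
    apply sC rfl
    intro m _
    push_cast
    ring
  rw [key]
  refine (norm_add_le _ _).trans ?_
  have b1 : ‖∑ m ∈ Finset.Icc 1 M, ((mb m : ℤ) : ℂ) * ((∑' v, Fv (e+2) ε T y ((m:ℤ) • v) - ((m:ℂ) ^ (e+2))⁻¹ * Ih (e+2) ε T y) - Fv (e+2) ε T y 0)‖ ≤ W * perr (e+2) ε T y + M := by
    have : W * perr (e+2) ε T y + M = ∑ m ∈ Finset.Icc 1 M, (W * ((T / m) ^ (e+2) * ∑' q : Fin (e+2) → ℤ, kerS (e+2) (ε * T / m) ((m:ℝ) • y) q) + 1) := by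
      rw [Finset.sum_add_distrib, ← Finset.mul_sum]
      unfold perr
      simp [hMd]
    rw [this]
    apply norm_sum_le_of_le
    intro m hm
    have hm0 : 0 < m := by rw [Finset.mem_Icc] at hm; omega
    have hmr : (0:ℝ) < m := by exact_mod_cast hm0
    rw [norm_mul]
    have hmu : ‖((mb m : ℤ) : ℂ)‖ ≤ 1 := by
      have := moeb_abs m
      rw [← Complex.ofReal_intCast, cN]; exact this
    refine (mul_le_of_le_one_left (norm_nonneg _) hmu).trans ((norm_sub_le _ _).trans (add_le_add ?_ (Fv_norm h0 y 0)))
    have hp := poissonPhi h0 h1 (div_pos hT0 hmr) ((m:ℝ) • y)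
    rw [moeb_scale hT0 y hm0] at hp
    simp_rw [← Fv_scale hT0 y hm0] at hp
    refine hp.trans_eq ?_
    rw [← mul_div_assoc, ← mul_assoc, hW]
  have b2 : ‖((∑ m ∈ Finset.Icc 1 M, (mb m : ℝ) / (m:ℝ) ^ (e+2) - (zetaval (e+2))⁻¹ : ℝ) : ℂ) * Ih (e+2) ε T y‖ ≤ W * Z2 * T^2 := by
    rw [norm_mul, cN, nA]
    have ht := moeb_tail e hM
    calc _ ≤ ((M:ℝ)⁻¹ ^ e * Z2) * (W * T ^ (e+2)) := mul_le_mul ht hId (norm_nonneg _) (mul_nonneg pz Z2_nonneg)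
      _ ≤ (T⁻¹ ^ e * Z2) * (W * T ^ (e+2)) := by
        apply mR _ pz
        apply mR _ Z2_nonneg
        exact pL pz (inv_anti₀ hT0 hMT) e
      _ = W * Z2 * T^2 := by rw [pow_add, inv_pow]; field_simp
  refine (add_le_add b1 b2).trans ?_
  have hp := perr_nonneg (e+2) h0 hT0 y
  have hMl : (M:ℝ) ≤ T * (2 + 2 * ((e+2 : ℕ):ℝ)) := Mt_le (e+2) hT
  have hz := Z2_nonneg
  have hTT : T ≤ T^2 := by nlinarith
  have hM2 : (M:ℝ) ≤ (2 + 2 * ((e+2 : ℕ):ℝ)) * T^2 := hMl.trans (by rw [mul_comm]; exact mL hTT pz)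
  unfold c0
  rw [← hW]
  generalize (2 + 2 * ((e+2 : ℕ):ℝ)) = D at hM2 hMl
  have hD : 0 ≤ D := by nlinarith
  generalize perr (e+2) ε T y = p at *
  have : 0 ≤ W * Z2 * p := by positivity
  have : 0 ≤ D * p := by positivity
  have : 0 ≤ W * T^2 := by positivity
  nlinarith

def Dprop (n : ℕ) (L : Set (Fin (2*n) → ℤ)) (κ : ℝ) : Prop :=
  ∀ a : ℝ, 1 ≤ a → ∀ μ : Measure (SL2n n), μ.IsHaarMeasure → ∃ C > (0:ℝ), ∀ ε > (0:ℝ), ε ≤ 1 → ∀ T ≥ (1:ℝ), ∀ w : Vv (2*n),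
    ∫⁻ g in Ka (2*n) a, oR ‖Sf (2*n) L κ ε T (Ag n g *ᵥ w)‖ ∂μ ≤ oR (C * ε⁻¹ ^ (2*(2*n)) * T^3 * (1+‖w‖)^2)

lemma perr_real (hd : 2 ≤ d) {ε T x : ℝ} (h0 : 0 < ε) (h1 : ε ≤ 1) (hT : 1 ≤ T) (hx : 0 ≤ x) {m : ℕ} (hm : 0 < m) (hmM : m ≤ Mt d T) :
    (T / m) ^ d * (m ^ d * x^2 * (ε * T)⁻¹ ^ (d-2) + (m / (ε * T)) ^ (2*d)) ≤ (2+2*d)^d * (ε⁻¹ ^ (2*d) * T^2 * (1+x)^2) := by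
  have hmr : (0:ℝ) < m := by exact_mod_cast hm
  have hT0 : 0 < T := by linarith
  have hmT : (m:ℝ) ≤ T * (2+2*d) := le_trans (by exact_mod_cast hmM) (Mt_le d hT)
  have hε : 1 ≤ ε⁻¹ := (one_le_inv₀ h0).mpr h1
  have hd1 : (1:ℝ) ≤ (2+2*d)^d := oP (by have : (0:ℝ) ≤ d := Nat.cast_nonneg d; linarith)
  obtain ⟨e, rfl⟩ : ∃ e, d = e + 2 := ⟨d-2, by omega⟩
  rw [mul_add]
  have a1 : (T / m) ^ (e+2) * (m ^ (e+2) * x^2 * (ε * T)⁻¹ ^ (e+2-2)) = T^2 * x^2 * ε⁻¹ ^ e := by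
    rw [Nat.add_sub_cancel, div_pow, inv_pow, mul_pow, pow_add T, inv_pow]; field_simp
  have a2 : (T / m) ^ (e+2) * (m / (ε * T)) ^ (2*(e+2)) = (m/T)^(e+2) * ε⁻¹ ^ (2*(e+2)) := by
    rw [two_mul, pow_add ((m:ℝ) / (ε * T)) (e+2), pow_add ε⁻¹ (e+2) (e+2), div_pow, div_pow, mul_pow, div_pow, inv_pow]; field_simp
  rw [a1, a2]
  have b1 : ε⁻¹ ^ e ≤ ε⁻¹ ^ (2*(e+2)) := pow_le_pow_right₀ hε (by omega)
  have b2 : ((m:ℝ)/T)^(e+2) ≤ (2+2*((e+2:ℕ):ℝ))^(e+2) := by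
    apply pL pz
    rw [div_le_iff₀ hT0]; linarith
  generalize (2+2*((e+2:ℕ):ℝ))^(e+2) = D at *
  generalize ε⁻¹ ^ (2*(e+2)) = E at *
  have hE : 0 ≤ E := le_trans pz b1
  have hT2 : 1 ≤ T^2 := oP hT
  calc T^2 * x^2 * ε⁻¹ ^ e + (m/T)^(e+2) * E ≤ T^2 * x^2 * E + D * E := by gcongr
    _ ≤ T^2 * x^2 * (D * E) + T^2 * (D * E) := by
      have : E ≤ D * E := le_mul_of_one_le_left hE hd1
      have h3 : T^2 * x^2 * E ≤ T^2 * x^2 * (D * E) := mL this pz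
      have h4 : D * E ≤ T^2 * (D*E) := le_mul_of_one_le_left (hE.trans this) hT2
      linarith
    _ ≤ D * (E * T^2 * (1+x)^2) := by
      have : 0 ≤ D * E * T^2 * (2*x) := by
        have : 0 ≤ D := by linarith
        positivity
      nlinarith

lemma perr_avg (hn : 0 < n) {a : ℝ} (ha : 0 < a) (μ : Measure (SL2n n)) [μ.IsHaarMeasure] : ∃ C > (0:ℝ), ∀ ε > (0:ℝ), ε ≤ 1 → ∀ T ≥ (1:ℝ), ∀ w : Vv (2*n),
    ∫⁻ g in Ka (2*n) a, oR (perr (2*n) ε T (Ag n g *ᵥ w)) ∂μ ≤ oR (C * (ε⁻¹ ^ (2*(2*n)) * T^3 * (1+‖w‖)^2)) := by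
  obtain ⟨C, hC, hC2⟩ := C2 hn ha μ
  refine ⟨C * (2+2*((2*n:ℕ):ℝ))^(2*n+1), by positivity, ?_⟩
  intro ε h0 h1 T hT w
  have hT0 : 0 < T := by linarith
  have hpos : 0 < ε * T := by positivity
  have hme : ∀ m ∈ Finset.Icc 1 (Mt (2*n) T), (0:ℝ) < m := by
    intro m hm; rw [Finset.mem_Icc] at hm; exact_mod_cast hm.1
  have e1 : ∀ g : SL2n n, oR (perr (2*n) ε T (Ag n g *ᵥ w)) = ∑ m ∈ Finset.Icc 1 (Mt (2*n) T), oR ((T/m)^(2*n)) * ∑' q, oR (kerS (2*n) (ε * T/m) ((m:ℝ) • (Ag n g *ᵥ w)) q) := by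
    intro g
    unfold perr
    rw [ENNReal.ofReal_sum_of_nonneg]
    · apply sC rfl
      intro m hm
      have := hme m hm
      rw [oM pz, ENNReal.ofReal_tsum_of_nonneg (kerS_nonneg pz _) (kerS_summable _ pz _)]
    · intro m hm
      have := hme m hm
      exact perr_term_nonneg _ h0 hT0 _ (by exact_mod_cast this)
  simp_rw [e1]
  have hmeas : ∀ m ∈ Finset.Icc 1 (Mt (2*n) T), Measurable fun g : SL2n n => ∑' q, oR (kerS (2*n) (ε * T/m) ((m:ℝ) • (Ag n g *ᵥ w)) q) := by
    intro m hm
    have := hme m hm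
    apply Measurable.tsum
    intro q
    apply ENNReal.measurable_ofReal.comp
    exact (kerS_cont pz _ _ _).measurable
  rw [lintegral_finsetSum' _ (fun m hm => ((hmeas m hm).const_mul _).aemeasurable)]
  have b : ∀ m ∈ Finset.Icc 1 (Mt (2*n) T), ∫⁻ g in Ka (2*n) a, oR ((T/m)^(2*n)) * ∑' q, oR (kerS (2*n) (ε * T/m) ((m:ℝ) • (Ag n g *ᵥ w)) q) ∂μ
      ≤ oR (C * ((2+2*((2*n:ℕ):ℝ))^(2*n) * (ε⁻¹ ^ (2*(2*n)) * T^2 * (1+‖w‖)^2))) := by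
    intro m hm
    have h := hme m hm
    rw [lintegral_const_mul _ (hmeas m hm)]
    refine (mul_le_mul_right (hC2 (ε*T) hpos m (by exact_mod_cast h) w) _).trans ?_
    rw [← oM pz]
    apply oL
    rw [mul_left_comm]
    apply mL _ hC.le
    rw [Finset.mem_Icc] at hm
    exact perr_real (by omega) h0 h1 hT (norm_nonneg w) hm.1 hm.2
  refine (sL b).trans ?_
  rw [Finset.sum_const, Nat.card_Icc, nsmul_eq_mul, Nat.add_sub_cancel, ← ENNReal.ofReal_natCast, ← oM pz]
  apply oL
  have := Mt_le (2*n) hT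
  calc _ ≤ (T * (2+2*((2*n:ℕ):ℝ))) * (C * ((2+2*((2*n:ℕ):ℝ))^(2*n) * (ε⁻¹ ^ (2*(2*n)) * T^2 * (1+‖w‖)^2))) := mR this pz
    _ = _ := by rw [pow_succ _ (2*n)]; ring

lemma Dprop_of (hn : 0 < n) (L : Set (Fin (2*n) → ℤ)) (κ : ℝ)
    (H : ∀ ε > (0:ℝ), ε ≤ 1 → ∀ T ≥ (1:ℝ), ∀ y : Vv (2*n), ‖Sf (2*n) L κ ε T y‖ ≤ c0 (2*n) * (perr (2*n) ε T y + T ^ 2)) : Dprop n L κ := by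
  intro a ha μ hμ
  obtain ⟨C, hC, hC2⟩ := perr_avg hn (by linarith : 0 < a) μ
  have hc0 := c0_pos (2*n)
  have hfin : μ (Ka (2*n) a) ≠ ⊤ := (Ka_compact _ _).measure_lt_top.ne
  refine ⟨c0 (2*n) * (C + (μ (Ka (2*n) a)).toReal), by positivity, ?_⟩
  intro ε h0 h1 T hT w
  have hT0 : 0 < T := by linarith
  have hε : 1 ≤ ε⁻¹ := (one_le_inv₀ h0).mpr h1
  calc _ ≤ ∫⁻ g in Ka (2*n) a, oR (c0 (2*n)) * (oR (perr (2*n) ε T (Ag n g *ᵥ w)) + oR (T^2)) ∂μ := by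
        apply lintegral_mono
        intro g
        dsimp only
        rw [← ENNReal.ofReal_add (perr_nonneg _ h0 hT0 _) pz, ← oM hc0.le]
        exact oL (H ε h0 h1 T hT _)
    _ = oR (c0 (2*n)) * (∫⁻ g in Ka (2*n) a, oR (perr (2*n) ε T (Ag n g *ᵥ w)) ∂μ + oR (T^2) * μ (Ka (2*n) a)) := by
        rw [lintegral_const_mul' _ _ ENNReal.ofReal_ne_top, lintegral_add_right _ measurable_const, setLIntegral_const]
    _ ≤ oR (c0 (2*n)) * (oR (C * (ε⁻¹ ^ (2*(2*n)) * T^3 * (1+‖w‖)^2)) + oR (T^2) * oR (μ (Ka (2*n) a)).toReal) := by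
        rw [ENNReal.ofReal_toReal hfin]
        gcongr
        exact hC2 ε h0 h1 T hT w
    _ = oR (c0 (2*n) * (C * (ε⁻¹ ^ (2*(2*n)) * T^3 * (1+‖w‖)^2) + T^2 * (μ (Ka (2*n) a)).toReal)) := by
        rw [← oM pz, ← ENNReal.ofReal_add pz pz, ← oM hc0.le]
    _ ≤ _ := by
        apply oL
        rw [show c0 (2*n) * (C + (μ (Ka (2*n) a)).toReal) * ε⁻¹ ^ (2*(2*n)) * T^3 * (1+‖w‖)^2 = c0 (2*n) * ((C + (μ (Ka (2*n) a)).toReal) * (ε⁻¹ ^ (2*(2*n)) * T^3 * (1+‖w‖)^2)) by ring]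
        apply mL _ hc0.le
        rw [add_mul]
        apply add_le_add le_rfl
        rw [mul_comm]
        apply mL _ ENNReal.toReal_nonneg
        have e1 : 1 ≤ ε⁻¹ ^ (2*(2*n)) := oP hε
        have e2 : 1 ≤ (1+‖w‖)^2 := oP (by have := norm_nonneg w; linarith)
        have e3 : T^2 ≤ T^3 := pow_le_pow_right₀ hT (by omega)
        calc T^2 ≤ 1 * T^3 * 1 := by linarith
          _ ≤ _ := by gcongr

lemma Dprop_univ (hn : 0 < n) : Dprop n Set.univ 1 :=
  Dprop_of hn _ _ fun _ h0 h1 _ hT y => Sf_univ h0 h1 hT y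

lemma Dprop_prim (hn : 0 < n) : Dprop n {v | IsPrimitiveVec v} (zetaval (2*n))⁻¹ := by
  apply Dprop_of hn
  intro ε h0 h1 T hT y
  have key : ∀ d : ℕ, 2 ≤ d → ∀ y : Vv d, ‖Sf d {v | IsPrimitiveVec v} (zetaval d)⁻¹ ε T y‖ ≤ c0 d * (perr d ε T y + T ^ 2) := by
    intro d hd y
    obtain ⟨e, rfl⟩ : ∃ e, d = e + 2 := ⟨d-2, by omega⟩
    exact Sf_prim h0 h1 hT y _ (fun v => Iff.rfl)
  exact key (2*n) (by omega) y

def psi (ε a b s : ℝ) : ℝ := ∫ r in Set.Ioc a b, ε⁻¹ * chi ((s - r) / ε)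
def Psi (ε a b t : ℝ) : ℂ := ∫ r in Set.Ioc a b, chihat (ε * t) * ee (-(t * r))

lemma chie_int (ε s : ℝ) (h0 : 0 < ε) : Integrable (fun r => ε⁻¹ * chi ((s - r) / ε)) ∧ ∫ r, ε⁻¹ * chi ((s - r) / ε) = 1 := by
  constructor
  · exact ((chi_integrable.comp_div h0.ne').comp_sub_left s).const_mul _
  · rw [integral_const_mul, integral_sub_left_eq_self (fun r => chi (r / ε)) volume s, Measure.integral_comp_div, chi_integral, aP h0]
    simp [h0.ne']

lemma chie_nonneg (ε s r : ℝ) (h0 : 0 < ε) : 0 ≤ ε⁻¹ * chi ((s - r) / ε) := mul_nonneg pz (chi_nonneg _)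

lemma psi_nonneg (h0 : 0 < ε) (a b s : ℝ) : 0 ≤ psi ε a b s := integral_nonneg fun r => chie_nonneg ε s r h0

lemma psi_le_one (h0 : 0 < ε) (a b s : ℝ) : psi ε a b s ≤ 1 := by
  rw [← (chie_int ε s h0).2]
  exact setIntegral_le_integral (chie_int ε s h0).1 (eF fun r => chie_nonneg ε s r h0)

lemma psi_eq_one (h0 : 0 < ε) {a b s : ℝ} (ha : a + ε ≤ s) (hb : s ≤ b - ε) : psi ε a b s = 1 := by
  rw [← (chie_int ε s h0).2]
  apply setIntegral_eq_integral_of_forall_compl_eq_zero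
  intro r hr
  rw [chi_supp, mul_zero]
  rw [abs_div, aP h0, lD h0, one_mul]
  by_contra hc
  push Not at hc
  rw [abs_lt] at hc
  apply hr
  constructor <;> linarith

lemma psi_eq_zero (h0 : 0 < ε) {a b s : ℝ} (h : s ≤ a - ε ∨ b + ε ≤ s) : psi ε a b s = 0 := by
  apply setIntegral_eq_zero_of_forall_eq_zero
  intro r hr
  rw [chi_supp, mul_zero]
  rw [abs_div, aP h0, lD h0, one_mul, le_abs]
  rcases h with h | h
  · right; linarith [hr.1]
  · left; linarith [hr.2]

lemma chihat_le_one (t : ℝ) : ‖chihat t‖ ≤ 1 := by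
  unfold chihat
  refine (norm_integral_le_integral_norm _).trans ?_
  rw [← chi_integral]
  apply le_of_eq
  congr 1; ext s
  rw [norm_mul, ee_norm, one_mul, cN, rN (chi_nonneg s)]

lemma chihat_sub_one (t : ℝ) : ‖chihat t - 1‖ ≤ 2 * Real.pi * |t| := by
  have hi : Integrable fun s => (chi s : ℂ) := chi_integrable.ofReal
  have hi2 : Integrable fun s => ee (-(t*s)) * (chi s : ℂ) := by
    apply hi.bdd_mul (c := 1) (by fun_prop)
    exact eF fun s => (ee_norm _).le
  have e1 : (1:ℂ) = ∫ s, (chi s : ℂ) := by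
    rw [integral_complex_ofReal, chi_integral]; simp
  unfold chihat
  rw [e1, ← integral_sub hi2 hi]
  have : 2 * Real.pi * |t| = ∫ s, 2 * Real.pi * |t| * chi s := by rw [integral_const_mul, chi_integral, mul_one]
  rw [this]
  apply norm_integral_le_of_norm_le (chi_integrable.const_mul _)
  apply eF
  intro s
  rw [show ee (-(t*s)) * (chi s : ℂ) - chi s = (ee (-(t*s)) - 1) * chi s by ring, norm_mul, cN, rN (chi_nonneg s)]
  by_cases h : 1 ≤ |s|
  · rw [chi_supp h]; simp
  · apply mR _ (chi_nonneg s)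
    refine (ee_sub_one _).trans ?_
    rw [abs_neg, abs_mul]
    push Not at h
    have := Real.pi_pos
    apply mL _ pz
    exact mO (abs_nonneg _) h.le

lemma Psi_eq (ε a b t : ℝ) : Psi ε a b t = chihat (ε * t) * ∫ r in Set.Ioc a b, ee (-(t * r)) := by
  unfold Psi; rw [integral_const_mul]

lemma Psi_cont (ε a b : ℝ) : Continuous (Psi ε a b) := by
  unfold Psi
  apply continuous_of_dominated (bound := fun _ => 1)
  · intro t; apply cM; fun_prop
  · intro t
    apply eF
    intro r
    rw [norm_mul, ee_norm, mul_one]; exact chihat_le_one _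
  · exact integrable_const _
  · apply eF
    intro r
    have := chihat_cont
    fun_prop

lemma Psi_norm (ε : ℝ) {a b : ℝ} (hab : a ≤ b) (t : ℝ) : ‖Psi ε a b t‖ ≤ (b - a) * ‖chihat (ε * t)‖ := by
  unfold Psi
  refine (norm_setIntegral_le_of_norm_le_const (C := ‖chihat (ε * t)‖) (by simp) ?_).trans_eq ?_
  · intro r _
    rw [norm_mul, ee_norm, mul_one]
  · rw [Measure.real, Real.volume_Ioc, ENNReal.toReal_ofReal (by linarith), mul_comm]

lemma Psi_sub {ε M : ℝ} (h0 : 0 < ε) (h1 : ε ≤ 1) {a b : ℝ} (hab : a ≤ b) (ha : |a| ≤ M) (hb : |b| ≤ M) (t : ℝ) :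
    ‖Psi ε a b t - (b - a : ℝ)‖ ≤ 2 * Real.pi * (1 + M) * |t| * (b - a) := by
  have hv : volume.real (Set.Ioc a b) = b - a := by
    rw [Measure.real, Real.volume_Ioc, ENNReal.toReal_ofReal (by linarith)]
  have e1 : ((b - a : ℝ) : ℂ) = ∫ r in Set.Ioc a b, (1:ℂ) := by
    rw [setIntegral_const, hv]; simp
  unfold Psi
  have hint : IntegrableOn (fun r => chihat (ε * t) * ee (-(t*r))) (Set.Ioc a b) := by
    apply Continuous.integrableOn_Ioc; fun_prop
  rw [e1, ← integral_sub hint (by simp)]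
  refine (norm_setIntegral_le_of_norm_le_const (C := 2 * Real.pi * (1 + M) * |t|) (by simp) ?_).trans_eq (by rw [hv])
  intro r hr
  have hr' : |r| ≤ M := by
    rw [abs_le] at *
    constructor <;> linarith [hr.1, hr.2]
  have hp := Real.pi_pos
  calc _ = ‖(chihat (ε*t) - 1) * ee (-(t*r)) + (ee (-(t*r)) - 1)‖ := by congr 1; ring
    _ ≤ 2 * Real.pi * |ε * t| + 2 * Real.pi * |(-(t*r))| := by
      refine (norm_add_le _ _).trans (add_le_add ?_ (ee_sub_one _))
      rw [norm_mul, ee_norm, mul_one]; exact chihat_sub_one _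
    _ ≤ 2 * Real.pi * |t| + 2 * Real.pi * (|t| * M) := by
      rw [abs_neg, abs_mul, abs_mul, aP h0]
      gcongr
      exact mul_le_of_le_one_left (abs_nonneg _) h1
    _ = _ := by ring

lemma Psi_decay : ∃ C : ℝ, 1 ≤ C ∧ ∀ ε : ℝ, 0 < ε → ε ≤ 1 → ∀ a b : ℝ, a ≤ b → ∀ t, ‖Psi ε a b t‖ ≤ (b - a) * (C * ε⁻¹ ^ 4 * ((1 + |t|) ^ 4)⁻¹) := by
  obtain ⟨C, hC, h⟩ := chihat_decay 4
  refine ⟨C, hC, ?_⟩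
  intro ε h0 h1 a b hab t
  refine (Psi_norm ε hab t).trans ?_
  apply mL _ (by linarith)
  refine (h _).trans ?_
  rw [mul_assoc]
  apply mL _ (by linarith)
  rw [inv_pow, ← mul_inv, ← mul_pow]
  apply inv_anti₀ pz
  apply pL pz
  rw [abs_mul, aP h0]
  nlinarith [abs_nonneg t]

lemma psi_fourier (h0 : 0 < ε) (a b s : ℝ) : (psi ε a b s : ℂ) = ∫ t, Psi ε a b t * ee (t * s) := by
  have e1 : ∀ r, ((ε⁻¹ * chi ((s - r) / ε) : ℝ) : ℂ) = ∫ t, chihat (ε * t) * ee (-(t * r)) * ee (t * s) := by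
    intro r
    have := Measure.integral_comp_mul_left (fun t => chihat t * ee (t * ((s - r) / ε))) ε
    rw [← chi_inversion] at this
    push_cast
    rw [aP pz] at this
    rw [show (ε:ℂ)⁻¹ * (chi ((s - r)/ε) : ℂ) = ε⁻¹ • (chi ((s - r)/ε) : ℂ) by simp, ← this]
    congr 1; ext t
    rw [mul_assoc (chihat _), ← ee_add]
    congr 2
    field_simp; ring
  unfold psi Psi
  rw [← integral_complex_ofReal]
  simp_rw [e1]
  rw [integral_integral_swap]
  · congr 1; ext t
    rw [← integral_mul_const]
  · have hi : Integrable (fun z : ℝ × ℝ => (1:ℂ) * chihat (ε * z.2)) ((volume.restrict (Set.Ioc a b)).prod volume) :=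
      Integrable.mul_prod (f := fun _ : ℝ => (1:ℂ)) (g := fun t => chihat (ε * t)) (integrable_const _) (chihat_integrable.comp_mul_left' h0.ne')
    refine hi.mono ?_ ?_
    · apply cM
      have := chihat_cont
      unfold Function.uncurry
      fun_prop
    · apply eF
      intro z
      simp [Function.uncurry, ee_norm]

def Qf (A : Mm d) (η : Pairs k → ℝ) (X : Fin k → Vv d) : ℝ :=
  ∑ p : Pairs k, η p * dp (X p.1.1) (A *ᵥ X p.1.2)

def wf (l : Fin k) (η : Pairs k → ℝ) (X : Fin k → Vv d) : Vv d :=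
  ∑ p : Pairs k, η p • (if p.1.1 = l then X p.1.2 else if p.1.2 = l then -X p.1.1 else 0)

def cf (A : Mm d) (l : Fin k) (η : Pairs k → ℝ) (X : Fin k → Vv d) : ℝ :=
  ∑ p : Pairs k, if p.1.1 = l ∨ p.1.2 = l then 0 else η p * dp (X p.1.1) (A *ᵥ X p.1.2)

def Skew (A : Mm d) : Prop := ∀ x y : Vv d, dp x (A *ᵥ y) = - dp y (A *ᵥ x)

lemma dp_eq (x y : Vv d) : dp x y = x ⬝ᵥ y := rfl

lemma Qf_update {A : Mm d} (hA : Skew A) (l : Fin k) (η : Pairs k → ℝ) (X : Fin k → Vv d) (x : Vv d) :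
    Qf A η (Function.update X l x) = dp x (A *ᵥ wf l η X) + cf A l η X := by
  unfold Qf wf cf
  rw [Matrix.mulVec_sum, dp_eq, dotProduct_sum, ← Finset.sum_add_distrib]
  apply sC rfl
  rintro ⟨⟨i, j⟩, hij⟩ _
  dsimp only at hij ⊢
  rw [Matrix.mulVec_smul, dotProduct_smul, smul_eq_mul]
  by_cases h1 : i = l
  · subst h1
    rw [if_pos rfl, if_pos (Or.inl rfl), Function.update_self, uN hij.ne', add_zero, dp_eq]
  · by_cases h2 : j = l
    · subst h2
      rw [if_neg h1, if_pos rfl, if_pos (Or.inr rfl), Function.update_self, uN h1, hA, add_zero, Matrix.mulVec_neg, dotProduct_neg, dp_eq]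
    · rw [if_neg h1, if_neg h2, if_neg (by tauto), uN h1, uN h2]
      simp

lemma wf_bound (l : Fin k) (η : Pairs k → ℝ) (X : Fin k → Vv d) : ‖wf l η X‖ ≤ (∑ p, |η p|) * ‖X‖ := by
  unfold wf
  rw [Finset.sum_mul]
  apply norm_sum_le_of_le
  intro p _
  rw [norm_smul, nA]
  apply mL _ (abs_nonneg _)
  split_ifs
  · exact pI X _
  · rw [norm_neg]; exact pI X _
  · simp

@[fun_prop]
lemma Qf_cont (A : Mm d) : Continuous (fun z : (Pairs k → ℝ) × (Fin k → Vv d) => Qf A z.1 z.2) := by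
  unfold Qf dp Matrix.mulVec dotProduct
  fun_prop

lemma wf_cont (l : Fin k) : Continuous (fun z : (Pairs k → ℝ) × (Fin k → Vv d) => wf l z.1 z.2) := by
  unfold wf
  apply continuous_finsetSum
  intro p _
  split_ifs <;> fun_prop

open Classical in
def nud (d : ℕ) (L : Set (Fin d → ℤ)) (ε T : ℝ) : Measure (Vv d) :=
  ∑ v ∈ Vt d T, oR (if v ∈ L then phi d ε (fun i => v i / T) else 0) • Measure.dirac (fun i => (v i : ℝ))

def nuc (d : ℕ) (κ ε T : ℝ) : Measure (Vv d) :=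
  oR κ • volume.withDensity (fun x => oR (phi d ε (fun i => x i / T)))

def mC (d : ℕ) : ℝ := (3 * (2 + 2 * d)) ^ d

def BND (d : ℕ) (T : ℝ) (ν : Measure (Vv d)) : Prop := ν Set.univ ≤ oR (mC d * T ^ d) ∧ ∀ᵐ x ∂ν, ‖x‖ ≤ T * (2 + 2 * d)

lemma BND_fin {ν : Measure (Vv d)} (h : BND d T ν) : IsFiniteMeasure ν := ⟨h.1.trans_lt ENNReal.ofReal_lt_top⟩

lemma phiT_cont (h0 : 0 < ε) (h1 : ε ≤ 1) : Continuous (fun x : Vv d => phi d ε (fun i => x i / T)) :=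
  (phi_cont h0 h1).comp (by fun_prop)

lemma nud_BND (L : Set (Fin d → ℤ)) (h0 : 0 < ε) (hT : 1 ≤ T) : BND d T (nud d L ε T) := by
  classical
  have hM := Mt_le d hT
  constructor
  · unfold nud
    rw [Measure.finsetSum_apply]
    have : ∀ v ∈ Vt d T, (oR (if v ∈ L then phi d ε (fun i => v i / T) else 0) • Measure.dirac (fun i => (v i : ℝ))) Set.univ ≤ 1 := by
      intro v _
      rw [Measure.smul_apply, measure_univ, smul_eq_mul, mul_one]
      rw [← oO]
      apply oL
      split_ifs
      · exact phi_le_one h0 _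
      · exact zero_le_one
    refine (sL this).trans ?_
    rw [Finset.sum_const, nsmul_eq_mul, mul_one, ← ENNReal.ofReal_natCast]
    apply oL
    unfold Vt mC
    rw [Fintype.card_piFinset, Finset.prod_const, Int.card_Icc, Finset.card_univ, fF, Nat.cast_pow, ← mul_pow]
    apply pL pz
    have e : (((Mt d T : ℤ) + 1 - (-(Mt d T : ℤ))).toNat) = 2 * Mt d T + 1 := by omega
    rw [e]
    push_cast
    have : 0 ≤ T * d := by positivity
    linarith
  · unfold nud
    rw [ae_finsetSum_measure_iff]
    intro v hv
    apply Measure.ae_smul_measure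
    rw [ae_dirac_eq]
    rw [Filter.eventually_pure]
    rw [pN pz]
    intro i
    refine le_trans ?_ hM
    rw [nA]
    exact_mod_cast mem_Vt.mp hv i

lemma phiT_zero (h0 : 0 < ε) (h1 : ε ≤ 1) (hT : 0 < T) {x : Vv d} (hx : x ∉ Metric.closedBall (0 : Vv d) (T * (2 + 2 * d))) : phi d ε (fun i => x i / T) = 0 := by
  by_contra hne
  apply hx
  rw [mem_closedBall_zero_iff, pN pz]
  intro i
  have := phi_lattice_zero h0 h1 hT (le_refl _) hne i
  rw [nA]
  linarith

lemma nuc_BND {κ : ℝ} (hκ : κ ≤ 1) (h0 : 0 < ε) (h1 : ε ≤ 1) (hT : 1 ≤ T) : BND d T (nuc d κ ε T) := by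
  have hT0 : 0 < T := by linarith
  constructor
  · unfold nuc
    rw [Measure.smul_apply, withDensity_apply _ MeasurableSet.univ, setLIntegral_univ, smul_eq_mul]
    have hb : ∫⁻ x : Vv d, oR (phi d ε (fun i => x i / T)) ≤ oR (mC d * T ^ d) := by
      calc _ ≤ ∫⁻ x, (Metric.closedBall (0 : Vv d) (T * (2 + 2 * d))).indicator 1 x := by
            apply lintegral_mono
            intro x
            by_cases hx : x ∈ Metric.closedBall (0 : Vv d) (T * (2 + 2 * d))
            · rw [iM hx, Pi.one_apply, ← oO]
              exact oL (phi_le_one h0 _)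
            · dsimp only
              rw [phiT_zero h0 h1 hT0 hx]; simp
        _ ≤ _ := by
          rw [lintegral_indicator_one Metric.isClosed_closedBall.measurableSet, Real.volume_pi_closedBall _ pz, fF]
          apply oL
          unfold mC
          rw [← mul_pow]
          apply pL pz
          have : 0 ≤ T * (2 + 2 * d) := by positivity
          linarith
    calc _ ≤ 1 * oR (mC d * T ^ d) := by
          gcongr
          rw [← oO]; exact oL hκ
      _ = _ := one_mul _
  · unfold nuc
    apply Measure.ae_smul_measure
    rw [ae_withDensity_iff (by exact ((phiT_cont h0 h1).measurable.ennreal_ofReal))]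
    apply eF
    intro x hx
    by_contra hc
    apply hx
    rw [phiT_zero h0 h1 hT0 (by rwa [mem_closedBall_zero_iff])]; simp

lemma nud_ee (L : Set (Fin d → ℤ)) (h0 : 0 < ε) (y : Vv d) [DecidablePred (· ∈ L)] :
    ∫ x, ee (dp x y) ∂(nud d L ε T) = ∑ v ∈ Vt d T, (if v ∈ L then Fv d ε T y v else 0) := by
  unfold nud
  rw [integral_finsetSum_measure]
  · apply sC rfl
    intro v _
    rw [integral_smul_measure, integral_dirac]
    unfold Fv
    by_cases h : v ∈ L
    · simp [h, ENNReal.toReal_ofReal (phi_nonneg h0 _)]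
    · simp [h]
  · intro v _
    apply Integrable.smul_measure _ ENNReal.ofReal_ne_top
    exact integrable_dirac (by simp)

lemma nuc_int {κ : ℝ} (hκ : 0 ≤ κ) (h0 : 0 < ε) (h1 : ε ≤ 1) (f : (Vv d) → ℂ) :
    ∫ x, f x ∂(nuc d κ ε T) = (κ:ℂ) * ∫ x, (phi d ε (fun i => x i / T) : ℂ) * f x := by
  unfold nuc
  rw [integral_smul_measure, integral_withDensity_eq_integral_toReal_smul (by exact ((phiT_cont h0 h1).measurable.ennreal_ofReal)) (eF fun x => ENNReal.ofReal_lt_top)]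
  rw [ENNReal.toReal_ofReal hκ, Complex.real_smul]
  congr 2
  ext x
  rw [ENNReal.toReal_ofReal (phi_nonneg h0 _), Complex.real_smul]

lemma S_eq (L : Set (Fin d → ℤ)) {κ : ℝ} (hκ : 0 ≤ κ) (h0 : 0 < ε) (h1 : ε ≤ 1) (y : Vv d) :
    ∫ x, ee (dp x y) ∂(nud d L ε T) - ∫ x, ee (dp x y) ∂(nuc d κ ε T) = Sf d L κ ε T y := by
  classical
  rw [nud_ee L h0, nuc_int hκ h0 h1]
  unfold Sf Ih
  congr!

lemma Sf_cont (L : Set (Fin d → ℤ)) {κ : ℝ} (hκ : 0 ≤ κ) (hκ1 : κ ≤ 1) (h0 : 0 < ε) (h1 : ε ≤ 1) (hT : 1 ≤ T) : Continuous (Sf d L κ ε T) := by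
  have hd := BND_fin (nud_BND L h0 hT)
  have hc := BND_fin (nuc_BND hκ1 h0 h1 hT (d := d))
  have : Sf d L κ ε T = fun y => ∫ x, ee (dp x y) ∂(nud d L ε T) - ∫ x, ee (dp x y) ∂(nuc d κ ε T) := by
    ext y; rw [S_eq L hκ h0 h1]
  rw [this]
  apply Continuous.sub <;>
  · apply continuous_of_dominated (bound := fun _ => 1)
    · intro y; apply cM; unfold dp; fun_prop
    · intro y; exact eF fun x => (ee_norm _).le
    · exact integrable_const _
    · apply eF; intro x; unfold dp; fun_prop

def ins {E : Type*} (l : Fin (k+1)) (x : E) (X : Fin k → E) : Fin (k+1) → E := Fin.insertNth (α := fun _ => E) l x X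

lemma ins_update {E : Type*} (l : Fin (k+1)) (x z : E) (X : Fin k → E) : ins l x X = Function.update (ins l z X) l x := by
  unfold ins
  rw [Fin.update_insertNth]

lemma ins_cont {E : Type*} [TopologicalSpace E] (l : Fin (k+1)) : Continuous (fun z : E × (Fin k → E) => ins l z.1 z.2) := by
  unfold ins
  exact Continuous.finInsertNth (A := fun _ => E) l continuous_fst continuous_snd

lemma iso_map {E : Type*} [MeasurableSpace E] (H : Fin (k+1) → Measure E) [∀ i, SigmaFinite (H i)] (l : Fin (k+1)) :
    MeasurePreserving (fun z : E × (Fin k → E) => ins l z.1 z.2) ((H l).prod (Measure.pi fun j => H (l.succAbove j))) (Measure.pi H) :=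
  (measurePreserving_piFinSuccAbove H l).symm

lemma iso_emb {E : Type*} [MeasurableSpace E] (l : Fin (k+1)) : MeasurableEmbedding (fun z : E × (Fin k → E) => ins l z.1 z.2) :=
  (MeasurableEquiv.piFinSuccAbove (fun _ => E) l).symm.measurableEmbedding

lemma iso_lint {E : Type*} [MeasurableSpace E] (H : Fin (k+1) → Measure E) [∀ i, SigmaFinite (H i)] (l : Fin (k+1)) (f : (Fin (k+1) → E) → ENNReal) (hf : Measurable f) :
    ∫⁻ X, f X ∂Measure.pi H = ∫⁻ X, ∫⁻ x, f (ins l x X) ∂H l ∂(Measure.pi fun j => H (l.succAbove j)) := by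
  rw [← (iso_map H l).lintegral_comp hf, lintegral_prod_symm]
  exact (hf.comp (iso_map H l).measurable).aemeasurable

lemma iso_int {E : Type*} [MeasurableSpace E] (H : Fin (k+1) → Measure E) [∀ i, SigmaFinite (H i)] (l : Fin (k+1)) (f : (Fin (k+1) → E) → ℂ) (hf : Integrable f (Measure.pi H)) :
    ∫ X, f X ∂Measure.pi H = ∫ X, ∫ x, f (ins l x X) ∂H l ∂(Measure.pi fun j => H (l.succAbove j)) := by
  have := (iso_map H l).integral_comp (iso_emb l) f
  rw [← this, integral_prod_symm]
  exact ((iso_map H l).integrable_comp_emb (iso_emb l)).mpr hf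

def Ef (A : Mm d) (H : Fin k → Measure (Vv d)) (η : Pairs k → ℝ) : ℂ := ∫ X, ee (Qf A η X) ∂Measure.pi H

lemma eeQ_cont (A : Mm d) (η : Pairs k → ℝ) : Continuous (fun X : Fin k → Vv d => ee (Qf A η X)) :=
  ee_cont.comp ((Qf_cont A).comp (by fun_prop : Continuous fun X : Fin k → Vv d => (η, X)))

lemma eeQ_int (A : Mm d) (η : Pairs k → ℝ) (ν : Measure (Fin k → Vv d)) [IsFiniteMeasure ν] : Integrable (fun X => ee (Qf A η X)) ν := by
  refine Integrable.mono' (integrable_const (1:ℝ)) (eeQ_cont A η).aestronglyMeasurable ?_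
  exact eF fun X => (ee_norm _).le

lemma Ef_iso {A : Mm d} (hA : Skew A) (H : Fin (k+1) → Measure (Vv d)) [∀ i, IsFiniteMeasure (H i)] (l : Fin (k+1)) (η : Pairs (k+1) → ℝ) :
    Ef A H η = ∫ X, ee (cf A l η (ins l 0 X)) * ∫ x, ee (dp x (A *ᵥ wf l η (ins l 0 X))) ∂H l ∂(Measure.pi fun j => H (l.succAbove j)) := by
  unfold Ef
  rw [iso_int H l _ (eeQ_int A η _)]
  congr 1; ext X
  rw [← integral_const_mul]
  congr 1; ext x
  rw [ins_update l x 0, Qf_update hA, ee_add, mul_comm]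

lemma hat_cont (ν : Measure (Vv d)) [IsFiniteMeasure ν] : Continuous (fun y : Vv d => ∫ x, ee (dp x y) ∂ν) := by
  apply continuous_of_dominated (bound := fun _ => 1)
  · intro y; apply cM; unfold dp; fun_prop
  · intro y; exact eF fun x => (ee_norm _).le
  · exact integrable_const _
  · apply eF; intro x; unfold dp; fun_prop

lemma hat_bd (ν : Measure (Vv d)) [IsFiniteMeasure ν] (y : Vv d) : ‖∫ x, ee (dp x y) ∂ν‖ ≤ ν.real Set.univ := by
  refine (norm_integral_le_of_norm_le_const (C := 1) (eF fun x => (ee_norm _).le)).trans_eq (one_mul _)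

lemma cf_cont (A : Mm d) (l : Fin k) (η : Pairs k → ℝ) : Continuous (fun X : Fin k → Vv d => cf A l η X) := by
  unfold cf dp Matrix.mulVec dotProduct
  apply continuous_finsetSum
  intro p _
  split_ifs <;> fun_prop

lemma ins0_cont (l : Fin (k+1)) : Continuous (fun X : Fin k → Vv d => ins l 0 X) :=
  (ins_cont l).comp (by fun_prop : Continuous fun X : Fin k → Vv d => ((0 : Vv d), X))

lemma inner_int (A : Mm d) (ν : Measure (Vv d)) [IsFiniteMeasure ν] (l : Fin (k+1)) (η : Pairs (k+1) → ℝ) (H : Measure (Fin k → Vv d)) [IsFiniteMeasure H] :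
    Integrable (fun X => ee (cf A l η (ins l 0 X)) * ∫ x, ee (dp x (A *ᵥ wf l η (ins l 0 X))) ∂ν) H := by
  refine Integrable.mono' (integrable_const (ν.real Set.univ)) ?_ ?_
  · apply cM
    apply Continuous.mul
    · exact ee_cont.comp ((cf_cont A l η).comp (ins0_cont l))
    · apply (hat_cont ν).comp
      apply Continuous.matrix_mulVec continuous_const
      exact (wf_cont l).comp (continuous_const.prodMk (ins0_cont l))
  · apply eF
    intro X
    rw [norm_mul, ee_norm, one_mul]
    exact hat_bd ν _

lemma Ef_step {A : Mm d} (hA : Skew A) (H H' : Fin (k+1) → Measure (Vv d)) [∀ i, IsFiniteMeasure (H i)] [∀ i, IsFiniteMeasure (H' i)] (l : Fin (k+1))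
    (hH : ∀ j, H (l.succAbove j) = H' (l.succAbove j)) (η : Pairs (k+1) → ℝ) :
    oR ‖Ef A H η - Ef A H' η‖ ≤ ∫⁻ X, oR ‖(∫ x, ee (dp x (A *ᵥ wf l η (ins l 0 X))) ∂H l) - ∫ x, ee (dp x (A *ᵥ wf l η (ins l 0 X))) ∂H' l‖ ∂(Measure.pi fun j => H (l.succAbove j)) := by
  rw [Ef_iso hA H l, Ef_iso hA H' l]
  have : (fun j => H' (l.succAbove j)) = fun j => H (l.succAbove j) := by ext1 j; rw [hH j]
  rw [this, ← integral_sub (inner_int A (H l) l η _) (inner_int A (H' l) l η _), ofReal_norm]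
  refine (enorm_integral_le_lintegral_enorm _).trans (lintegral_mono fun X => ?_)
  dsimp only
  rw [← mul_sub, enorm_mul, ← ofReal_norm, ← ofReal_norm, ee_norm, oO, one_mul]

lemma Jmat_tr (n : ℕ) : (Jmat n)ᵀ = - Jmat n := by
  ext i j
  rw [Matrix.transpose_apply, Matrix.neg_apply]
  unfold Jmat
  split_ifs <;> first | omega | simp

lemma Ag_skew (n : ℕ) (g : SL2n n) : Skew (Ag n g) := by
  have h : (Ag n g)ᵀ = - Ag n g := by
    unfold Ag
    rw [Matrix.transpose_mul, Matrix.transpose_mul, Matrix.transpose_transpose, Jmat_tr, Matrix.neg_mul, Matrix.mul_neg, Matrix.mul_assoc]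
  intro x y
  rw [dp_eq, dp_eq, Matrix.dotProduct_mulVec, ← Matrix.mulVec_transpose, h, Matrix.neg_mulVec, neg_dotProduct, dotProduct_comm]

lemma Ag_contM (n : ℕ) : Continuous (fun g : SL2n n => Ag n g) := by
  unfold Ag
  have := sl_cont (2*n)
  exact ((this.matrix_transpose).matrix_mul continuous_const).matrix_mul this

lemma AgMul_cont (n : ℕ) {E : Type*} [TopologicalSpace E] {f : E → Vv (2*n)} (hf : Continuous f) : Continuous (fun z : SL2n n × E => Ag n z.1 *ᵥ f z.2) :=
  Continuous.matrix_mulVec ((Ag_contM n).comp continuous_fst) (hf.comp continuous_snd)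

lemma G_cont (L : Set (Fin (2*n) → ℤ)) {κ : ℝ} (hκ : 0 ≤ κ) (hκ1 : κ ≤ 1) (h0 : 0 < ε) (h1 : ε ≤ 1) (hT : 1 ≤ T) (l : Fin (k+1)) (η : Pairs (k+1) → ℝ) :
    Continuous (fun z : SL2n n × (Fin k → Vv (2*n)) => ‖Sf (2*n) L κ ε T (Ag n z.1 *ᵥ wf l η (ins l 0 z.2))‖) :=
  ((Sf_cont L hκ hκ1 h0 h1 hT).comp (AgMul_cont n ((wf_cont l).comp (continuous_const.prodMk (ins0_cont l))))).norm

def Gf (L : Set (Fin (2*n) → ℤ)) (κ ε T : ℝ) (l : Fin (k+1)) (η : Pairs (k+1) → ℝ) (H : Fin k → Measure (Vv (2*n))) (g : SL2n n) : ENNReal :=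
  ∫⁻ X, oR ‖Sf (2*n) L κ ε T (Ag n g *ᵥ wf l η (ins l 0 X))‖ ∂(Measure.pi H)

lemma G_meas (L : Set (Fin (2*n) → ℤ)) {κ : ℝ} (hκ : 0 ≤ κ) (hκ1 : κ ≤ 1) (h0 : 0 < ε) (h1 : ε ≤ 1) (hT : 1 ≤ T) (l : Fin (k+1)) (η : Pairs (k+1) → ℝ) :
    Measurable (fun z : SL2n n × (Fin k → Vv (2*n)) => oR ‖Sf (2*n) L κ ε T (Ag n z.1 *ᵥ wf l η (ins l 0 z.2))‖) :=
  (G_cont L hκ hκ1 h0 h1 hT l η).measurable.ennreal_ofReal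

lemma Gf_meas (L : Set (Fin (2*n) → ℤ)) {κ : ℝ} (hκ : 0 ≤ κ) (hκ1 : κ ≤ 1) (h0 : 0 < ε) (h1 : ε ≤ 1) (hT : 1 ≤ T) (l : Fin (k+1)) (η : Pairs (k+1) → ℝ) (H : Fin k → Measure (Vv (2*n))) [∀ i, IsFiniteMeasure (H i)] :
    Measurable (Gf L κ ε T l η H) :=
  (G_meas L hκ hκ1 h0 h1 hT l η).lintegral_prod_right'

lemma pi_mass (hT : 0 ≤ T) (H : Fin k → Measure (Vv d)) (hH : ∀ i, BND d T (H i)) : Measure.pi H Set.univ ≤ oR ((mC d * T ^ d) ^ k) := by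
  have := fun i => BND_fin (hH i)
  rw [Measure.pi_univ]
  refine (Finset.prod_le_prod' (fun i _ => (hH i).1)).trans_eq ?_
  rw [Finset.prod_const, Finset.card_univ, fF, ENNReal.ofReal_pow]
  unfold mC; positivity

lemma pi_supp (hT : 0 ≤ T) (H : Fin k → Measure (Vv d)) (hH : ∀ i, BND d T (H i)) : ∀ᵐ X ∂Measure.pi H, ‖X‖ ≤ T * (2 + 2 * d) := by
  have := fun i => BND_fin (hH i)
  have h : ∀ᵐ X ∂Measure.pi H, ∀ i, ‖X i‖ ≤ T * (2 + 2 * d) := by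
    rw [ae_all_iff]
    intro i
    exact Measure.tendsto_eval_ae_ae.eventually (hH i).2
  filter_upwards [h] with X hX
  rw [pN pz]
  exact hX

lemma ins_norm (l : Fin (k+1)) (X : Fin k → Vv d) : ‖ins l 0 X‖ ≤ ‖X‖ := by
  rw [pN (norm_nonneg _)]
  intro i
  unfold ins
  rcases Fin.eq_self_or_eq_succAbove l i with h | ⟨j, h⟩
  · subst h; simp
  · subst h; simp only [Fin.insertNth_apply_succAbove]; exact pI X j

def Cst (n k : ℕ) : ℝ := (2 + 2 * ((2*n:ℕ):ℝ))^2 * mC (2*n) ^ k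

lemma Gf_avg (L : Set (Fin (2*n) → ℤ)) {κ : ℝ} (hκ : 0 ≤ κ) (hκ1 : κ ≤ 1) {a C : ℝ} (hC0 : 0 < C) (μ : Measure (SL2n n)) [μ.IsHaarMeasure]
    (hC : ∀ ε > (0:ℝ), ε ≤ 1 → ∀ T ≥ (1:ℝ), ∀ w : Vv (2*n),
    ∫⁻ g in Ka (2*n) a, oR ‖Sf (2*n) L κ ε T (Ag n g *ᵥ w)‖ ∂μ ≤ oR (C * ε⁻¹ ^ (2*(2*n)) * T^3 * (1+‖w‖)^2))
    {ε T : ℝ} (h0 : 0 < ε) (h1 : ε ≤ 1) (hT : 1 ≤ T) (l : Fin (k+1)) (η : Pairs (k+1) → ℝ) (H : Fin k → Measure (Vv (2*n))) (hH : ∀ i, BND (2*n) T (H i)) :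
    ∫⁻ g in Ka (2*n) a, Gf L κ ε T l η H g ∂μ ≤ oR (C * Cst n k * ε⁻¹ ^ (2*(2*n)) * T^(2*n*k+5) * (1+∑ p, |η p|)^2) := by
  have := fun i => BND_fin (hH i)
  have hT0 : 0 < T := by linarith
  unfold Gf
  rw [lintegral_lintegral_swap (G_meas L hκ hκ1 h0 h1 hT l η).aemeasurable]
  have hs : 0 ≤ ∑ p, |η p| := Finset.sum_nonneg fun _ _ => abs_nonneg _
  have hb : ∀ᵐ X ∂Measure.pi H, ∫⁻ g in Ka (2*n) a, oR ‖Sf (2*n) L κ ε T (Ag n g *ᵥ wf l η (ins l 0 X))‖ ∂μ ≤ oR (C * ε⁻¹ ^ (2*(2*n)) * T^3 * (T * (2 + 2 * ((2*n:ℕ):ℝ)) * (1 + ∑ p, |η p|))^2) := by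
    filter_upwards [pi_supp hT0.le H hH] with X hX
    refine (hC ε h0 h1 T hT _).trans (oL ?_)
    apply mL _ pz
    apply pL pz
    have h2 := (wf_bound l η (ins l 0 X)).trans (mL ((ins_norm l X).trans hX) hs)
    have h3 : 1 ≤ T * (2 + 2 * ((2*n:ℕ):ℝ)) := by
      have : 0 ≤ T * (2 * ((2*n:ℕ):ℝ)) := by positivity
      linarith
    linarith
  refine (lintegral_mono_ae hb).trans ?_
  rw [lintegral_const]
  refine (mul_le_mul_right (pi_mass hT0.le H hH) _).trans ?_
  rw [← oM pz]
  apply oL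
  apply le_of_eq
  unfold Cst
  rw [mul_pow (mC _), ← pow_mul]
  ring

def Hm (d : ℕ) (L : Set (Fin d → ℤ)) (κ ε T : ℝ) (k m : ℕ) (l : Fin k) : Measure (Vv d) :=
  if (l:ℕ) < m then nud d L ε T else nuc d κ ε T

lemma Hm_BND (L : Set (Fin d → ℤ)) {κ : ℝ} (hκ1 : κ ≤ 1) (h0 : 0 < ε) (h1 : ε ≤ 1) (hT : 1 ≤ T) (k m : ℕ) (l : Fin k) : BND d T (Hm d L κ ε T k m l) := by
  unfold Hm
  split_ifs
  · exact nud_BND L h0 hT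
  · exact nuc_BND hκ1 h0 h1 hT

lemma Hm_step (L : Set (Fin (2*n) → ℤ)) {κ : ℝ} (hκ : 0 ≤ κ) (hκ1 : κ ≤ 1) (h0 : 0 < ε) (h1 : ε ≤ 1) (hT : 1 ≤ T) (k : ℕ) (l : Fin (k+1)) (η : Pairs (k+1) → ℝ) (g : SL2n n) :
    oR ‖Ef (Ag n g) (Hm (2*n) L κ ε T (k+1) (l+1)) η - Ef (Ag n g) (Hm (2*n) L κ ε T (k+1) l) η‖ ≤ Gf L κ ε T l η (fun j => Hm (2*n) L κ ε T (k+1) (l+1) (l.succAbove j)) g := by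
  have i1 := fun i => BND_fin (Hm_BND L hκ1 h0 h1 hT (k+1) (l+1) i)
  have i2 := fun i => BND_fin (Hm_BND L hκ1 h0 h1 hT (k+1) l i)
  refine (Ef_step (Ag_skew n g) _ _ l ?_ η).trans_eq ?_
  · intro j
    have : ((l.succAbove j : Fin (k+1)) : ℕ) ≠ l := fun h => Fin.succAbove_ne l j (Fin.ext h)
    unfold Hm
    congr 1
    rw [eq_iff_iff]
    omega
  · unfold Gf
    congr 1; ext X
    have e1 : Hm (2*n) L κ ε T (k+1) (l+1) l = nud (2*n) L ε T := by unfold Hm; rw [if_pos (by omega)]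
    have e2 : Hm (2*n) L κ ε T (k+1) l l = nuc (2*n) κ ε T := by unfold Hm; rw [if_neg (by omega)]
    rw [e1, e2, S_eq L hκ h0 h1]

lemma E_avg (L : Set (Fin (2*n) → ℤ)) {κ : ℝ} (hκ : 0 ≤ κ) (hκ1 : κ ≤ 1) (hD : Dprop n L κ) {a : ℝ} (ha : 1 ≤ a) (μ : Measure (SL2n n)) [hμ : μ.IsHaarMeasure] :
    ∃ C > (0:ℝ), ∀ ε > (0:ℝ), ε ≤ 1 → ∀ T ≥ (1:ℝ), ∀ η : Pairs (k+1) → ℝ,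
    ∫⁻ g in Ka (2*n) a, oR ‖Ef (Ag n g) (fun _ => nud (2*n) L ε T) η - Ef (Ag n g) (fun _ => nuc (2*n) κ ε T) η‖ ∂μ ≤ oR (C * ε⁻¹ ^ (2*(2*n)) * T^(2*n*k+5) * (1+∑ p, |η p|)^2) := by
  obtain ⟨C, hC0, hC⟩ := hD a ha μ hμ
  have hcst : 0 < Cst n k := by unfold Cst mC; positivity
  refine ⟨(k+1:ℕ) * (C * Cst n k), by positivity, ?_⟩
  intro ε h0 h1 T hT η
  have i1 := fun m i => BND_fin (Hm_BND L hκ1 h0 h1 hT (k+1) m i)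
  have tel : ∀ g : SL2n n, oR ‖Ef (Ag n g) (fun _ => nud (2*n) L ε T) η - Ef (Ag n g) (fun _ => nuc (2*n) κ ε T) η‖ ≤ ∑ l : Fin (k+1), Gf L κ ε T l η (fun j => Hm (2*n) L κ ε T (k+1) (l+1) (l.succAbove j)) g := by
    intro g
    have e1 : (fun _ : Fin (k+1) => nud (2*n) L ε T) = Hm (2*n) L κ ε T (k+1) (k+1) := by
      ext1 l; unfold Hm; rw [if_pos l.2]
    have e2 : (fun _ : Fin (k+1) => nuc (2*n) κ ε T) = Hm (2*n) L κ ε T (k+1) 0 := by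
      ext1 l; unfold Hm; rw [if_neg (by omega)]
    rw [e1, e2, ← Finset.sum_range_sub (fun m => Ef (Ag n g) (Hm (2*n) L κ ε T (k+1) m) η) (k+1), ← Fin.sum_univ_eq_sum_range (fun m => Ef (Ag n g) (Hm (2*n) L κ ε T (k+1) (m+1)) η - Ef (Ag n g) (Hm (2*n) L κ ε T (k+1) m) η)]
    refine (oL (norm_sum_le _ _)).trans ?_
    rw [ENNReal.ofReal_sum_of_nonneg (fun _ _ => norm_nonneg _)]
    exact sL fun l _ => Hm_step L hκ hκ1 h0 h1 hT k l η g
  refine (lintegral_mono tel).trans ?_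
  rw [lintegral_finsetSum _ (fun l _ => Gf_meas L hκ hκ1 h0 h1 hT l η _)]
  refine (sL fun l _ => Gf_avg L hκ hκ1 hC0 μ hC h0 h1 hT l η _ (fun i => Hm_BND L hκ1 h0 h1 hT (k+1) _ _)).trans_eq ?_
  rw [Finset.sum_const, Finset.card_univ, fF, nsmul_eq_mul, ← ENNReal.ofReal_natCast, ← oM pz]
  congr 1
  ring

def PP (ε : ℝ) (a b : Pairs k → ℝ) (η : Pairs k → ℝ) : ℂ := ∏ p, Psi ε (a p) (b p) (η p)

def bt (A : Mm d) (X : Fin k → Vv d) (p : Pairs k) : ℝ := dp (X p.1.1) (A *ᵥ X p.1.2)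

def pps (A : Mm d) (ε : ℝ) (a b : Pairs k → ℝ) (X : Fin k → Vv d) : ℝ := ∏ p, psi ε (a p) (b p) (bt A X p)

def Nf (A : Mm d) (H : Fin k → Measure (Vv d)) (ε : ℝ) (a b : Pairs k → ℝ) : ℝ :=
  ∫ X, pps A ε a b X ∂Measure.pi H

lemma PP_cont (ε : ℝ) (a b : Pairs k → ℝ) : Continuous (PP ε a b) := by
  unfold PP
  apply continuous_finsetProd
  intro p _
  exact (Psi_cont _ _ _).comp (continuous_apply p)

lemma wt_int : Integrable (fun t : ℝ => ((1 + |t|) ^ 2)⁻¹) := by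
  have := integrable_one_add_norm (E := ℝ) (μ := volume) (r := 2) (by simp)
  convert this using 2 with t
  rw [nA, Real.rpow_neg pz]
  norm_num

def wI : ℝ := ∫ t : ℝ, ((1 + |t|) ^ 2)⁻¹

lemma wI_nonneg : 0 ≤ wI := integral_nonneg fun t => by positivity

lemma wtp_int (k : ℕ) : Integrable (fun η : Pairs k → ℝ => ∏ p, ((1 + |η p|) ^ 2)⁻¹) :=
  Integrable.fintype_prod (μ := fun _ => volume) (f := fun _ t => ((1 + |t|) ^ 2)⁻¹) fun _ => wt_int

lemma wtp_eq (k : ℕ) : ∫ η : Pairs k → ℝ, ∏ p, ((1 + |η p|) ^ 2)⁻¹ = wI ^ (fC (Pairs k)) :=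
  integral_fintype_prod_volume_eq_pow (fun t : ℝ => ((1 + |t|) ^ 2)⁻¹)

lemma one_add_sum_le {ι : Type*} (s : Finset ι) (f : ι → ℝ) (hf : ∀ i, 0 ≤ f i) : 1 + ∑ i ∈ s, f i ≤ ∏ i ∈ s, (1 + f i) := by
  classical
  induction s using Finset.induction_on with
  | empty => simp
  | insert i s hi ih =>
    rw [Finset.sum_insert hi, Finset.prod_insert hi]
    have := Finset.sum_nonneg (s := s) (fun i _ => hf i)
    nlinarith [hf i]

lemma PP_bound (k : ℕ) (B : ℝ) (hB : 0 ≤ B) : ∃ C > (0:ℝ), ∀ ε : ℝ, 0 < ε → ε ≤ 1 → ∀ a b : Pairs k → ℝ, (∀ p, a p ≤ b p) → (∀ p, b p - a p ≤ B) → ∀ η,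
    ‖PP ε a b η‖ * (1 + ∑ p, |η p|) ^ 2 ≤ C * ε⁻¹ ^ (4 * fC (Pairs k)) * ∏ p, ((1 + |η p|) ^ 2)⁻¹ := by
  obtain ⟨C, hC1, hC⟩ := Psi_decay
  refine ⟨((B + 1) * C) ^ (fC (Pairs k)), by positivity, ?_⟩
  intro ε h0 h1 a b hab hB' η
  have e1 : (1 + ∑ p, |η p|) ^ 2 ≤ ∏ p, (1 + |η p|) ^ 2 := by
    rw [Finset.prod_pow]
    exact pL (add_nonneg zero_le_one (Finset.sum_nonneg fun p _ => abs_nonneg _)) (one_add_sum_le _ _ fun p => abs_nonneg _) 2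
  refine (mL e1 (norm_nonneg _)).trans ?_
  unfold PP
  rw [norm_prod, ← pD, pow_mul, ← mul_pow]
  have : ((B + 1) * C * ε⁻¹ ^ 4) ^ (fC (Pairs k)) * ∏ p, ((1 + |η p|) ^ 2)⁻¹ = ∏ p, (((B + 1) * C * ε⁻¹ ^ 4) * ((1 + |η p|) ^ 2)⁻¹) := by
    rw [pD, Finset.prod_const, Finset.card_univ]
  rw [this]
  apply Finset.prod_le_prod
  · intro p _; positivity
  intro p _
  refine (mR (hC ε h0 h1 _ _ (hab p) (η p)) pz).trans ?_
  have h2 : (b p - a p) * (C * ε⁻¹ ^ 4 * ((1 + |η p|) ^ 4)⁻¹) * (1 + |η p|) ^ 2 = (b p - a p) * (C * ε⁻¹ ^ 4 * ((1 + |η p|) ^ 2)⁻¹) := by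
    field_simp
  rw [h2, mul_assoc (B+1) C, mul_assoc (B+1)]
  apply mR _ pz
  linarith [hB' p]

lemma PP_int (h0 : 0 < ε) (h1 : ε ≤ 1) {a b : Pairs k → ℝ} (hab : ∀ p, a p ≤ b p) : Integrable (PP ε a b) := by
  obtain ⟨C, hC, h⟩ := PP_bound k (∑ p, (b p - a p)) (Finset.sum_nonneg fun p _ => by linarith [hab p])
  refine Integrable.mono' ((wtp_int k).const_mul (C * ε⁻¹ ^ (4 * fC (Pairs k)))) (PP_cont ε a b).aestronglyMeasurable (eF fun η => ?_)
  refine le_trans ?_ (h ε h0 h1 a b hab (fun p => Finset.single_le_sum (f := fun p => b p - a p) (fun p _ => by linarith [hab p]) (Finset.mem_univ p)) η)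
  have : (0:ℝ) ≤ ∑ p, |η p| := Finset.sum_nonneg fun p _ => abs_nonneg _
  exact le_mul_of_one_le_right (norm_nonneg _) (oP (by linarith))

lemma pps_fourier (A : Mm d) (h0 : 0 < ε) (a b : Pairs k → ℝ) (X : Fin k → Vv d) :
    (pps A ε a b X : ℂ) = ∫ η, PP ε a b η * ee (Qf A η X) := by
  unfold pps
  push_cast
  rw [Finset.prod_congr rfl fun p _ => psi_fourier h0 (a p) (b p) (bt A X p)]
  rw [← integral_fintype_prod_volume_eq_prod (fun p t => Psi ε (a p) (b p) t * ee (t * bt A X p))]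
  congr 1; ext η
  unfold PP Qf bt
  rw [ee_sum, pD]

lemma Nf_fourier (A : Mm d) (H : Fin k → Measure (Vv d)) [∀ i, IsFiniteMeasure (H i)] (h0 : 0 < ε) (h1 : ε ≤ 1) {a b : Pairs k → ℝ} (hab : ∀ p, a p ≤ b p) :
    (Nf A H ε a b : ℂ) = ∫ η, PP ε a b η * Ef A H η := by
  unfold Nf Ef
  rw [← integral_complex_ofReal]
  simp_rw [pps_fourier A h0 a b, ← integral_const_mul]
  apply integral_integral_swap
  have h := (PP_int h0 h1 hab).comp_snd (Measure.pi H)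
  refine Integrable.mono' h.norm ?_ ?_
  · apply cM
    refine ((PP_cont ε a b).comp continuous_snd).mul (ee_cont.comp ((Qf_cont A).comp (continuous_snd.prodMk continuous_fst)))
  · refine eF fun z => ?_
    simp only [Function.uncurry, norm_mul, ee_norm, mul_one]
    exact le_refl _

lemma QfA_cont : Continuous (fun z : (SL2n n × (Pairs k → ℝ)) × (Fin k → Vv (2*n)) => Qf (Ag n z.1.1) z.1.2 z.2) := by
  unfold Qf dp
  apply continuous_finsetSum; intro p _
  apply Continuous.mul (by fun_prop)
  apply continuous_finsetSum; intro i _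
  apply Continuous.mul (by fun_prop)
  have : Continuous (fun z : (SL2n n × (Pairs k → ℝ)) × (Fin k → Vv (2*n)) => Ag n z.1.1 *ᵥ z.2 p.1.2) :=
    Continuous.matrix_mulVec ((Ag_contM n).comp (continuous_fst.comp continuous_fst)) (by fun_prop)
  exact (continuous_apply i).comp this

lemma Ef_cont (H : Fin k → Measure (Vv (2*n))) [∀ i, IsFiniteMeasure (H i)] : Continuous (fun z : SL2n n × (Pairs k → ℝ) => Ef (Ag n z.1) H z.2) := by
  unfold Ef
  apply continuous_of_dominated (bound := fun _ => 1)
  · intro z; exact (eeQ_cont _ _).aestronglyMeasurable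
  · intro z; exact eF fun x => (ee_norm _).le
  · exact integrable_const _
  · apply eF; intro X
    exact ee_cont.comp (QfA_cont.comp (continuous_id.prodMk continuous_const))

lemma PPEf_int (A : Mm d) (H : Fin k → Measure (Vv d)) [∀ i, IsFiniteMeasure (H i)] (h0 : 0 < ε) (h1 : ε ≤ 1) {a b : Pairs k → ℝ} (hab : ∀ p, a p ≤ b p) : Integrable (fun η => PP ε a b η * Ef A H η) := by
  have hc : Continuous (fun η : Pairs k → ℝ => Ef A H η) := by
    unfold Ef
    apply continuous_of_dominated (bound := fun _ => 1)
    · intro z; exact (eeQ_cont _ _).aestronglyMeasurable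
    · intro z; exact eF fun x => (ee_norm _).le
    · exact integrable_const _
    · apply eF; intro X
      exact ee_cont.comp ((Qf_cont A).comp (continuous_id.prodMk continuous_const))
  refine (PP_int h0 h1 hab).mul_bdd (c := (Measure.pi H).real Set.univ) hc.aestronglyMeasurable (eF fun η => ?_)
  unfold Ef
  refine (norm_integral_le_of_norm_le_const (C := 1) (eF fun x => (ee_norm _).le)).trans_eq (one_mul _)

lemma N_avg (L : Set (Fin (2*n) → ℤ)) {κ : ℝ} (hκ : 0 ≤ κ) (hκ1 : κ ≤ 1) (hD : Dprop n L κ) {α : ℝ} (ha : 1 ≤ α) (μ : Measure (SL2n n)) [hμ : μ.IsHaarMeasure] (B : ℝ) (hB : 0 ≤ B) :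
    ∃ C > (0:ℝ), ∀ ε > (0:ℝ), ε ≤ 1 → ∀ T ≥ (1:ℝ), ∀ a b : Pairs (k+1) → ℝ, (∀ p, a p ≤ b p) → (∀ p, b p - a p ≤ B) →
    ∫⁻ g in Ka (2*n) α, oR |Nf (Ag n g) (fun _ => nud (2*n) L ε T) ε a b - Nf (Ag n g) (fun _ => nuc (2*n) κ ε T) ε a b| ∂μ ≤ oR (C * ε⁻¹ ^ (2*(2*n) + 4 * fC (Pairs (k+1))) * T^(2*n*k+5)) := by
  obtain ⟨C, hC0, hC⟩ := E_avg (k := k) L hκ hκ1 hD ha μ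
  obtain ⟨C', hC0', hC'⟩ := PP_bound (k+1) B hB
  refine ⟨C * C' * (wI ^ (fC (Pairs (k+1))) + 1), by have := wI_nonneg; positivity, ?_⟩
  intro ε h0 h1 T hT a b hab hab'
  have i1 := BND_fin (nud_BND L h0 hT)
  have i2 := BND_fin (nuc_BND hκ1 h0 h1 hT (d := 2*n))
  have hT0 : 0 < T := by linarith
  have s1 : ∀ g : SL2n n, oR |Nf (Ag n g) (fun _ => nud (2*n) L ε T) ε a b - Nf (Ag n g) (fun _ => nuc (2*n) κ ε T) ε a b| ≤ ∫⁻ η, oR ‖PP ε a b η‖ * oR ‖Ef (Ag n g) (fun _ => nud (2*n) L ε T) η - Ef (Ag n g) (fun _ => nuc (2*n) κ ε T) η‖ := by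
    intro g
    rw [← nA, ← cN, Complex.ofReal_sub, Nf_fourier _ _ h0 h1 hab, Nf_fourier _ _ h0 h1 hab, ← integral_sub (PPEf_int _ _ h0 h1 hab) (PPEf_int _ _ h0 h1 hab), ofReal_norm]
    refine (enorm_integral_le_lintegral_enorm _).trans (lintegral_mono fun η => ?_)
    rw [← mul_sub, ← ofReal_norm, norm_mul, oM (norm_nonneg _)]
  have hm : Measurable (fun z : SL2n n × (Pairs (k+1) → ℝ) => oR ‖PP ε a b z.2‖ * oR ‖Ef (Ag n z.1) (fun _ => nud (2*n) L ε T) z.2 - Ef (Ag n z.1) (fun _ => nuc (2*n) κ ε T) z.2‖) := by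
    refine ((PP_cont ε a b).comp continuous_snd).norm.measurable.ennreal_ofReal.mul (((Ef_cont _).sub (Ef_cont _)).norm.measurable.ennreal_ofReal)
  refine (lintegral_mono fun g => s1 g).trans ?_
  rw [lintegral_lintegral_swap hm.aemeasurable]
  have s2 : ∀ η : Pairs (k+1) → ℝ, ∫⁻ g in Ka (2*n) α, oR ‖PP ε a b η‖ * oR ‖Ef (Ag n g) (fun _ => nud (2*n) L ε T) η - Ef (Ag n g) (fun _ => nuc (2*n) κ ε T) η‖ ∂μ ≤ oR ((C * ε⁻¹ ^ (2*(2*n)) * T^(2*n*k+5)) * (C' * ε⁻¹ ^ (4 * fC (Pairs (k+1))) * ∏ p, ((1 + |η p|) ^ 2)⁻¹)) := by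
    intro η
    rw [lintegral_const_mul' _ _ ENNReal.ofReal_ne_top]
    refine (mul_le_mul_right (hC ε h0 h1 T hT η) _).trans ?_
    rw [← oM (norm_nonneg _)]
    apply oL
    have := mL (hC' ε h0 h1 a b hab hab' η) (show 0 ≤ C * ε⁻¹ ^ (2*(2*n)) * T^(2*n*k+5) by positivity)
    linarith
  refine (lintegral_mono s2).trans ?_
  have hint := ((wtp_int (k+1)).const_mul (C' * ε⁻¹ ^ (4 * fC (Pairs (k+1))))).const_mul (C * ε⁻¹ ^ (2*(2*n)) * T^(2*n*k+5))
  rw [← ofReal_integral_eq_lintegral_ofReal hint (eF fun η => by positivity)]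
  apply oL
  rw [integral_const_mul, integral_const_mul, wtp_eq, pow_add ε⁻¹]
  have hw := wI_nonneg
  have : 0 ≤ C * C' * (ε⁻¹ ^ (2 * (2 * n)) * ε⁻¹ ^ (4 * fC (Pairs (k+1)))) * T ^ (2 * n * k + 5) := by positivity
  nlinarith

lemma vol_scale (hT : 0 < T) (g : (Vv d) → ENNReal) (hg : Measurable g) :
    ∫⁻ x, g x = oR (T ^ d) * ∫⁻ x, g (T • x) := by
  have h := Measure.map_addHaar_smul (volume : Measure (Vv d)) hT.ne'
  have h2 : ∫⁻ x, g (T • x) = ∫⁻ y, g y ∂(Measure.map (T • ·) volume) := (lintegral_map hg (measurable_const_smul T)).symm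
  rw [h2, h, lintegral_smul_measure, smul_eq_mul, ← mul_assoc, ← oM pz, aP pz]
  simp [mul_inv_cancel₀ (pow_pos hT d).ne']

lemma nuc_scale {κ : ℝ} (hκ : 0 ≤ κ) (h0 : 0 < ε) (h1 : ε ≤ 1) (hT : 0 < T) :
    nuc d κ ε T = oR (κ * T ^ d) • Measure.map (T • ·) (nuc d 1 ε 1) := by
  ext s hs
  have hm := measurable_const_smul (M := ℝ) (α := Vv d) T
  rw [Measure.smul_apply, Measure.map_apply hm hs]
  unfold nuc
  rw [Measure.smul_apply, Measure.smul_apply, withDensity_apply _ hs, withDensity_apply _ (hm hs), ← lintegral_indicator hs, ← lintegral_indicator (hm hs)]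
  rw [vol_scale hT _ (((phiT_cont h0 h1).measurable.ennreal_ofReal).indicator hs)]
  simp only [oO, smul_eq_mul, one_mul]
  rw [← mul_assoc, ← oM hκ]
  congr 2; ext x
  simp only [Set.indicator, Set.mem_preimage]
  have e : (fun i => (T • x) i / T) = fun i => x i / 1 := by
    ext i; rw [Pi.smul_apply, smul_eq_mul, div_one, mul_div_cancel_left₀ _ hT.ne']
  rw [e]; rfl

lemma pi_scale (ν : Measure (Vv d)) [IsFiniteMeasure ν] (c : ENNReal) (hc : c ≠ ⊤) (T : ℝ) :
    Measure.pi (fun _ : Fin k => c • Measure.map (T • ·) ν) = c ^ k • Measure.map (T • ·) (Measure.pi fun _ : Fin k => ν) := by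
  have hm := measurable_const_smul (M := ℝ) (α := Vv d) T
  have hm' := measurable_const_smul (M := ℝ) (α := Fin k → Vv d) T
  have i2 : IsFiniteMeasure (c • Measure.map (T • ·) ν) := by
    have : IsFiniteMeasure (Measure.map (T • ·) ν) := Measure.isFiniteMeasure_map ν _
    exact Measure.smul_finite _ hc
  apply Measure.pi_eq
  intro s hs
  rw [Measure.smul_apply, Measure.map_apply hm' (MeasurableSet.univ_pi hs)]
  have : (fun x : Fin k → Vv d => T • x) ⁻¹' (Set.univ.pi s) = Set.univ.pi fun i => (fun x : Vv d => T • x) ⁻¹' (s i) := by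
    ext x; simp
  rw [this, Measure.pi_pi]
  simp only [Measure.smul_apply, smul_eq_mul, pD, Finset.prod_const, Finset.card_univ, fF]
  congr 1
  apply Finset.prod_congr rfl
  intro i _
  rw [Measure.map_apply hm (hs i)]

lemma Qf_scale (A : Mm d) (η : Pairs k → ℝ) (X : Fin k → Vv d) (T : ℝ) : Qf A η (T • X) = Qf A (fun p => T ^ 2 * η p) X := by
  unfold Qf
  apply sC rfl
  intro p _
  simp only [Pi.smul_apply, Matrix.mulVec_smul, dp_eq, smul_dotProduct, dotProduct_smul, smul_eq_mul]
  ring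

def Ph (k : ℕ) (A : Mm d) (ε : ℝ) (η : Pairs k → ℝ) : ℂ := Ef A (fun _ => nuc d 1 ε 1) η

lemma Ef_scale (A : Mm d) {κ : ℝ} (hκ : 0 ≤ κ) (h0 : 0 < ε) (h1 : ε ≤ 1) (hT : 0 < T) (η : Pairs k → ℝ) :
    Ef A (fun _ => nuc d κ ε T) η = ((κ * T ^ d) ^ k : ℝ) * Ph k A ε (fun p => T ^ 2 * η p) := by
  have i2 := BND_fin (nuc_BND le_rfl h0 h1 le_rfl (d := d))
  unfold Ph Ef
  rw [nuc_scale hκ h0 h1 hT, pi_scale _ _ ENNReal.ofReal_ne_top, integral_smul_measure, integral_map (measurable_const_smul T).aemeasurable (eeQ_cont A η).aestronglyMeasurable]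
  simp_rw [Qf_scale]
  rw [← ENNReal.ofReal_pow pz, ENNReal.toReal_ofReal pz, Complex.real_smul]

lemma Ph_cont (A : Mm d) (h0 : 0 < ε) (h1 : ε ≤ 1) : Continuous (Ph k A ε) := by
  have i2 := BND_fin (nuc_BND le_rfl h0 h1 le_rfl (d := d))
  unfold Ph Ef
  apply continuous_of_dominated (bound := fun _ => 1)
  · intro z; exact (eeQ_cont _ _).aestronglyMeasurable
  · intro z; exact eF fun x => (ee_norm _).le
  · exact integrable_const _
  · apply eF; intro X
    exact ee_cont.comp ((Qf_cont A).comp (continuous_id.prodMk continuous_const))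

lemma Ph_triv (A : Mm d) (h0 : 0 < ε) (h1 : ε ≤ 1) (η : Pairs k → ℝ) : ‖Ph k A ε η‖ ≤ mC d ^ k := by
  have hb := nuc_BND le_rfl h0 h1 le_rfl (d := d)
  have i2 := BND_fin hb
  unfold Ph Ef
  refine (norm_integral_le_of_norm_le_const (C := 1) (eF fun x => (ee_norm _).le)).trans ?_
  rw [one_mul, Measure.real]
  have := pi_mass zero_le_one (fun _ : Fin k => nuc d 1 ε 1) (fun _ => hb)
  rw [one_pow, mul_one] at this
  exact ENNReal.toReal_le_of_le_ofReal (by unfold mC; positivity) this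

lemma wf_upd (p : Pairs k) (η : Pairs k → ℝ) (X : Fin k → Vv d) (x : Vv d) :
    wf p.1.1 η (Function.update X p.1.2 x) = wf p.1.1 η (Function.update X p.1.2 0) + η p • x := by
  rw [← sub_eq_iff_eq_add']
  unfold wf
  rw [← Finset.sum_sub_distrib, Finset.sum_eq_single p]
  · simp
  · rintro q _ hq
    rw [← smul_sub]
    convert smul_zero _
    rw [sub_eq_zero]
    by_cases c1 : q.1.1 = p.1.1
    · simp only [c1, if_true]
      have : q.1.2 ≠ p.1.2 := fun h => hq (Subtype.ext (Prod.ext c1 h))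
      rw [uN this, uN this]
    · simp only [c1, if_false]
      by_cases c2 : q.1.2 = p.1.1
      · have : q.1.1 ≠ p.1.2 := by
          intro h
          have h3 := q.2
          have h4 := p.2
          rw [c2, h] at h3
          exact absurd h3 (not_lt.mpr h4.le)
        rw [uN this, uN this]
      · simp only [c2, if_false]
  · simp

lemma ins_ins {E : Type*} (i : Fin (k+2)) (j : Fin (k+1)) (x z w : E) (Y : Fin k → E) :
    ins i z (ins j x Y) = Function.update (ins i z (ins j w Y)) (i.succAbove j) x := by
  ext1 m
  refine Fin.succAboveCases i ?_ (fun q => ?_) m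
  · rw [uN (Fin.succAbove_ne i j).symm]
    simp [ins]
  · by_cases h : q = j
    · subst h; simp [ins]
    · rw [uN (fun h' => h (Fin.succAbove_right_injective h'))]
      simp only [ins, Fin.insertNth_apply_succAbove]
      have := ins_update j x w Y
      unfold ins at this
      rw [this, uN h]

lemma nuc_le (h0 : 0 < ε) : nuc d 1 ε 1 ≤ volume := by
  unfold nuc
  rw [oO, one_smul]
  refine (withDensity_mono (g := 1) (eF fun x => ?_)).trans_eq withDensity_one
  exact ENNReal.ofReal_le_one.mpr (phi_le_one h0 _)

def kI (d : ℕ) : ENNReal := ∫⁻ x : Vv d, oR (ker d ‖x‖)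

lemma kI_fin (hd : 0 < d) : kI d ≠ ⊤ := by
  have hd' : (0:ℝ) < d := by exact_mod_cast hd
  have := integrable_one_add_norm (E := Vv d) (μ := volume) (r := (2 * d : ℕ)) (by rw [Module.finrank_fin_fun]; push_cast; linarith)
  have h2 := this.lintegral_lt_top
  refine ne_of_lt (lt_of_eq_of_lt ?_ h2)
  unfold kI ker
  congr 1; ext x
  rw [Real.rpow_neg pz, Real.rpow_natCast]

lemma ker_meas : Measurable (fun x : Vv d => oR (ker d ‖x‖)) := by
  unfold ker; fun_prop

lemma inner_ker {s r : ℝ} (hr : 0 < r) (hs : s ≠ 0) (z : Vv d) :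
    ∫⁻ x : Vv d, oR (ker d (r * ‖z + s • x‖)) = oR ((r * |s|)⁻¹ ^ d) * kI d := by
  have e1 : ∀ x : Vv d, r * ‖z + s • x‖ = ‖(r * |s|) • (s⁻¹ • z + x)‖ := by
    intro x
    rw [norm_smul, rN pz, mul_assoc, ← nA s, ← norm_smul, smul_add, smul_inv_smul₀ hs]
  simp_rw [e1]
  rw [lintegral_add_left_eq_self (fun x : Vv d => oR (ker d ‖(r * |s|) • x‖)) (s⁻¹ • z)]
  have hp : 0 < r * |s| := by positivity
  unfold kI
  rw [vol_scale hp (fun x => oR (ker d ‖x‖)) ker_meas, ← mul_assoc, ← oM pz, ← mul_pow, inv_mul_cancel₀ hp.ne', one_pow, oO, one_mul]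

lemma Ph_dec1 {A : Mm d} (hA : Skew A) {c : ℝ} (hc : 0 < c) (hAc : ∀ y, c * ‖y‖ ≤ ‖A *ᵥ y‖) (h0 : 0 < ε) (h1 : ε ≤ 1) (η : Pairs (k+2) → ℝ) (p : Pairs (k+2)) (hp : η p ≠ 0) :
    oR ‖Ph (k+2) A ε η‖ ≤ oR (mC d ^ k * (volC d * decC d ^ d) * (ε * c * |η p|)⁻¹ ^ d) * kI d := by
  have hb := nuc_BND le_rfl h0 h1 le_rfl (d := d)
  have i2 := BND_fin hb
  obtain ⟨j, hj⟩ := Fin.exists_succAbove_eq p.2.ne'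
  unfold Ph
  rw [Ef_iso hA _ p.1.1, ofReal_norm]
  refine (enorm_integral_le_lintegral_enorm _).trans ?_
  have hV : 0 ≤ volC d * decC d ^ d := by
    have := (norm_nonneg _).trans (phi_hat_bound h0 h1 (0 : Vv d))
    have h3 := ker_pos (d := d) (show 0 ≤ ε * ‖(0 : Vv d)‖ by positivity)
    exact nonneg_of_mul_nonneg_left this h3
  have hrc : 0 < ε * c := by positivity
  have s1 : ∀ X : Fin (k+1) → Vv d, ‖ee (cf A p.1.1 η (ins p.1.1 0 X)) * ∫ x, ee (dp x (A *ᵥ wf p.1.1 η (ins p.1.1 0 X))) ∂(nuc d 1 ε 1)‖ₑ ≤ oR (volC d * decC d ^ d) * oR (ker d (ε * c * ‖wf p.1.1 η (ins p.1.1 0 X)‖)) := by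
    intro X
    rw [← ofReal_norm, norm_mul, ee_norm, one_mul, nuc_int zero_le_one h0 h1, ← oM hV]
    apply oL
    simp only [Complex.ofReal_one, one_mul, div_one]
    refine (phi_hat_bound h0 h1 _).trans (mL (ker_anti pz ?_) hV)
    rw [mul_assoc]
    exact mL (hAc _) h0.le
  refine (lintegral_mono s1).trans ?_
  rw [lintegral_const_mul' _ _ ENNReal.ofReal_ne_top]
  have hmeas : Measurable (fun X : Fin (k+1) → Vv d => oR (ker d (ε * c * ‖wf p.1.1 η (ins p.1.1 0 X)‖))) := by
    apply Measurable.ennreal_ofReal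
    apply Continuous.measurable
    apply ker_contOn _ (fun X => by positivity)
    exact continuous_const.mul (((wf_cont p.1.1).comp (continuous_const.prodMk (ins0_cont p.1.1))).norm)
  rw [iso_lint (fun _ : Fin (k+1) => nuc d 1 ε 1) j _ hmeas]
  have s2 : ∀ Y : Fin k → Vv d, ∫⁻ x, oR (ker d (ε * c * ‖wf p.1.1 η (ins p.1.1 0 (ins j x Y))‖)) ∂(nuc d 1 ε 1) ≤ oR ((ε * c * |η p|)⁻¹ ^ d) * kI d := by
    intro Y
    refine (lintegral_mono' (nuc_le h0) le_rfl).trans ?_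
    have e3 : ∀ x, wf p.1.1 η (ins p.1.1 0 (ins j x Y)) = wf p.1.1 η (Function.update (ins p.1.1 0 (ins j 0 Y)) p.1.2 0) + η p • x := by
      intro x
      rw [ins_ins p.1.1 j x 0 0 Y, hj, wf_upd p η]
    have e4 : (fun x => oR (ker d (ε * c * ‖wf p.1.1 η (ins p.1.1 0 (ins j x Y))‖))) = fun x => oR (ker d (ε * c * ‖wf p.1.1 η (Function.update (ins p.1.1 0 (ins j 0 Y)) p.1.2 0) + η p • x‖)) := by
      ext x; rw [e3 x]
    rw [e4, inner_ker hrc hp]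
  refine (mul_le_mul_right (lintegral_mono s2) _).trans ?_
  rw [lintegral_const]
  have hmass := pi_mass zero_le_one (fun _ : Fin k => nuc d 1 ε 1) (fun _ => hb)
  rw [one_pow, mul_one] at hmass
  refine (mul_le_mul_right (mul_le_mul_right hmass _) _).trans_eq ?_
  have hm : 0 ≤ mC d := by unfold mC; positivity
  have hm2 : 0 ≤ mC d ^ k := by positivity
  rw [oM (mul_nonneg hm2 hV), oM hm2]
  generalize volC d * decC d ^ d = u
  generalize (ε * c * |η p|)⁻¹ ^ d = u'
  ring

lemma Ph_dec (k : ℕ) (hd : 0 < d) {c : ℝ} (hc : 0 < c) : ∃ C > (0:ℝ), ∀ A : Mm d, Skew A → (∀ y, c * ‖y‖ ≤ ‖A *ᵥ y‖) → ∀ ε : ℝ, 0 < ε → ε ≤ 1 → ∀ η : Pairs (k+2) → ℝ,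
    ‖Ph (k+2) A ε η‖ ≤ C * ε⁻¹ ^ d * ((1 + ‖η‖) ^ d)⁻¹ := by
  have hm : 0 < mC d := by unfold mC; positivity
  have hV := volC_pos d
  have hD : 0 < decC d := by have := decC_one d; linarith
  refine ⟨mC d ^ (k+2) * 2 ^ d + mC d ^ k * (volC d * decC d ^ d) * c⁻¹ ^ d * (kI d).toReal * 2 ^ d, by positivity, ?_⟩
  intro A hA hAc ε h0 h1 η
  have hε : 1 ≤ ε⁻¹ ^ d := oP ((one_le_inv₀ h0).mpr h1)
  have hn := norm_nonneg η
  have key : ‖Ph (k+2) A ε η‖ ≤ (mC d ^ (k+2) * 2 ^ d) * ((1 + ‖η‖) ^ d)⁻¹ ∨ ‖Ph (k+2) A ε η‖ ≤ (mC d ^ k * (volC d * decC d ^ d) * c⁻¹ ^ d * (kI d).toReal * 2 ^ d) * ε⁻¹ ^ d * ((1 + ‖η‖) ^ d)⁻¹ := by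
    rcases le_or_gt ‖η‖ 1 with h | h
    · left
      refine (Ph_triv A h0 h1 η).trans ?_
      rw [← dI, lD pz]
      gcongr
      linarith
    · right
      have : Nonempty (Pairs (k+2)) := ⟨⟨(0, 1), by simp⟩⟩
      obtain ⟨p, hp⟩ := Finite.exists_max (fun p => ‖η p‖)
      have hp2 : ‖η‖ ≤ |η p| := (pN (norm_nonneg _)).mpr hp
      have hne : η p ≠ 0 := by intro h3; rw [h3, abs_zero] at hp2; linarith
      have := Ph_dec1 hA hc hAc h0 h1 η p hne
      rw [← ENNReal.ofReal_toReal (kI_fin hd), ← oM pz] at this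
      have := (ENNReal.ofReal_le_ofReal_iff pz).mp this
      refine this.trans ?_
      have e2 : (ε * c * |η p|)⁻¹ ^ d ≤ ε⁻¹ ^ d * c⁻¹ ^ d * (2 ^ d * ((1 + ‖η‖) ^ d)⁻¹) := by
        rw [mul_inv, mul_inv, mul_pow, mul_pow, ← inv_pow, ← mul_pow 2]
        gcongr
        rw [← dI, inv_eq_one_div, div_le_div_iff₀ (by linarith) (by linarith)]
        linarith
      have := mL e2 (show 0 ≤ mC d ^ k * (volC d * decC d ^ d) * (kI d).toReal by positivity)
      nlinarith
  have hi : 0 < ((1 + ‖η‖) ^ d)⁻¹ := by positivity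
  have P1 : 0 < mC d ^ (k+2) * 2 ^ d := by positivity
  have P2 : 0 ≤ mC d ^ k * (volC d * decC d ^ d) * c⁻¹ ^ d * (kI d).toReal * 2 ^ d := by positivity
  generalize mC d ^ (k+2) * 2 ^ d = U at *
  generalize mC d ^ k * (volC d * decC d ^ d) * c⁻¹ ^ d * (kI d).toReal * 2 ^ d = W at *
  rcases key with h | h
  · refine h.trans (mR ?_ hi.le)
    nlinarith
  · refine h.trans (mR ?_ hi.le)
    nlinarith

def cE (k : ℕ) (A : Mm d) (ε : ℝ) : ℝ := (∫ η, Ph k A ε η).re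

lemma prod_diff {ι : Type*} (s : Finset ι) (x y : ι → ℂ) (B : ℝ) (hB : 1 ≤ B) (hx : ∀ i, ‖x i‖ ≤ B) (hy : ∀ i, ‖y i‖ ≤ B) :
    ‖∏ i ∈ s, x i - ∏ i ∈ s, y i‖ ≤ B ^ s.card * ∑ i ∈ s, ‖x i - y i‖ := by
  classical
  induction s using Finset.induction_on with
  | empty => simp
  | insert i s hi ih =>
    rw [Finset.prod_insert hi, Finset.prod_insert hi, Finset.sum_insert hi, Finset.card_insert_of_notMem hi]
    have e : x i * ∏ i ∈ s, x i - y i * ∏ i ∈ s, y i = x i * (∏ i ∈ s, x i - ∏ i ∈ s, y i) + (x i - y i) * ∏ i ∈ s, y i := by ring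
    rw [e]
    refine (norm_add_le _ _).trans ?_
    rw [norm_mul, norm_mul]
    have h1 : ‖∏ i ∈ s, y i‖ ≤ B ^ s.card := by
      rw [norm_prod, ← Finset.prod_const]
      exact Finset.prod_le_prod (fun i _ => norm_nonneg _) fun i _ => hy i
    have h2 : B ^ s.card ≤ B ^ (s.card + 1) := pow_le_pow_right₀ hB (Nat.le_succ _)
    have a1 := mul_le_mul (hx i) ih (norm_nonneg _) (by linarith)
    have a2 := mL (h1.trans h2) (norm_nonneg (x i - y i))
    rw [pow_succ] at a2 ⊢
    linarith

lemma PP_sub {ε M : ℝ} (h0 : 0 < ε) (h1 : ε ≤ 1) (hM : 0 ≤ M) {a b : Pairs k → ℝ} (hab : ∀ p, a p ≤ b p) (ha : ∀ p, |a p| ≤ M) (hb : ∀ p, |b p| ≤ M) (η : Pairs k → ℝ) :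
    ‖PP ε a b η - (∏ p, (b p - a p) : ℝ)‖ ≤ (2 * M + 1) ^ (fC (Pairs k)) * (fC (Pairs k) * (2 * Real.pi * (1 + M) * (2 * M))) * ‖η‖ := by
  unfold PP
  push_cast
  have hba : ∀ p, b p - a p ≤ 2 * M := fun p => by
    have := abs_le.mp (ha p); have := abs_le.mp (hb p); linarith
  refine (prod_diff Finset.univ _ _ (2 * M + 1) (by linarith) ?_ ?_).trans ?_
  · intro p
    refine (Psi_norm ε (hab p) _).trans ?_
    have := chihat_le_one (ε * η p)
    nlinarith [hba p, hab p]
  · intro p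
    rw [← Complex.ofReal_sub, cN, nA, abs_of_nonneg (by linarith [hab p])]
    linarith [hba p]
  rw [Finset.card_univ, mul_assoc]
  apply mL _ pz
  have : ∀ p ∈ Finset.univ, ‖Psi ε (a p) (b p) (η p) - ((b p : ℂ) - a p)‖ ≤ 2 * Real.pi * (1 + M) * (2 * M) * ‖η‖ := by
    intro p _
    have h3 := Psi_sub h0 h1 (hab p) (ha p) (hb p) (η p)
    push_cast at h3
    refine h3.trans ?_
    have h4 : |η p| ≤ ‖η‖ := pI η p
    have h5 : |η p| * (b p - a p) ≤ ‖η‖ * (2 * M) := mul_le_mul h4 (hba p) (by linarith [hab p]) (norm_nonneg _)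
    have h6 := mL h5 (show 0 ≤ 2 * Real.pi * (1 + M) by positivity)
    linarith
  refine (Finset.sum_le_card_nsmul _ _ _ this).trans_eq ?_
  rw [nsmul_eq_mul, Finset.card_univ]; ring

lemma decint {D : Type*} [Fintype D] {m : ℕ} (h : fC D < m) : Integrable (fun η : D → ℝ => ((1 + ‖η‖) ^ m)⁻¹) := by
  have := integrable_one_add_norm (E := D → ℝ) (μ := volume) (r := m) (by simpa using h)
  convert this using 2 with t
  rw [Real.rpow_neg pz, Real.rpow_natCast]

lemma Ph_int (hd : fC (Pairs (k+2)) + 1 < d) {c : ℝ} (hc : 0 < c) {A : Mm d} (hA : Skew A) (hAc : ∀ y, c * ‖y‖ ≤ ‖A *ᵥ y‖) (h0 : 0 < ε) (h1 : ε ≤ 1) : Integrable (Ph (k+2) A ε) := by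
  obtain ⟨C, hC, h⟩ := Ph_dec k (show 0 < d by omega) hc
  exact Integrable.mono' ((decint (show fC (Pairs (k+2)) < d by omega)).const_mul (C * ε⁻¹ ^ d)) (Ph_cont A h0 h1).aestronglyMeasurable (eF fun η => h A hA hAc ε h0 h1 η)

lemma V_asym (k : ℕ) (hd : fC (Pairs (k+2)) + 1 < d) {c : ℝ} (hc : 0 < c) {M : ℝ} (hM : 0 ≤ M) : ∃ C > (0:ℝ), ∀ A : Mm d, Skew A → (∀ y, c * ‖y‖ ≤ ‖A *ᵥ y‖) → ∀ ε : ℝ, 0 < ε → ε ≤ 1 → ∀ ε' : ℝ, 0 < ε' → ε' ≤ 1 → ∀ κ : ℝ, 0 ≤ κ → κ ≤ 1 → ∀ T : ℝ, 1 ≤ T → ∀ a b : Pairs (k+2) → ℝ, (∀ p, a p ≤ b p) → (∀ p, |a p| ≤ M) → (∀ p, |b p| ≤ M) →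
    |Nf A (fun _ => nuc d κ ε T) ε' a b - (κ * T ^ d) ^ (k+2) * ((T ^ 2) ^ (fC (Pairs (k+2))))⁻¹ * ((∏ p, (b p - a p)) * cE (k+2) A ε)| ≤ (κ * T ^ d) ^ (k+2) * ((T ^ 2) ^ (fC (Pairs (k+2))))⁻¹ * (C * ε⁻¹ ^ d * (T ^ 2)⁻¹) := by
  obtain ⟨C, hC, h⟩ := Ph_dec k (show 0 < d by omega) hc
  obtain ⟨C1, hC1⟩ : ∃ C1 : ℝ, C1 = (2 * M + 1) ^ (fC (Pairs (k+2))) * (fC (Pairs (k+2)) * (2 * Real.pi * (1 + M) * (2 * M))) := ⟨_, rfl⟩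
  have hC10 : 0 ≤ C1 := by rw [hC1]; positivity
  have hdi := decint (show fC (Pairs (k+2)) < d - 1 by omega)
  obtain ⟨I1, hI1⟩ : ∃ I1 : ℝ, I1 = ∫ η : Pairs (k+2) → ℝ, ((1 + ‖η‖) ^ (d-1))⁻¹ := ⟨_, rfl⟩
  have hI10 : 0 ≤ I1 := by rw [hI1]; exact integral_nonneg fun η => by positivity
  refine ⟨C1 * C * I1 + 1, by positivity, ?_⟩
  intro A hA hAc ε h0 h1 ε' h0' h1' κ hκ hκ1 T hT a b hab ha hb
  have hT0 : 0 < T := by linarith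
  have i2 := BND_fin (nuc_BND hκ1 h0 h1 hT (d := d))
  have hPi := Ph_int hd hc hA hAc h0 h1
  have hPP := fun y => PP_sub h0' h1' hM hab ha hb y
  rw [← hC1] at hPP
  generalize (∏ p, (b p - a p) : ℝ) = P at *
  have hR : (0:ℝ) < T ^ 2 := by positivity
  obtain ⟨f, hf⟩ : ∃ f : (Pairs (k+2) → ℝ) → ℂ, f = fun y => PP ε' a b ((T ^ 2)⁻¹ • y) * Ph (k+2) A ε y := ⟨_, rfl⟩
  have e1 : (Nf A (fun _ => nuc d κ ε T) ε' a b : ℂ) = ((κ * T ^ d) ^ (k+2) * ((T ^ 2) ^ (fC (Pairs (k+2))))⁻¹ : ℝ) * ∫ y, f y := by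
    rw [Nf_fourier _ _ h0' h1' hab]
    have : ∀ η, PP ε' a b η * Ef A (fun _ => nuc d κ ε T) η = ((κ * T ^ d) ^ (k+2) : ℝ) * f ((T ^ 2) • η) := by
      intro η
      rw [Ef_scale A hκ h0 h1 hT0, hf]
      simp only [inv_smul_smul₀ hR.ne']
      have : (fun p => T ^ 2 * η p) = T ^ 2 • η := rfl
      rw [this]; ring
    simp_rw [this]
    rw [integral_const_mul, Measure.integral_comp_smul, abs_of_nonneg pz, Module.finrank_fintype_fun_eq_card, Complex.real_smul]
    push_cast; ring
  have fb : ∀ y, ‖f y - P * Ph (k+2) A ε y‖ ≤ (C1 * (T ^ 2)⁻¹ * (C * ε⁻¹ ^ d)) * ((1 + ‖y‖) ^ (d-1))⁻¹ := by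
    intro y
    rw [hf]
    simp only
    rw [← sub_mul, norm_mul]
    have b1 := hPP ((T ^ 2)⁻¹ • y)
    rw [norm_smul, rN pz] at b1
    have b2 := h A hA hAc ε h0 h1 y
    refine (mul_le_mul b1 b2 (norm_nonneg _) pz).trans ?_
    have b3 : ‖y‖ * ((1 + ‖y‖) ^ d)⁻¹ ≤ ((1 + ‖y‖) ^ (d-1))⁻¹ := by
      have : (1 + ‖y‖) ^ d = (1 + ‖y‖) ^ (d-1) * (1 + ‖y‖) := by rw [← pow_succ]; congr 1; omega
      rw [this, mul_inv]
      have hy := norm_nonneg y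
      have : ‖y‖ * (1 + ‖y‖)⁻¹ ≤ 1 := by rw [← dI, div_le_one (by linarith)]; linarith
      have h7 : 0 ≤ ((1 + ‖y‖) ^ (d-1))⁻¹ := by positivity
      nlinarith
    have := mL b3 (show 0 ≤ C1 * (T ^ 2)⁻¹ * (C * ε⁻¹ ^ d) by positivity)
    linarith
  have fc : Continuous f := by
    rw [hf]; exact ((PP_cont ε' a b).comp (continuous_const_smul _)).mul (Ph_cont A h0 h1)
  have hdint : Integrable fun y => f y - P * Ph (k+2) A ε y :=
    Integrable.mono' (hdi.const_mul (C1 * (T ^ 2)⁻¹ * (C * ε⁻¹ ^ d))) (fc.sub (continuous_const.mul (Ph_cont A h0 h1))).aestronglyMeasurable (eF fb)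
  have hfint : Integrable f := by
    have := hdint.add (hPi.const_mul (P : ℂ))
    have e : f = (fun y => f y - P * Ph (k+2) A ε y) + fun y => (P : ℂ) * Ph (k+2) A ε y := by
      ext y; rw [Pi.add_apply, sub_add_cancel]
    rw [e]; exact this
  have e2 : ‖(∫ y, f y) - P * ∫ y, Ph (k+2) A ε y‖ ≤ (C1 * (T ^ 2)⁻¹ * (C * ε⁻¹ ^ d)) * I1 := by
    rw [← integral_const_mul, ← integral_sub hfint (hPi.const_mul _), hI1, ← integral_const_mul]
    exact norm_integral_le_of_norm_le (hdi.const_mul _) (eF fb)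
  have e3 : Nf A (fun _ => nuc d κ ε T) ε' a b = ((κ * T ^ d) ^ (k+2) * ((T ^ 2) ^ (fC (Pairs (k+2))))⁻¹) * (∫ y, f y).re := by
    have := congrArg Complex.re e1
    rwa [Complex.ofReal_re, Complex.re_ofReal_mul] at this
  rw [e3, ← mul_sub, abs_mul, abs_of_nonneg (show 0 ≤ (κ * T ^ d) ^ (k+2) * ((T ^ 2) ^ (fC (Pairs (k+2))))⁻¹ by positivity)]
  apply mL _ pz
  have e4 : (∫ y, f y).re - P * cE (k+2) A ε = ((∫ y, f y) - P * ∫ y, Ph (k+2) A ε y).re := by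
    rw [Complex.sub_re, Complex.re_ofReal_mul]; rfl
  rw [e4]
  refine (Complex.abs_re_le_norm _).trans (e2.trans ?_)
  have : 0 ≤ ε⁻¹ ^ d * (T ^ 2)⁻¹ := by positivity
  nlinarith

lemma pi_mono' {ι E : Type*} [Fintype ι] [MeasurableSpace E] (H H' : ι → Measure E) [∀ i, SigmaFinite (H i)] (h : ∀ i, H i ≤ H' i) : Measure.pi H ≤ Measure.pi H' := by
  intro s
  rw [Measure.pi_def H']
  refine le_trans ?_ (le_toMeasure_apply _ _ s)
  have : (Measure.pi H).toOuterMeasure ≤ OuterMeasure.pi fun i => (H' i).toOuterMeasure := by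
    rw [OuterMeasure.le_pi]
    intro t _
    refine (Measure.pi_pi H t).le.trans (Finset.prod_le_prod' fun i _ => h i (t i))
  exact this s

lemma meas_sum_sub {ι E : Type*} [MeasurableSpace E] {s t : Finset ι} {f : ι → Measure E} (h : s ⊆ t) : ∑ i ∈ s, f i ≤ ∑ i ∈ t, f i := by
  intro S; simp only [Measure.finsetSum_apply]; exact Finset.sum_le_sum_of_subset h

lemma psi_cont (h0 : 0 < ε) (a b : ℝ) : Continuous (psi ε a b) := by
  obtain ⟨C, hC⟩ := chi_compact.exists_bound_of_continuous chi_cont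
  unfold psi
  apply continuous_of_dominated (bound := fun _ => ε⁻¹ * C)
  · intro s; apply cM
    exact continuous_const.mul (chi_cont.comp (by fun_prop))
  · intro s; refine eF fun r => ?_
    rw [norm_mul, rN pz]
    exact mL (hC _) pz
  · exact integrable_const _
  · refine eF fun r => ?_
    exact continuous_const.mul (chi_cont.comp (by fun_prop))

lemma bt_cont (A : Mm d) (p : Pairs k) : Continuous (fun X : Fin k → Vv d => bt A X p) := by
  unfold bt dp Matrix.mulVec dotProduct; fun_prop

lemma pps_cont (A : Mm d) (h0 : 0 < ε) (a b : Pairs k → ℝ) : Continuous (pps A ε a b) := by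
  unfold pps
  apply continuous_finsetProd; intro p _
  exact (psi_cont h0 _ _).comp (bt_cont A p)

lemma pps_nonneg (A : Mm d) (h0 : 0 < ε) (a b : Pairs k → ℝ) (X) : 0 ≤ pps A ε a b X :=
  Finset.prod_nonneg fun p _ => psi_nonneg h0 _ _ _

lemma pps_le_one (A : Mm d) (h0 : 0 < ε) (a b : Pairs k → ℝ) (X) : pps A ε a b X ≤ 1 :=
  Finset.prod_le_one (fun p _ => psi_nonneg h0 _ _ _) fun p _ => psi_le_one h0 _ _ _

lemma pps_int (A : Mm d) (h0 : 0 < ε) (a b : Pairs k → ℝ) (ν : Measure (Fin k → Vv d)) [IsFiniteMeasure ν] : Integrable (pps A ε a b) ν := by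
  refine Integrable.mono' (integrable_const (1:ℝ)) (pps_cont A h0 a b).aestronglyMeasurable (eF fun X => ?_)
  rw [rN (pps_nonneg A h0 a b X)]; exact pps_le_one A h0 a b X

lemma Nf_mono (A : Mm d) (h0 : 0 < ε) (a b : Pairs k → ℝ) (H H' : Fin k → Measure (Vv d)) [∀ i, IsFiniteMeasure (H i)] [∀ i, IsFiniteMeasure (H' i)] (h : ∀ i, H i ≤ H' i) : Nf A H ε a b ≤ Nf A H' ε a b :=
  integral_mono_measure (pi_mono' H H' h) (eF fun X => pps_nonneg A h0 a b X) (pps_int A h0 a b _)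

def BX (A : Mm d) (a b : Pairs k → ℝ) : Set (Fin k → Vv d) := {X | ∀ p, bt A X p ∈ Set.Ioo (a p) (b p)}

lemma BX_open (A : Mm d) (a b : Pairs k → ℝ) : IsOpen (BX A a b) := by
  unfold BX
  rw [Set.setOf_forall]
  exact isOpen_iInter_of_finite fun p => isOpen_Ioo.preimage (bt_cont A p)

lemma set_le_Nf (A : Mm d) (h0 : 0 < ε) (a b : Pairs k → ℝ) (H : Fin k → Measure (Vv d)) [∀ i, IsFiniteMeasure (H i)] :
    (Measure.pi H).real (BX A a b) ≤ Nf A H ε (fun p => a p - ε) (fun p => b p + ε) := by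
  rw [← integral_indicator_one (BX_open A a b).measurableSet]
  refine integral_mono ((integrable_const (1:ℝ)).indicator (BX_open A a b).measurableSet) (pps_int A h0 _ _ _) fun X => ?_
  by_cases h : X ∈ BX A a b
  · rw [iM h]
    unfold pps
    rw [Finset.prod_eq_one]
    · simp
    intro p _
    have := h p
    exact psi_eq_one h0 (by linarith [this.1]) (by linarith [this.2])
  · rw [iN h]; exact pps_nonneg A h0 _ _ X

lemma Nf_le_set (A : Mm d) (h0 : 0 < ε) (a b : Pairs k → ℝ) (H : Fin k → Measure (Vv d)) [∀ i, IsFiniteMeasure (H i)] :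
    Nf A H ε (fun p => a p + ε) (fun p => b p - ε) ≤ (Measure.pi H).real (BX A a b) := by
  rw [← integral_indicator_one (BX_open A a b).measurableSet]
  refine integral_mono (pps_int A h0 _ _ _) ((integrable_const (1:ℝ)).indicator (BX_open A a b).measurableSet) fun X => ?_
  by_cases h : X ∈ BX A a b
  · rw [iM h]; exact pps_le_one A h0 _ _ X
  · rw [iN h]
    unfold BX at h
    simp only [Set.mem_setOf_eq, not_forall] at h
    obtain ⟨p, hp⟩ := h
    unfold pps
    rw [Finset.prod_eq_zero (Finset.mem_univ p)]
    apply psi_eq_zero h0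
    rw [Set.mem_Ioo, not_and_or, not_lt, not_lt] at hp
    rcases hp with h | h
    · left; linarith
    · right; linarith

open Classical in
def Fs (d : ℕ) (L : Set (Fin d → ℤ)) (T : ℝ) : Finset (Fin d → ℤ) := (Vt d T).filter fun v => v ∈ L ∧ enorm2 (fun i => (v i : ℝ)) < T

lemma mem_Fs {L : Set (Fin d → ℤ)} {v : Fin d → ℤ} : v ∈ Fs d L T ↔ v ∈ L ∧ enorm2 (fun i => (v i : ℝ)) < T := by
  classical
  unfold Fs
  rw [Finset.mem_filter, and_iff_right_iff_imp]
  rintro ⟨_, h⟩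
  rw [mem_Vt]
  intro i
  have h1 := (pI (fun i => (v i : ℝ)) i).trans (norm_le_enorm2 _)
  have h2 := Mt_ge d T
  have h3 : 0 ≤ T := (enorm2_nonneg _).trans h.le
  rw [nA] at h1
  have h4 : ((|v i| : ℤ) : ℝ) ≤ ((Mt d T : ℤ) : ℝ) := by
    push_cast
    have : (0:ℝ) ≤ d := by positivity
    nlinarith
  exact_mod_cast h4

def nd (d : ℕ) (L : Set (Fin d → ℤ)) (T : ℝ) : Measure (Vv d) := ∑ v ∈ Fs d L T, Measure.dirac (fun i => (v i : ℝ))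

instance nd_fin (d : ℕ) (L : Set (Fin d → ℤ)) (T : ℝ) : IsFiniteMeasure (nd d L T) := by unfold nd; infer_instance

lemma enorm2_div (hT : 0 < T) (x : Vv d) : enorm2 (fun i => x i / T) = enorm2 x / T := by
  have : (fun i => x i / T) = T⁻¹ • x := by ext i; simp [div_eq_inv_mul]
  rw [this, enorm2_smul, aP pz, div_eq_inv_mul]

lemma nd_le (L : Set (Fin d → ℤ)) (h0 : 0 < ε) (hT : 0 < T) : nd d L T ≤ nud d L ε T := by
  classical
  unfold nd nud
  refine le_trans (le_of_eq ?_) (meas_sum_sub (f := fun v : Fin d → ℤ => oR (if v ∈ L then phi d ε (fun i => v i / T) else 0) • Measure.dirac (fun i => (v i : ℝ))) (Finset.filter_subset (fun v => v ∈ L ∧ enorm2 (fun i => (v i : ℝ)) < T) (Vt d T)) ) |>.trans (le_of_eq ?_)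
  · unfold Fs
    apply sC (by congr!)
    intro v hv
    rw [Finset.mem_filter] at hv
    rw [if_pos hv.2.1, phi_eq_one h0, oO, one_smul]
    rw [enorm2_div hT (fun i => (v i : ℝ)), div_lt_one hT]; exact hv.2.2
  · congr!

lemma nud_le (L : Set (Fin d → ℤ)) (h0 : 0 < ε) (hT : 0 < T) : nud d L ε T ≤ nd d L ((1 + 2 * d * ε) * T) := by
  classical
  unfold nd nud
  have hz : ∀ v ∈ Vt d T, v ∉ (Vt d T).filter (fun v => v ∈ L ∧ enorm2 (fun i => (v i : ℝ)) < (1 + 2 * d * ε) * T) → oR (if v ∈ L then phi d ε (fun i => v i / T) else 0) • Measure.dirac (fun i => (v i : ℝ)) = (0 : Measure (Vv d)) := by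
    intro v hv h
    rw [Finset.mem_filter] at h
    split_ifs with hL
    · by_cases hp : phi d ε (fun i => v i / T) = 0
      · rw [hp]; simp
      · exfalso
        have := phi_supp h0 hp
        rw [enorm2_div hT (fun i => (v i : ℝ)), div_lt_iff₀ hT] at this
        exact h ⟨hv, hL, this⟩
    · simp
  have e := Finset.sum_subset (Finset.filter_subset (fun v => v ∈ L ∧ enorm2 (fun i => (v i : ℝ)) < (1 + 2 * d * ε) * T) (Vt d T)) hz
  refine le_trans (le_of_eq ?_) (e.symm.le.trans ?_)
  · congr!
  refine le_trans (Finset.sum_le_sum (g := fun v : Fin d → ℤ => Measure.dirac (fun i => (v i : ℝ))) ?_) (meas_sum_sub ?_)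
  · intro v _ s
    rw [Measure.smul_apply, smul_eq_mul]
    refine mul_le_of_le_one_left (zero_le) (ENNReal.ofReal_le_one.mpr ?_)
    split_ifs
    · exact phi_le_one h0 _
    · exact zero_le_one
  · intro v hv
    rw [Finset.mem_filter] at hv
    exact mem_Fs.mpr hv.2

lemma pi_dirac (F : Finset (Fin d → ℤ)) : Measure.pi (fun _ : Fin k => ∑ v ∈ F, Measure.dirac (fun i => (v i : ℝ))) = ∑ V ∈ Fintype.piFinset (fun _ : Fin k => F), Measure.dirac (fun l i => (V l i : ℝ)) := by
  apply Measure.pi_eq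
  intro s hs
  simp only [Measure.finsetSum_apply]
  rw [Finset.prod_univ_sum]
  apply sC rfl
  intro V _
  rw [Measure.dirac_apply' _ (MeasurableSet.univ_pi hs)]
  by_cases h : ∀ i, (fun j => (V i j : ℝ)) ∈ s i
  · rw [iM (by intro i _; exact h i), Finset.prod_eq_one]
    · simp
    intro i _
    rw [Measure.dirac_apply' _ (hs i), iM (h i)]; rfl
  · rw [iN (by intro h'; exact h fun i => h' i trivial)]
    push Not at h
    obtain ⟨i, hi⟩ := h
    rw [Finset.prod_eq_zero (Finset.mem_univ i)]
    rw [Measure.dirac_apply' _ (hs i), iN hi]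

def cnt (A : Mm d) (L : Set (Fin d → ℤ)) (a b : Pairs k → ℝ) (T : ℝ) : ℝ := (Measure.pi fun _ : Fin k => nd d L T).real (BX A a b)

lemma cnt_eq (g : SL2n n) (L : Set (Fin (2*n) → ℤ)) (a b : Pairs k → ℝ) (T : ℝ) :
    cnt (Ag n g) L a b T = (Nat.card {v : Fin k → (Fin (2*n) → ℤ) |
    (∀ l, v l ∈ L) ∧ (∀ p : Pairs k, sympG n g (fun j => ((v p.1.1 j : ℤ) : ℝ))
        (fun j => ((v p.1.2 j : ℤ) : ℝ)) ∈ Set.Ioo (a p) (b p)) ∧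
    ∀ l, enorm2 (fun j => ((v l j : ℤ) : ℝ)) < T} : ℕ) := by
  classical
  have e : {v : Fin k → (Fin (2*n) → ℤ) |
    (∀ l, v l ∈ L) ∧ (∀ p : Pairs k, sympG n g (fun j => ((v p.1.1 j : ℤ) : ℝ))
        (fun j => ((v p.1.2 j : ℤ) : ℝ)) ∈ Set.Ioo (a p) (b p)) ∧
    ∀ l, enorm2 (fun j => ((v l j : ℤ) : ℝ)) < T} = (((Fintype.piFinset (fun _ : Fin k => Fs (2*n) L T)).filter fun V => (fun l i => (V l i : ℝ)) ∈ BX (Ag n g) a b : Finset (Fin k → Fin (2*n) → ℤ)) : Set (Fin k → Fin (2*n) → ℤ)) := by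
    ext V
    simp only [Set.mem_setOf_eq, Finset.coe_filter, Fintype.mem_piFinset, mem_Fs, BX, bt, sympG_eq]
    constructor
    · rintro ⟨h1, h2, h3⟩; exact ⟨fun l => ⟨h1 l, h3 l⟩, h2⟩
    · rintro ⟨h1, h2⟩; exact ⟨fun l => (h1 l).1, h2, fun l => (h1 l).2⟩
  rw [e, Nat.card_coe_set_eq, Set.ncard_coe_finset]
  unfold cnt nd
  rw [pi_dirac, Measure.real, Measure.finsetSum_apply]
  simp_rw [Measure.dirac_apply' _ (BX_open (Ag n g) a b).measurableSet, Set.indicator_apply]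
  rw [← Finset.sum_filter]
  simp

lemma cnt_up (A : Mm d) (L : Set (Fin d → ℤ)) (a b : Pairs k → ℝ) (h0 : 0 < ε) (hT : 1 ≤ T) :
    cnt A L a b T ≤ Nf A (fun _ => nud d L ε T) ε (fun p => a p - ε) (fun p => b p + ε) := by
  have i1 := BND_fin (nud_BND L h0 hT)
  exact (set_le_Nf A h0 a b _).trans (Nf_mono A h0 _ _ _ _ fun _ => nd_le L h0 (by linarith))

lemma cnt_down (A : Mm d) (L : Set (Fin d → ℤ)) (a b : Pairs k → ℝ) (h0 : 0 < ε) (hT : 1 ≤ T) :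
    Nf A (fun _ => nud d L ε T) ε (fun p => a p + ε) (fun p => b p - ε) ≤ cnt A L a b ((1 + 2 * d * ε) * T) := by
  have i1 := BND_fin (nud_BND L h0 hT)
  exact (Nf_mono A h0 _ _ _ _ fun _ => nud_le L h0 (by linarith)).trans (Nf_le_set A h0 a b _)

lemma nd_mono (L : Set (Fin d → ℤ)) {T T' : ℝ} (h : T ≤ T') : nd d L T ≤ nd d L T' := by
  unfold nd
  apply meas_sum_sub
  intro v hv
  rw [mem_Fs] at hv ⊢
  exact ⟨hv.1, hv.2.trans_le h⟩

lemma cnt_mono (A : Mm d) (L : Set (Fin d → ℤ)) (a b : Pairs k → ℝ) {T T' : ℝ} (h : T ≤ T') : cnt A L a b T ≤ cnt A L a b T' := by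
  unfold cnt Measure.real
  exact ENNReal.toReal_mono (measure_ne_top _ _) (pi_mono' _ _ (fun _ => nd_mono L h) _)

lemma card_pairs (K : ℕ) : fC (Pairs K) = ∑ i ∈ Finset.range K, i := by
  rw [Fintype.card_subtype, Finset.card_filter, ← Finset.univ_product_univ, Finset.sum_product]
  rw [← Finset.sum_range_reflect, ← Fin.sum_univ_eq_sum_range (fun j => K - 1 - j)]
  apply sC rfl
  intro i _
  rw [← Finset.card_filter, Finset.filter_lt_eq_Ioi, Fin.card_Ioi]

lemma card_pairs_succ (K : ℕ) : fC (Pairs (K+1)) = fC (Pairs K) + K := by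
  rw [card_pairs, card_pairs, Finset.sum_range_succ]

lemma two_card (K : ℕ) : 2 * fC (Pairs K) = K * (K - 1) := by
  rw [card_pairs, mul_comm, Finset.sum_range_id_mul_two]

def bE (d : ℕ) (T : ℝ) : Set (Vv d) := {x | enorm2 x < T}

lemma bE_open (d : ℕ) (T : ℝ) : IsOpen (bE d T) := isOpen_lt enorm2_cont continuous_const

lemma bE_sub (d : ℕ) (T : ℝ) : bE d T ⊆ Metric.closedBall 0 T := by
  intro x hx
  rw [mem_closedBall_zero_iff]
  exact (norm_le_enorm2 x).trans (le_of_lt hx)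

lemma bE_lt_top (d : ℕ) (T : ℝ) : volume (bE d T) < ⊤ :=
  (measure_mono (bE_sub d T)).trans_lt (isCompact_closedBall _ _).measure_lt_top

lemma bE_vol (hT : 0 < T) : volume (bE d T) = oR (T ^ d) * volume (bE d 1) := by
  have h := vol_scale hT (fun x => (bE d T).indicator 1 x) (measurable_one.indicator (bE_open d T).measurableSet)
  rw [lintegral_indicator_one (bE_open d T).measurableSet] at h
  rw [h, ← lintegral_indicator_one (bE_open d 1).measurableSet]
  congr 2
  ext x
  have : (T • x ∈ bE d T) ↔ x ∈ bE d 1 := by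
    unfold bE
    rw [Set.mem_setOf_eq, Set.mem_setOf_eq, enorm2_smul, aP hT]
    constructor
    · intro h; by_contra h'; nlinarith
    · intro h; nlinarith
  by_cases hx : x ∈ bE d 1
  · rw [iM hx, iM (this.mpr hx)]; rfl
  · rw [iN hx, iN (mt this.mp hx)]

lemma bE_pos (d : ℕ) : 0 < volume (bE d 1) := by
  refine (bE_open d 1).measure_pos (volume : Measure (Vv d)) ⟨0, ?_⟩
  unfold bE enorm2
  simp

lemma dp_abs (x y : Vv d) : |dp x y| ≤ d * (‖x‖ * ‖y‖) := by
  unfold dp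
  refine (Finset.abs_sum_le_sum_abs _ _).trans ?_
  have : ∀ i ∈ Finset.univ, |x i * y i| ≤ ‖x‖ * ‖y‖ := fun i _ => by
    rw [abs_mul]
    exact mul_le_mul (pI x i) (pI y i) (abs_nonneg _) (norm_nonneg _)
  refine (sL this).trans ?_
  simp

lemma dp_contL (y : Vv d) : Continuous (fun x => dp x y) := by unfold dp; fun_prop

def tube {d r : ℕ} (T : ℝ) (u : Fin r → Vv d) : Set (Vv d) := {x | enorm2 x < T ∧ ∀ i, |dp x (u i)| < 1}

lemma tube_open {d r : ℕ} (T : ℝ) (u : Fin r → Vv d) : IsOpen (tube T u) := by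
  unfold tube
  have : {x : Vv d | enorm2 x < T ∧ ∀ i, |dp x (u i)| < 1} = bE d T ∩ ⋂ i, {x | |dp x (u i)| < 1} := by ext x; simp [bE]
  rw [this]
  exact (bE_open d T).inter (isOpen_iInter_of_finite fun i => isOpen_lt (continuous_abs.comp (dp_contL _)) continuous_const)

lemma tube_vol (d r : ℕ) {C : ℝ} (hC : 0 ≤ C) : ∃ c > (0:ℝ), ∀ T ≥ (1:ℝ), ∀ u : Fin r → Vv d, (∀ i, ‖u i‖ ≤ C * T) →
    oR (c * (T ^ d * ((T ^ 2) ^ r)⁻¹)) ≤ volume (tube T u) := by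
  have hv := bE_pos d
  have hv' := bE_lt_top d 1
  obtain ⟨v, hvv⟩ : ∃ v : ℝ, v = (volume (bE d 1)).toReal := ⟨_, rfl⟩
  have hv0 : 0 < v := by rw [hvv]; exact ENNReal.toReal_pos hv.ne' hv'.ne
  have hvr : volume (bE d 1) = oR v := by rw [hvv, ENNReal.ofReal_toReal hv'.ne]
  refine ⟨v * 2⁻¹ ^ d * ((2 * d * C + 5) ^ r)⁻¹, by positivity, ?_⟩
  intro T hT u hu
  have hT0 : 0 < T := by linarith
  obtain ⟨R, hR⟩ : ∃ R : ℤ, R = ⌈d * C * T ^ 2⌉ + 1 := ⟨_, rfl⟩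
  have hR1 : d * C * T ^ 2 + 1 ≤ R := by rw [hR]; push_cast; linarith [Int.le_ceil (d * C * T ^ 2)]
  have hR2 : (R : ℝ) ≤ d * C * T ^ 2 + 2 := by rw [hR]; push_cast; linarith [(Int.ceil_lt_add_one (d * C * T ^ 2)).le]
  have hd0 : 0 ≤ d * C * T ^ 2 := by positivity
  have key : volume (bE d (T/2)) ≤ ∑ q ∈ Fintype.piFinset (fun _ : Fin r => Finset.Icc (-R) R), volume (tube T u) := by
    have sub : bE d (T/2) ⊆ ⋃ q ∈ Fintype.piFinset (fun _ : Fin r => Finset.Icc (-R) R), (bE d (T/2) ∩ {x | ∀ i, ⌊dp x (u i)⌋ = q i}) := by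
      intro x hx
      simp only [Set.mem_iUnion]
      refine ⟨fun i => ⌊dp x (u i)⌋, ?_, hx, fun i => rfl⟩
      rw [Fintype.mem_piFinset]
      intro i
      have h1 := dp_abs x (u i)
      have h2 : ‖x‖ ≤ T := (norm_le_enorm2 x).trans (by have : enorm2 x < T/2 := hx; linarith)
      have h3 : |dp x (u i)| ≤ d * C * T ^ 2 := by
        refine h1.trans ?_
        have : ‖x‖ * ‖u i‖ ≤ T * (C * T) := mul_le_mul h2 (hu i) (norm_nonneg _) hT0.le
        calc _ ≤ (d:ℝ) * (T * (C * T)) := by gcongr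
          _ = _ := by ring
      rw [abs_le] at h3
      rw [Finset.mem_Icc]
      constructor
      · rw [Int.le_floor]; push_cast; linarith
      · have := Int.floor_le (dp x (u i))
        have : ((⌊dp x (u i)⌋ : ℤ) : ℝ) ≤ R := by linarith
        exact_mod_cast this
    refine (measure_mono sub).trans ((measure_biUnion_finset_le _ _).trans (sL fun q _ => ?_))
    by_cases hne : (bE d (T/2) ∩ {x | ∀ i, ⌊dp x (u i)⌋ = q i}).Nonempty
    · obtain ⟨x0, hx0, hx0'⟩ := hne
      rw [← measure_preimage_add (volume : Measure (Vv d)) x0 (bE d (T/2) ∩ {x | ∀ i, ⌊dp x (u i)⌋ = q i})]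
      apply measure_mono
      rintro x ⟨h1, h2⟩
      have e : x = (x0 + x) + (-1:ℝ) • x0 := by ext i; simp
      constructor
      · rw [e]
        refine (enorm2_add _ _).trans_lt ?_
        rw [enorm2_smul]
        have h3 : enorm2 (x0 + x) < T / 2 := h1
        have h4 : enorm2 x0 < T / 2 := hx0
        norm_num
        linarith
      · intro i
        have h3 : ⌊dp (x0 + x) (u i)⌋ = ⌊dp x0 (u i)⌋ := by rw [h2 i, hx0' i]
        have h4 := Int.abs_sub_lt_one_of_floor_eq_floor h3
        have h5 : dp x (u i) = dp (x0 + x) (u i) - dp x0 (u i) := by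
          unfold dp; rw [← Finset.sum_sub_distrib]; apply sC rfl; intro j _; simp; ring
        rw [h5]; exact h4
    · rw [Set.not_nonempty_iff_eq_empty] at hne
      rw [hne]; simp
  rw [Finset.sum_const, nsmul_eq_mul, Fintype.card_piFinset_const, Int.card_Icc, bE_vol pz, hvr] at key
  have hN : ((((R + 1 - -R).toNat) ^ r : ℕ) : ENNReal) ≤ oR (((2 * d * C + 5) * T ^ 2) ^ r) := by
    rw [Nat.cast_pow, ENNReal.ofReal_pow pz]
    gcongr
    rw [← ENNReal.ofReal_natCast]
    apply oL
    have : (((R + 1 - -R).toNat : ℕ) : ℤ) = R + 1 - -R := by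
      apply Int.toNat_of_nonneg
      have : (0:ℝ) ≤ R := by linarith
      have : 0 ≤ R := by exact_mod_cast this
      linarith
    have : (((R + 1 - -R).toNat : ℕ) : ℝ) = R + 1 - -R := by exact_mod_cast this
    rw [this]
    nlinarith [oP hT (n := 2)]
  have key2 := key.trans (mul_le_mul_left hN _)
  obtain ⟨N, hNN⟩ : ∃ N : ℝ, N = ((2 * d * C + 5) * T ^ 2) ^ r := ⟨_, rfl⟩
  have hN0 : 0 < N := by rw [hNN]; positivity
  rw [← hNN] at key2
  have e : v * 2⁻¹ ^ d * ((2 * d * C + 5) ^ r)⁻¹ * (T ^ d * ((T ^ 2) ^ r)⁻¹) = N⁻¹ * ((T/2)^d * v) := by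
    rw [hNN, mul_pow, mul_inv, dI, mul_pow]; ring
  rw [e, oM pz, oM pz]
  calc _ ≤ oR N⁻¹ * (oR N * volume (tube T u)) := by gcongr
    _ = volume (tube T u) := by
      rw [← mul_assoc, ← oM pz, inv_mul_cancel₀ hN0.ne', oO, one_mul]

instance rest_fin (d : ℕ) (T : ℝ) : IsFiniteMeasure ((volume : Measure (Vv d)).restrict (bE d T)) :=
  ⟨by rw [Measure.restrict_apply_univ]; exact bE_lt_top d T⟩

lemma mv_bound (A : Mm d) : ∃ C ≥ (0:ℝ), ∀ y, ‖A *ᵥ y‖ ≤ C * ‖y‖ := by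
  obtain ⟨C, hC, h⟩ := (LinearMap.toContinuousLinearMap (Matrix.mulVecLin A)).bound
  exact ⟨C, hC.le, h⟩

lemma BX_lower (A : Mm d) (K : ℕ) : ∃ c > (0:ℝ), ∀ T ≥ (1:ℝ),
    oR (c * ((T ^ d) ^ K * ((T ^ 2) ^ fC (Pairs K))⁻¹)) ≤ Measure.pi (fun _ : Fin K => (volume : Measure (Vv d)).restrict (bE d T)) (BX A (fun _ => -1) (fun _ => 1)) := by
  induction K with
  | zero =>
    refine ⟨1, one_pos, ?_⟩
    intro T hT
    have : BX A (fun _ : Pairs 0 => (-1:ℝ)) (fun _ => 1) = Set.univ := by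
      ext X; simp only [Set.mem_univ, iff_true]; intro p; exact p.1.1.elim0
    rw [this, Measure.pi_univ]
    simp
  | succ K ih =>
    obtain ⟨c, hc, h⟩ := ih
    obtain ⟨CA, hCA, hA⟩ := mv_bound A
    obtain ⟨c', hc', h'⟩ := tube_vol d K hCA
    refine ⟨c * c', by positivity, ?_⟩
    intro T hT
    have hT0 : 0 < T := by linarith
    specialize h T hT
    rw [← lintegral_indicator_one (BX_open A _ _).measurableSet, iso_lint _ 0 _ (measurable_one.indicator (BX_open A _ _).measurableSet)]
    have hae : ∀ᵐ X ∂Measure.pi (fun _ : Fin K => (volume : Measure (Vv d)).restrict (bE d T)), ∀ i, ‖X i‖ ≤ T := by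
      rw [ae_all_iff]
      intro i
      apply Measure.tendsto_eval_ae_ae.eventually (p := fun y : Vv d => ‖y‖ ≤ T)
      rw [ae_restrict_iff' (bE_open d T).measurableSet]
      exact eF fun y hy => (norm_le_enorm2 y).trans (le_of_lt hy)
    calc oR (c * c' * ((T ^ d) ^ (K+1) * ((T ^ 2) ^ fC (Pairs (K+1)))⁻¹))
        = oR (c' * (T ^ d * ((T ^ 2) ^ K)⁻¹)) * oR (c * ((T ^ d) ^ K * ((T ^ 2) ^ fC (Pairs K))⁻¹)) := by
          rw [← oM pz, card_pairs_succ, pow_add (T^2), mul_inv, pow_succ]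
          congr 1; ring
      _ ≤ oR (c' * (T ^ d * ((T ^ 2) ^ K)⁻¹)) * Measure.pi (fun _ : Fin K => (volume : Measure (Vv d)).restrict (bE d T)) (BX A (fun _ => -1) (fun _ => 1)) := by gcongr
      _ = ∫⁻ X, (BX A (fun _ => -1) (fun _ => 1)).indicator (fun _ => oR (c' * (T ^ d * ((T ^ 2) ^ K)⁻¹))) X ∂Measure.pi (fun _ : Fin K => (volume : Measure (Vv d)).restrict (bE d T)) := by
          rw [lintegral_indicator_const (BX_open A _ _).measurableSet]
      _ ≤ _ := by
          apply lintegral_mono_ae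
          filter_upwards [hae] with X hX
          by_cases hXB : X ∈ BX A (fun _ : Pairs K => (-1:ℝ)) (fun _ => 1)
          · rw [iM hXB]
            refine (h' T hT (fun i => A *ᵥ X i) (fun i => (hA _).trans (by gcongr; exact hX i))).trans ?_
            have e1 : volume (tube T fun i => A *ᵥ X i) = ((volume : Measure (Vv d)).restrict (bE d T)) (tube T fun i => A *ᵥ X i) := by
              rw [Measure.restrict_apply (tube_open _ _).measurableSet, Set.inter_eq_left.mpr]
              intro x hx; exact hx.1
            rw [e1, ← lintegral_indicator_one (tube_open _ _).measurableSet]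
            apply lintegral_mono
            intro x
            by_cases hx : x ∈ tube T fun i => A *ᵥ X i
            · beta_reduce
              rw [iM hx, iM]
              · rfl
              rintro ⟨⟨i, j⟩, hij⟩
              have hij' : i < j := hij
              unfold ins bt
              simp only [Fin.insertNth_zero']
              obtain rfl | ⟨j, rfl⟩ := Fin.eq_zero_or_eq_succ j
              · exact absurd hij' (Fin.not_lt_zero _)
              obtain rfl | ⟨i, rfl⟩ := Fin.eq_zero_or_eq_succ i
              · simp only [Fin.cons_zero, Fin.cons_succ]
                exact abs_lt.mp (hx.2 j)
              · simp only [Fin.cons_succ]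
                exact hXB ⟨(i, j), Fin.succ_lt_succ_iff.mp hij'⟩
            · rw [iN hx]; exact zero_le
          · rw [iN hXB]; exact zero_le

lemma nuc_comp {ε ε' T : ℝ} (h0 : 0 < ε) (h0' : 0 < ε') (hT : 0 < T) : nuc d 1 ε' T ≤ nuc d 1 ε ((1 + 2 * d * ε') * T) := by
  unfold nuc
  rw [oO, one_smul, one_smul]
  refine withDensity_mono (eF fun x => oL ?_)
  by_cases hp : phi d ε' (fun i => x i / T) = 0
  · rw [hp]; exact phi_nonneg h0 _
  · have h1 := phi_supp h0' hp
    rw [enorm2_div hT, div_lt_iff₀ hT] at h1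
    rw [phi_eq_one (ε := ε) h0]
    · exact phi_le_one h0' _
    · rw [enorm2_div pz, div_lt_one pz]; exact h1

lemma rest_le (h0 : 0 < ε) (hT : 0 < T) : (volume : Measure (Vv d)).restrict (bE d T) ≤ nuc d 1 ε T := by
  unfold nuc
  rw [oO, one_smul, ← withDensity_indicator_one (bE_open d T).measurableSet]
  refine withDensity_mono (eF fun x => ?_)
  by_cases hx : x ∈ bE d T
  · beta_reduce
    rw [iM hx, phi_eq_one h0]
    · simp
    · rw [enorm2_div hT, div_lt_one hT]; exact hx
  · rw [iN hx]; exact zero_le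

lemma le_of_inv {x y C : ℝ} (h : ∀ T ≥ (1:ℝ), x ≤ y + C * (T ^ 2)⁻¹) : x ≤ y := by
  have h1 : Filter.Tendsto (fun T : ℝ => y + C * (T ^ 2)⁻¹) Filter.atTop (nhds (y + C * 0)) :=
    ((tendsto_inv_atTop_zero.comp (Filter.tendsto_pow_atTop (by norm_num))).const_mul C).const_add y
  rw [mul_zero, add_zero] at h1
  exact ge_of_tendsto h1 (Filter.eventually_atTop.mpr ⟨1, h⟩)

lemma pow_e {d K D e : ℕ} (he : d * K = e + 2 * D) (hT : 0 < T) : (T ^ d) ^ K * ((T ^ 2) ^ D)⁻¹ = T ^ e := by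
  rw [← pow_mul, ← pow_mul, he, pow_add, mul_assoc, mul_inv_cancel₀ pz, mul_one]

lemma V_fix (k e : ℕ) (hd : fC (Pairs (k+2)) + 1 < d) (he : d * (k+2) = e + 2 * fC (Pairs (k+2))) {c : ℝ} (hc : 0 < c) {A : Mm d} (hA : Skew A) (hAc : ∀ y, c * ‖y‖ ≤ ‖A *ᵥ y‖)
    {a b : ℝ} (hab : a ≤ b) {ε : ℝ} (h0 : 0 < ε) (h1 : ε ≤ 1) : ∃ C, ∀ T ≥ (1:ℝ), |Nf A (fun _ : Fin (k+2) => nuc d 1 ε T) 1 (fun _ => a) (fun _ => b) - T ^ e * ((b - a) ^ fC (Pairs (k+2)) * cE (k+2) A ε)| ≤ T ^ e * (C * (T ^ 2)⁻¹) := by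
  obtain ⟨C, hC, h⟩ := V_asym (d := d) k hd hc (M := max |a| |b|) pz
  refine ⟨C * ε⁻¹ ^ d, ?_⟩
  intro T hT
  have := h A hA hAc ε h0 h1 1 one_pos le_rfl 1 zero_le_one le_rfl T hT (fun _ => a) (fun _ => b) (fun _ => hab) (fun _ => le_max_left _ _) (fun _ => le_max_right _ _)
  rw [one_mul, pow_e he (by linarith)] at this
  simpa using this

lemma Nf_nonneg (A : Mm d) (H : Fin k → Measure (Vv d)) (h0 : 0 < ε) (a b : Pairs k → ℝ) : 0 ≤ Nf A H ε a b :=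
  integral_nonneg fun X => pps_nonneg A h0 a b X

lemma cE_nonneg (k e : ℕ) (hd : fC (Pairs (k+2)) + 1 < d) (he : d * (k+2) = e + 2 * fC (Pairs (k+2))) {c : ℝ} (hc : 0 < c) {A : Mm d} (hA : Skew A) (hAc : ∀ y, c * ‖y‖ ≤ ‖A *ᵥ y‖)
    {ε : ℝ} (h0 : 0 < ε) (h1 : ε ≤ 1) : 0 ≤ cE (k+2) A ε := by
  obtain ⟨C, h⟩ := V_fix k e hd he hc hA hAc zero_le_one h0 h1
  apply le_of_inv (C := C)
  intro T hT
  have := (abs_le.mp (h T hT)).2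
  have h3 := Nf_nonneg A (fun _ : Fin (k+2) => nuc d 1 ε T) one_pos (fun _ => 0) (fun _ => 1)
  have h4 : 0 < T ^ e := by positivity
  rw [sub_zero, one_pow, one_mul] at this
  by_contra hn
  push Not at hn
  have := mul_neg_of_pos_of_neg h4 hn
  nlinarith

lemma cE_comp (k e : ℕ) (hd : fC (Pairs (k+2)) + 1 < d) (he : d * (k+2) = e + 2 * fC (Pairs (k+2))) {c : ℝ} (hc : 0 < c) {A : Mm d} (hA : Skew A) (hAc : ∀ y, c * ‖y‖ ≤ ‖A *ᵥ y‖)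
    {ε ε' : ℝ} (h0 : 0 < ε) (h1 : ε ≤ 1) (h0' : 0 < ε') (h1' : ε' ≤ 1) : cE (k+2) A ε' ≤ (1 + 2 * d * ε') ^ e * cE (k+2) A ε := by
  obtain ⟨C, h⟩ := V_fix k e hd he hc hA hAc zero_le_one h0 h1
  obtain ⟨C', h'⟩ := V_fix k e hd he hc hA hAc zero_le_one h0' h1'
  obtain ⟨l, hl⟩ : ∃ l : ℝ, l = 1 + 2 * d * ε' := ⟨_, rfl⟩
  have hl1 : 1 ≤ l := by rw [hl]; have : 0 ≤ 2 * d * ε' := by positivity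
                         linarith
  apply le_of_inv (C := C' + l ^ e * (C * (l ^ 2)⁻¹))
  intro T hT
  have hT0 : 0 < T := by linarith
  have i1 := BND_fin (nuc_BND (d := d) le_rfl h0' h1' hT)
  have i2 := BND_fin (nuc_BND (d := d) le_rfl h0 h1 (one_le_mul_of_one_le_of_one_le hl1 hT))
  have g1 := (abs_le.mp (h' T hT)).1
  have g2 := (abs_le.mp (h (l * T) (one_le_mul_of_one_le_of_one_le hl1 hT))).2
  have g3 := Nf_mono A one_pos (fun _ => 0) (fun _ => 1) (fun _ : Fin (k+2) => nuc d 1 ε' T) (fun _ => nuc d 1 ε (l * T)) (fun _ => by rw [hl]; exact nuc_comp h0 h0' hT0)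
  have h4 : 0 < T ^ e := by positivity
  rw [sub_zero, one_pow, one_mul] at g1 g2
  rw [← hl]
  have : T ^ e * cE (k+2) A ε' ≤ T ^ e * (l ^ e * cE (k+2) A ε + (C' + l ^ e * (C * (l ^ 2)⁻¹)) * (T ^ 2)⁻¹) := by
    calc _ ≤ (l * T) ^ e * cE (k+2) A ε + (l * T) ^ e * (C * ((l * T) ^ 2)⁻¹) + T ^ e * (C' * (T ^ 2)⁻¹) := by linarith
      _ = _ := by rw [mul_pow, mul_pow, mul_inv]; ring
  exact le_of_mul_le_mul_left this h4

def cA (k : ℕ) (A : Mm d) : ℝ := sInf (cE k A '' Set.Ioc 0 1)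

lemma cA_props (k e : ℕ) (hd : fC (Pairs (k+2)) + 1 < d) (he : d * (k+2) = e + 2 * fC (Pairs (k+2))) {c : ℝ} (hc : 0 < c) {A : Mm d} (hA : Skew A) (hAc : ∀ y, c * ‖y‖ ≤ ‖A *ᵥ y‖) :
    0 < cA (k+2) A ∧ ∀ ε : ℝ, 0 < ε → ε ≤ 1 → cA (k+2) A ≤ cE (k+2) A ε ∧ cE (k+2) A ε ≤ (1 + 2 * d * ε) ^ e * cA (k+2) A := by
  have hne : (cE (k+2) A '' Set.Ioc 0 1).Nonempty := ⟨_, 1, ⟨one_pos, le_rfl⟩, rfl⟩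
  constructor
  · obtain ⟨c', hc', h⟩ := BX_lower A (k+2)
    have : c' * (4 ^ fC (Pairs (k+2)))⁻¹ ≤ cA (k+2) A := by
      apply le_csInf hne
      rintro _ ⟨ε, ⟨h0, h1⟩, rfl⟩
      obtain ⟨C, hV⟩ := V_fix k e hd he hc hA hAc (show (-1:ℝ) - 1 ≤ 1 + 1 by norm_num) h0 h1
      rw [mul_inv_le_iff₀ pz]
      apply le_of_inv (C := C)
      intro T hT
      have hT0 : 0 < T := by linarith
      have i1 := BND_fin (nuc_BND (d := d) le_rfl h0 h1 hT)
      have g0 := h T hT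
      rw [pow_e he hT0] at g0
      have g1 : c' * T ^ e ≤ (Measure.pi (fun _ : Fin (k+2) => (volume : Measure (Vv d)).restrict (bE d T))).real (BX A (fun _ => -1) (fun _ => 1)) :=
        (ENNReal.ofReal_le_iff_le_toReal (measure_ne_top _ _)).mp g0
      have g2 := g1.trans (set_le_Nf A one_pos _ _ _)
      have g3 := g2.trans (Nf_mono A one_pos _ _ _ (fun _ : Fin (k+2) => nuc d 1 ε T) (fun _ => rest_le h0 hT0))
      have g4 := (abs_le.mp (hV T hT)).2
      have h4 : 0 < T ^ e := by positivity
      norm_num at g3 g4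
      have : T ^ e * c' ≤ T ^ e * (cE (k+2) A ε * 4 ^ fC (Pairs (k+2)) + C * (T ^ 2)⁻¹) := by linarith
      exact le_of_mul_le_mul_left this h4
    exact lt_of_lt_of_le pz this
  · intro ε h0 h1
    constructor
    · apply csInf_le
      · refine ⟨0, ?_⟩
        rintro _ ⟨ε, ⟨h0, h1⟩, rfl⟩
        exact cE_nonneg k e hd he hc hA hAc h0 h1
      · exact ⟨ε, ⟨h0, h1⟩, rfl⟩
    · have hl : 0 < (1 + 2 * d * ε) ^ e := by positivity
      rw [← div_le_iff₀' hl]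
      apply le_csInf hne
      rintro _ ⟨ε', ⟨h0', h1'⟩, rfl⟩
      rw [div_le_iff₀' hl]
      exact cE_comp k e hd he hc hA hAc h0' h1' h0 h1

lemma J_sq (n : ℕ) (x : Vv (2*n)) : ‖x‖ ≤ ‖Jmat n *ᵥ x‖ := by
  rw [pN (norm_nonneg _)]
  intro i
  have h := pI (Jmat n *ᵥ x) (st n i)
  rw [J_mulVec, st_st, norm_mul, nA (sg _ _), sg_abs, one_mul] at h
  exact h

lemma inv_low (G H : Mm d) (h : H * G = 1) : ∃ c > (0:ℝ), ∀ y, c * ‖y‖ ≤ ‖G *ᵥ y‖ := by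
  obtain ⟨C, hC, hb⟩ := mv_bound H
  refine ⟨(C + 1)⁻¹, by positivity, fun y => ?_⟩
  have h1 := hb (G *ᵥ y)
  rw [mV, h, Matrix.one_mulVec] at h1
  rw [inv_mul_le_iff₀ pz]
  nlinarith [norm_nonneg (G *ᵥ y)]

lemma Ag_low (n : ℕ) (g : SL2n n) : ∃ c > (0:ℝ), ∀ y, c * ‖y‖ ≤ ‖Ag n g *ᵥ y‖ := by
  have e1 : ((g⁻¹ : SL2n n) : Mm (2*n)) * (g : Mm (2*n)) = 1 := by
    rw [← Matrix.SpecialLinearGroup.coe_mul, inv_mul_cancel, Matrix.SpecialLinearGroup.coe_one]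
  have e2 : (g : Mm (2*n)) * ((g⁻¹ : SL2n n) : Mm (2*n)) = 1 := by
    rw [← Matrix.SpecialLinearGroup.coe_mul, mul_inv_cancel, Matrix.SpecialLinearGroup.coe_one]
  have e3 : ((g⁻¹ : SL2n n) : Mm (2*n))ᵀ * (g : Mm (2*n))ᵀ = 1 := by
    rw [← Matrix.transpose_mul, e2, Matrix.transpose_one]
  obtain ⟨c1, h1, g1⟩ := inv_low _ _ e1
  obtain ⟨c2, h2, g2⟩ := inv_low _ _ e3
  refine ⟨c2 * c1, by positivity, fun y => ?_⟩
  unfold Ag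
  rw [← mV, ← mV, mul_assoc]
  exact (mL ((g1 y).trans (J_sq n _)) h2.le).trans (g2 _)

lemma Nf_contg (H : Fin k → Measure (Vv (2*n))) [∀ i, IsFiniteMeasure (H i)] (h0 : 0 < ε) (a b : Pairs k → ℝ) : Continuous (fun g : SL2n n => Nf (Ag n g) H ε a b) := by
  unfold Nf
  apply continuous_of_dominated (bound := fun _ => (1:ℝ))
  · intro g; exact (pps_cont _ h0 a b).aestronglyMeasurable
  · intro g; refine eF fun X => ?_
    rw [rN (pps_nonneg _ h0 a b X)]; exact pps_le_one _ h0 a b X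
  · exact integrable_const _
  · refine eF fun X => ?_
    unfold pps
    apply continuous_finsetProd; intro p _
    refine (psi_cont h0 _ _).comp ?_
    have h1 : Continuous (fun g : SL2n n => Ag n g *ᵥ X p.1.2) := Continuous.matrix_mulVec (Ag_contM n) continuous_const
    unfold bt dp
    exact continuous_finsetSum _ fun i _ => continuous_const.mul ((continuous_apply i).comp h1)

def DV (n k : ℕ) (L : Set (Fin (2*n) → ℤ)) (κ : ℝ) (m J : ℕ) (a b : Pairs k → ℝ) (g : SL2n n) : ℝ :=
  |Nf (Ag n g) (fun _ => nud (2*n) L (J:ℝ)⁻¹ ((J:ℝ)^m)) (J:ℝ)⁻¹ a b - Nf (Ag n g) (fun _ => nuc (2*n) κ (J:ℝ)⁻¹ ((J:ℝ)^m)) (J:ℝ)⁻¹ a b|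

lemma BC (L : Set (Fin (2*n) → ℤ)) {κ : ℝ} (hκ : 0 ≤ κ) (hκ1 : κ ≤ 1) (hD : Dprop n L κ) (μ : Measure (SL2n n)) [hμ : μ.IsHaarMeasure] (B : ℝ) (hB : 0 ≤ B)
    (m e : ℕ) (hm : m = 2*(2*n) + 4 * fC (Pairs (k+1)) + 3) (he : 2*n*k+6 ≤ e) (J0 : ℕ) (hJ0 : 1 ≤ J0) (a b : ℕ → Pairs (k+1) → ℝ) (hab : ∀ J ≥ J0, ∀ p, a J p ≤ b J p) (hab' : ∀ J ≥ J0, ∀ p, b J p - a J p ≤ B) :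
    ∀ᵐ g ∂μ, ∃ J1 ≥ J0, ∀ J ≥ J1, DV n (k+1) L κ m J (a J) (b J) g ≤ ((J:ℝ)^m)^e * (J:ℝ)⁻¹ := by
  have hu : ∀ α : ℕ, ∀ᵐ g ∂μ.restrict (Ka (2*n) (α + 1)), ∃ J1 ≥ J0, ∀ J ≥ J1, DV n (k+1) L κ m J (a J) (b J) g ≤ ((J:ℝ)^m)^e * (J:ℝ)⁻¹ := by
    intro α
    have hα : (1:ℝ) ≤ (α:ℝ) + 1 := by linarith [Nat.cast_nonneg (α := ℝ) α]
    obtain ⟨C, hC0, hC⟩ := N_avg (k := k) L hκ hκ1 hD (α := (α:ℝ) + 1) hα μ B hB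
    obtain ⟨w, hw⟩ : ∃ w : ℕ → ℝ, w = fun J : ℕ => (((J:ℝ)^m)^e)⁻¹ * (J:ℝ) := ⟨_, rfl⟩
    have hw0 : ∀ J, 0 ≤ w J := fun J => by rw [hw]; positivity
    have hf : ∀ j : ℕ, Measurable (fun g : SL2n n => oR (w (j + J0)) * oR (DV n (k+1) L κ m (j + J0) (a (j + J0)) (b (j + J0)) g)) := by
      intro j
      have hJ1 : (1:ℝ) ≤ ((j + J0 : ℕ) : ℝ) := by exact_mod_cast (by omega : 1 ≤ j + J0)
      have h0 : (0:ℝ) < ((j + J0 : ℕ) : ℝ)⁻¹ := by positivity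
      have i1 := BND_fin (nud_BND L h0 (oP hJ1 (n := m)))
      have i2 := BND_fin (nuc_BND hκ1 h0 (iL hJ1) (oP hJ1 (n := m)) (d := 2*n))
      unfold DV
      exact (((Nf_contg _ h0 _ _).sub (Nf_contg _ h0 _ _)).abs.measurable.ennreal_ofReal).const_mul _
    have hsum : ∫⁻ g in Ka (2*n) (α + 1), ∑' j : ℕ, oR (w (j + J0)) * oR (DV n (k+1) L κ m (j + J0) (a (j + J0)) (b (j + J0)) g) ∂μ ≠ ⊤ := by
      rw [lintegral_tsum fun j => (hf j).aemeasurable]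
      have hle : ∀ j : ℕ, ∫⁻ g in Ka (2*n) (α + 1), oR (w (j + J0)) * oR (DV n (k+1) L κ m (j + J0) (a (j + J0)) (b (j + J0)) g) ∂μ ≤ oR (C * (((j:ℝ)+1)^2)⁻¹) := by
        intro j
        rw [lintegral_const_mul' _ _ ENNReal.ofReal_ne_top]
        obtain ⟨J, hJ⟩ : ∃ J : ℕ, J = j + J0 := ⟨_, rfl⟩
        rw [← hJ]
        have hJJ : J ≥ J0 := by omega
        have hJ1 : (1:ℝ) ≤ (J : ℝ) := by exact_mod_cast (by omega : 1 ≤ J)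
        have hJj : (j:ℝ) + 1 ≤ J := by exact_mod_cast (by omega : j + 1 ≤ J)
        have hT1 := oP hJ1 (n := m)
        have hh := hC (J:ℝ)⁻¹ pz (iL hJ1) ((J:ℝ)^m) hT1 (a J) (b J) (hab J hJJ) (hab' J hJJ)
        unfold DV
        refine (mul_le_mul_right hh _).trans ?_
        rw [← oM (hw0 J)]
        apply oL
        rw [inv_inv, hw]
        beta_reduce
        have hT0 : 0 < (J:ℝ)^m := by positivity
        have h2 : ((J:ℝ)^m)^(2*n*k+5) * (J:ℝ)^m ≤ ((J:ℝ)^m)^e := by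
          rw [← pow_succ]; exact pow_le_pow_right₀ hT1 (by omega)
        have h3 : (J:ℝ)^m = J ^ (2*(2*n) + 4 * fC (Pairs (k+1))) * J * J^2 := by
          rw [hm]; ring
        obtain ⟨X, hX⟩ : ∃ X : ℝ, X = J ^ (2*(2*n) + 4 * fC (Pairs (k+1))) := ⟨_, rfl⟩
        rw [← hX] at h3 ⊢
        have hX0 : 0 < X := by rw [hX]; positivity
        obtain ⟨Y, hY⟩ : ∃ Y : ℝ, Y = ((J:ℝ)^m)^(2*n*k+5) := ⟨_, rfl⟩
        rw [← hY] at h2 ⊢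
        have hY0 : 0 < Y := by rw [hY]; positivity
        obtain ⟨Z, hZ⟩ : ∃ Z : ℝ, Z = ((J:ℝ)^m)^e := ⟨_, rfl⟩
        rw [← hZ] at h2 ⊢
        have hZ0 : 0 < Z := by rw [hZ]; positivity
        rw [h3] at h2
        have hJ0' : (0:ℝ) < J := by linarith
        have h4 : Z⁻¹ * (J:ℝ) * (C * X * Y) ≤ C * ((J:ℝ)^2)⁻¹ := by
          rw [← dI, lD pz]
          calc _ = C * (Z⁻¹ * (Y * (X * J * J^2))) := by ring
            _ ≤ C * (Z⁻¹ * Z) := by gcongr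
            _ = C := by rw [inv_mul_cancel₀ hZ0.ne', mul_one]
        refine h4.trans ?_
        gcongr
      refine ((ENNReal.tsum_le_tsum hle).trans_lt ?_).ne
      have hs : Summable (fun j : ℕ => C * (((j:ℝ)+1)^2)⁻¹) := by
        apply Summable.mul_left
        have := (summable_nat_add_iff 1).mpr (Real.summable_nat_pow_inv.mpr (show 1 < 2 by norm_num))
        simpa using this
      rw [← ENNReal.ofReal_tsum_of_nonneg (fun j => by positivity) hs]
      exact ENNReal.ofReal_lt_top
    filter_upwards [ae_lt_top' (AEMeasurable.ennreal_tsum fun j => (hf j).aemeasurable) hsum] with g hg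
    have ht := ENNReal.tendsto_atTop_zero_of_tsum_ne_top hg.ne
    have hev := (ENNReal.tendsto_nhds_zero.mp ht) 1 one_pos
    obtain ⟨j1, hj1⟩ := Filter.eventually_atTop.mp hev
    refine ⟨j1 + J0, by omega, fun J hJ => ?_⟩
    have h1 := hj1 (J - J0) (by omega)
    rw [show J - J0 + J0 = J by omega, ← oM (hw0 J), ENNReal.ofReal_le_one, hw] at h1
    beta_reduce at h1
    have hJ1 : (1:ℝ) ≤ (J : ℝ) := by exact_mod_cast (by omega : 1 ≤ J)
    have hJ0' : (0:ℝ) < J := by linarith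
    rw [← dI, lD hJ0']
    rw [mul_assoc, inv_mul_le_iff₀ pz, mul_one] at h1
    linarith
  have h2 := (ae_restrict_iUnion_iff (μ := μ) (fun α : ℕ => Ka (2*n) ((α:ℝ) + 1)) _).mpr hu
  rw [Ka_union, Measure.restrict_univ] at h2
  exact h2

lemma lip_zero (F : ℝ → ℝ) (hF : ContDiff ℝ 1 F) : ∃ C ≥ (0:ℝ), ∀ ε, 0 ≤ ε → ε ≤ 1 → |F ε - F 0| ≤ C * ε := by
  obtain ⟨C, hC⟩ := isCompact_Icc.exists_bound_of_continuousOn (s := Set.Icc (0:ℝ) 1) (hF.continuous_deriv le_rfl).continuousOn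
  refine ⟨max C 0, le_max_right _ _, fun ε h0 h1 => ?_⟩
  have := (convex_Icc (0:ℝ) 1).norm_image_sub_le_of_norm_deriv_le (f := F) (C := max C 0) (x := 0) (y := ε)
    (fun x _ => hF.differentiable (by norm_num) x) (fun x hx => (hC x hx).trans (le_max_left _ _)) ⟨le_rfl, zero_le_one⟩ ⟨h0, h1⟩
  rw [nA, nA, sub_zero, abs_of_nonneg h0] at this
  exact this

lemma pow_thr (N : ℕ) (h0 : 0 ≤ ε) (h1 : ε ≤ 1) : (1 + ε) ^ N ≤ 1 + 3 ^ N * ε := by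
  induction N with
  | zero => simp; exact h0
  | succ N ih =>
    rw [pow_succ, pow_succ]
    have h3 : (1:ℝ) ≤ 3 ^ N := oP (by norm_num)
    have : 0 ≤ 1 + ε := by linarith
    refine (mR ih this).trans ?_
    nlinarith [mul_nonneg h0 h0, mul_nonneg (mul_nonneg h0 (sub_nonneg.mpr h1)) (by linarith : (0:ℝ) ≤ 3 ^ N), mul_nonneg h0 (sub_nonneg.mpr h3)]

lemma interp (F : ℝ → ℝ) (hF : Monotone F) (m e : ℕ) (hm : 1 ≤ m) (x : ℝ) (hx : 0 ≤ x) (hxm : x ≤ m) (Q c1 c2 : ℝ) (hQ : 0 ≤ Q) (hc1 : 0 ≤ c1) (hc2 : 0 ≤ c2) (J1 : ℕ)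
    (hU : ∀ J ≥ J1, F ((J:ℝ)^m) ≤ ((J:ℝ)^m)^e * (Q + c1 * (J:ℝ)⁻¹))
    (hL : ∀ J ≥ J1, ((J:ℝ)^m)^e * (Q - c2 * (J:ℝ)⁻¹) ≤ F ((1 + x * (J:ℝ)⁻¹) * (J:ℝ)^m)) :
    ∃ C > (0:ℝ), ∃ T0 > (1:ℝ), ∀ T > T0, |F T - Q * T ^ e| ≤ C * (T ^ e * (T ^ ((m:ℝ)⁻¹))⁻¹) := by
  obtain ⟨CU, hCU⟩ : ∃ CU : ℝ, CU = 2 ^ (m*e) * c1 + 3 ^ (m*e) * Q := ⟨_, rfl⟩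
  obtain ⟨CL, hCL⟩ : ∃ CL : ℝ, CL = 2 * c2 + 2 * (m*e:ℕ) * Q := ⟨_, rfl⟩
  have hCU0 : 0 ≤ CU := by rw [hCU]; positivity
  have hCL0 : 0 ≤ CL := by rw [hCL]; positivity
  refine ⟨2 * (CU + CL) + 1, by positivity, ((J1 + 2 : ℕ):ℝ)^m + 1, by have : 0 < ((J1 + 2 : ℕ):ℝ)^m := by positivity
                                                                       linarith, ?_⟩
  intro T hT
  have hp0 : 0 < ((J1 + 2 : ℕ):ℝ)^m := by positivity
  have hT0 : 0 < T := by linarith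
  obtain ⟨t, ht⟩ : ∃ t : ℝ, t = T ^ ((m:ℝ)⁻¹) := ⟨_, rfl⟩
  rw [← ht]
  have ht0 : 0 < t := by rw [ht]; positivity
  have htm : t ^ m = T := by rw [ht]; exact Real.rpow_inv_natCast_pow hT0.le (by omega)
  have htJ : ((J1 + 2 : ℕ):ℝ) ≤ t := by
    by_contra hlt
    push Not at hlt
    have := pL ht0.le hlt.le m
    linarith
  obtain ⟨J, hJ⟩ : ∃ J : ℕ, J = ⌊t⌋₊ := ⟨_, rfl⟩
  have hJt : (J:ℝ) ≤ t := by rw [hJ]; exact Nat.floor_le ht0.le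
  have hJt' : t < J + 1 := by rw [hJ]; exact Nat.lt_floor_add_one t
  have hJJ : J1 + 2 ≤ J := by rw [hJ]; exact Nat.le_floor htJ
  have hJ2 : (2:ℝ) ≤ J := by exact_mod_cast (by omega : 2 ≤ J)
  have hJ0 : (0:ℝ) < J := by linarith
  obtain ⟨ε, hε⟩ : ∃ ε : ℝ, ε = (J:ℝ)⁻¹ := ⟨_, rfl⟩
  have hε0 : 0 < ε := by rw [hε]; positivity
  have hε1 : ε ≤ 1 := by rw [hε]; exact iL (by linarith)
  have hJε : J * ε = 1 := by rw [hε]; exact mul_inv_cancel₀ hJ0.ne'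
  have hTe : 0 < T ^ e := by positivity
  have hεt : ε ≤ 2 * t⁻¹ := by
    rw [hε, ← dI, lD ht0, inv_mul_le_iff₀ hJ0]; linarith
  have U : F T ≤ T ^ e * (Q + CU * ε) := by
    have h1 : T ≤ ((J + 1 : ℕ):ℝ)^m := by
      rw [← htm]; push_cast; exact pL ht0.le hJt'.le m
    have h2 := (hF h1).trans (hU (J+1) (by omega))
    have h3 : (((J + 1 : ℕ):ℝ)^m)^e ≤ T ^ e * (1 + ε) ^ (m*e) := by
      rw [pow_mul, ← mul_pow, ← htm, ← mul_pow]
      gcongr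
      push_cast
      calc (J:ℝ) + 1 = J * (1 + ε) := by rw [mul_add, hJε, mul_one]
        _ ≤ t * (1 + ε) := by gcongr
    have h4 : (((J + 1 : ℕ):ℝ))⁻¹ ≤ ε := by rw [hε]; gcongr; push_cast; linarith
    have h5 : Q + c1 * (((J + 1 : ℕ):ℝ))⁻¹ ≤ Q + c1 * ε := by gcongr
    have h6 : (1 + ε) ^ (m*e) ≤ 2 ^ (m*e) := by gcongr; linarith
    have h7 := pow_thr (m*e) hε0.le hε1
    calc F T ≤ _ := h2
      _ ≤ T ^ e * (1 + ε) ^ (m*e) * (Q + c1 * ε) := by gcongr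
      _ = T ^ e * ((1 + ε) ^ (m*e) * Q + (1 + ε) ^ (m*e) * (c1 * ε)) := by ring
      _ ≤ T ^ e * ((1 + 3 ^ (m*e) * ε) * Q + 2 ^ (m*e) * (c1 * ε)) := by gcongr
      _ = _ := by rw [hCU]; ring
  have Lo : T ^ e * (Q - CL * ε) ≤ F T := by
    obtain ⟨I, hI⟩ : ∃ I : ℕ, J = I + 1 := ⟨J - 1, by omega⟩
    have hIJ : (J:ℝ) = I + 1 := by exact_mod_cast hI
    have hI1 : (1:ℝ) ≤ I := by linarith
    have hI0 : (0:ℝ) < I := by linarith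
    have h1 : (1 + x * (I:ℝ)⁻¹) * (I:ℝ)^m ≤ T := by
      have hb : 1 + (m:ℝ) * (I:ℝ)⁻¹ ≤ (1 + (I:ℝ)⁻¹) ^ m := one_add_mul_le_pow (by have : 0 < (I:ℝ)⁻¹ := by positivity
                                                                                  linarith) m
      calc _ ≤ (1 + m * (I:ℝ)⁻¹) * (I:ℝ)^m := by gcongr
        _ ≤ (1 + (I:ℝ)⁻¹) ^ m * (I:ℝ)^m := by gcongr
        _ = (J:ℝ) ^ m := by rw [← mul_pow, hIJ]; congr 1; field_simp
        _ ≤ T := by rw [← htm]; gcongr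
    refine le_trans ?_ ((hL I (by omega)).trans (hF h1))
    have h2 : T ^ e * (1 - 2 * ε) ^ (m*e) ≤ ((I:ℝ)^m)^e := by
      rw [pow_mul, ← mul_pow, ← htm, ← mul_pow]
      have hε2 : ε ≤ 1/2 := by rw [hε, inv_le_comm₀ hJ0 (by norm_num)]; norm_num; exact_mod_cast hJ2
      have h2' : 0 ≤ 1 - 2 * ε := by linarith
      gcongr
      calc t * (1 - 2 * ε) ≤ (J + 1) * (1 - 2 * ε) := by gcongr
        _ = J - 2 * (J * ε) + 1 - 2 * ε := by ring
        _ ≤ I := by rw [hJε, hIJ]; linarith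
    have h3 : 1 - 2 * (m*e:ℕ) * ε ≤ (1 - 2 * ε) ^ (m*e) := by
      have := one_add_mul_le_pow (show (-2:ℝ) ≤ -2 * ε by linarith) (m*e)
      calc _ = 1 + (m*e:ℕ) * (-2 * ε) := by ring
        _ ≤ _ := this
        _ = _ := by ring
    have h4 : (I:ℝ)⁻¹ ≤ 2 * ε := by
      rw [hε, ← dI, lD hJ0, inv_mul_le_iff₀ hI0]; linarith
    have h5 : ((I:ℝ)^m)^e ≤ T ^ e := by
      gcongr
      rw [← htm]; gcongr; linarith
    have h6 : T ^ e * (1 - 2 * (m*e:ℕ) * ε) * Q ≤ ((I:ℝ)^m)^e * Q := by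
      gcongr
      exact (mL h3 hTe.le).trans h2
    have h7 : ((I:ℝ)^m)^e * (c2 * (I:ℝ)⁻¹) ≤ T ^ e * (c2 * (2 * ε)) := by gcongr
    calc _ = T ^ e * (1 - 2 * (m*e:ℕ) * ε) * Q - T ^ e * (c2 * (2 * ε)) := by rw [hCL]; ring
      _ ≤ ((I:ℝ)^m)^e * Q - ((I:ℝ)^m)^e * (c2 * (I:ℝ)⁻¹) := by linarith
      _ = _ := by ring
  have hf : (CU + CL) * ε ≤ (2 * (CU + CL) + 1) * t⁻¹ := by
    have : 0 < t⁻¹ := by positivity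
    calc _ ≤ (CU + CL) * (2 * t⁻¹) := by gcongr
      _ ≤ _ := by nlinarith
  have hf2 := mL hf hTe.le
  have h8 : 0 ≤ T ^ e * (CU * ε) := by positivity
  have h9 : 0 ≤ T ^ e * (CL * ε) := by positivity
  rw [abs_le]
  constructor <;> nlinarith

lemma main_det (k m e : ℕ) (hd : fC (Pairs (k+2)) + 1 < 2*n) (he : 2*n * (k+2) = e + 2 * fC (Pairs (k+2))) (hm : 2*(2*n) + 3 ≤ m)
    (L : Set (Fin (2*n) → ℤ)) {κ : ℝ} (hκ : 0 ≤ κ) (hκ1 : κ ≤ 1) (a b : Pairs (k+2) → ℝ) (g : SL2n n) (J0 : ℕ) (hJ0 : 1 ≤ J0) (hJab : ∀ p, 2 * (J0:ℝ)⁻¹ ≤ b p - a p)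
    (h1 : ∃ J1 ≥ J0, ∀ J ≥ J1, DV n (k+2) L κ m J (fun p => a p - (J:ℝ)⁻¹) (fun p => b p + (J:ℝ)⁻¹) g ≤ ((J:ℝ)^m)^e * (J:ℝ)⁻¹)
    (h2 : ∃ J1 ≥ J0, ∀ J ≥ J1, DV n (k+2) L κ m J (fun p => a p + (J:ℝ)⁻¹) (fun p => b p - (J:ℝ)⁻¹) g ≤ ((J:ℝ)^m)^e * (J:ℝ)⁻¹) :
    ∃ C > (0:ℝ), ∃ T0 > (1:ℝ), ∀ T > T0, |cnt (Ag n g) L a b T - (κ ^ (k+2) * (∏ p, (b p - a p)) * cA (k+2) (Ag n g)) * T ^ e| ≤ C * (T ^ e * (T ^ ((m:ℝ)⁻¹))⁻¹) := by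
  obtain ⟨c, hc, hlow⟩ := Ag_low n g
  have hsk := Ag_skew n g
  obtain ⟨hcA, hcE⟩ := cA_props k e hd he hc hsk hlow
  unfold DV at h1 h2
  generalize Ag n g = A at *
  obtain ⟨J1, hJ1, h1⟩ := h1
  obtain ⟨J2, hJ2, h2⟩ := h2
  obtain ⟨M, hM⟩ : ∃ M : ℝ, M = ∑ p, (|a p| + |b p|) + 1 := ⟨_, rfl⟩
  have hM0 : 0 ≤ M := by rw [hM]; positivity
  have hMp : ∀ p, |a p| + |b p| + 1 ≤ M := by
    intro p; rw [hM]
    have := Finset.single_le_sum (f := fun p => |a p| + |b p|) (fun p _ => by positivity) (Finset.mem_univ p)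
    linarith
  obtain ⟨CV, hCV, hV⟩ := V_asym (d := 2*n) k hd hc hM0
  have hV := hV A hsk hlow
  obtain ⟨c1, hc1, hG1⟩ := lip_zero (fun ε => κ ^ (k+2) * (∏ p, (b p - a p + 2 * ε)) * ((1 + 2 * (2*n:ℕ) * ε) ^ e * cA (k+2) A)) (by fun_prop)
  obtain ⟨c2, hc2, hG2⟩ := lip_zero (fun ε => κ ^ (k+2) * (∏ p, (b p - a p - 2 * ε)) * cA (k+2) A) (by fun_prop)
  simp only [mul_zero, add_zero, one_pow, one_mul, sub_zero] at hG1 hG2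
  have hJ00 : (0:ℝ) < J0 := by exact_mod_cast hJ0
  have hP0 : ∀ p, 0 < b p - a p := fun p => lt_of_lt_of_le pz (hJab p)
  have hP : 0 ≤ ∏ p, (b p - a p) := Finset.prod_nonneg fun p _ => (hP0 p).le
  have hκK : κ ^ (k+2) ≤ 1 := pow_le_one₀ hκ hκ1
  have hκK0 : 0 ≤ κ ^ (k+2) := by positivity
  have common : ∀ J ≥ J0, (1:ℝ) ≤ J ∧ (0:ℝ) < (J:ℝ)⁻¹ ∧ (J:ℝ)⁻¹ ≤ 1 ∧ (1:ℝ) ≤ (J:ℝ)^m ∧ (J:ℝ)⁻¹⁻¹ ^ (2*n) * (((J:ℝ)^m)^2)⁻¹ ≤ (J:ℝ)⁻¹ ∧ ∀ p, 2 * (J:ℝ)⁻¹ ≤ b p - a p := by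
    intro J hJ
    have hJ1 : (1:ℝ) ≤ J := by exact_mod_cast hJ0.trans hJ
    have hJ00 : (0:ℝ) < J := by linarith
    refine ⟨hJ1, by positivity, iL hJ1, oP hJ1, ?_, fun p => le_trans ?_ (hJab p)⟩
    · rw [inv_inv, ← pow_mul, ← dI, div_le_iff₀ pz, ← div_eq_inv_mul, lD hJ00, ← pow_succ]
      exact pow_le_pow_right₀ hJ1 (by omega)
    · have : (0:ℝ) < J0 := by exact_mod_cast hJ0
      have : (J0:ℝ) ≤ J := by exact_mod_cast hJ
      gcongr
  have hUp : ∀ J ≥ max J1 J2, cnt A L a b ((J:ℝ)^m) ≤ ((J:ℝ)^m)^e * (κ ^ (k+2) * (∏ p, (b p - a p)) * cA (k+2) A + (c1 + CV + 1) * (J:ℝ)⁻¹) := by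
    intro J hJ
    obtain ⟨g1, g2, g3, g4, g5, g6⟩ := common J (by have := le_max_left J1 J2; omega)
    have d1 := h1 J (le_trans (le_max_left _ _) hJ)
    have d2 := (cnt_up A L a b g2 g4)
    have d3 := hV (J:ℝ)⁻¹ g2 g3 (J:ℝ)⁻¹ g2 g3 κ hκ hκ1 ((J:ℝ)^m) g4 (fun p => a p - (J:ℝ)⁻¹) (fun p => b p + (J:ℝ)⁻¹) (fun p => by linarith [hP0 p])
      (fun p => by have := hMp p; have := abs_sub (a p) (J:ℝ)⁻¹; rw [aP g2] at this; linarith [abs_nonneg (b p)])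
      (fun p => by have := hMp p; have := abs_add_le (b p) (J:ℝ)⁻¹; rw [aP g2] at this; linarith [abs_nonneg (a p)])
    rw [mul_pow, mul_assoc (κ ^ (k+2)), pow_e he (by linarith)] at d3
    have d4 := hG1 _ g2.le g3
    have d5 := (hcE _ g2 g3).2
    generalize (J:ℝ)⁻¹ = ε at *
    generalize (J:ℝ)^m = T at *
    have hTe : 0 < T ^ e := by positivity
    have e1 : ∀ p, b p + ε - (a p - ε) = b p - a p + 2 * ε := fun p => by ring
    simp only [e1] at d3
    have hPp : 0 ≤ ∏ p, (b p - a p + 2 * ε) := Finset.prod_nonneg fun p _ => by linarith [hP0 p]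
    have d6 := (abs_le.mp d4).2
    have d7 : κ ^ (k+2) * T ^ e * ((∏ p, (b p - a p + 2 * ε)) * cE (k+2) A ε) ≤ T ^ e * (κ ^ (k+2) * (∏ p, (b p - a p)) * cA (k+2) A + c1 * ε) := by
      calc _ = T ^ e * (κ ^ (k+2) * (∏ p, (b p - a p + 2 * ε)) * cE (k+2) A ε) := by ring
        _ ≤ T ^ e * (κ ^ (k+2) * (∏ p, (b p - a p + 2 * ε)) * ((1 + 2 * (2*n:ℕ) * ε) ^ e * cA (k+2) A)) := by gcongr
        _ ≤ _ := by gcongr; linarith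
    have d8 : κ ^ (k+2) * T ^ e * (CV * ε⁻¹ ^ (2*n) * (T ^ 2)⁻¹) ≤ T ^ e * (CV * ε) := by
      calc _ = κ ^ (k+2) * (T ^ e * (CV * (ε⁻¹ ^ (2*n) * (T ^ 2)⁻¹))) := by ring
        _ ≤ 1 * (T ^ e * (CV * ε)) := by gcongr
        _ = _ := one_mul _
    have d9 := (abs_le.mp d1).2
    have d10 := (abs_le.mp d3).2
    calc _ ≤ _ := d2
      _ ≤ T ^ e * (κ ^ (k+2) * (∏ p, (b p - a p)) * cA (k+2) A + c1 * ε) + T ^ e * (CV * ε) + T ^ e * ε := by linarith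
      _ = _ := by ring
  have hLo : ∀ J ≥ max J1 J2, ((J:ℝ)^m)^e * (κ ^ (k+2) * (∏ p, (b p - a p)) * cA (k+2) A - (c2 + CV + 1) * (J:ℝ)⁻¹) ≤ cnt A L a b ((1 + (2 * (2*n:ℕ)) * (J:ℝ)⁻¹) * (J:ℝ)^m) := by
    intro J hJ
    obtain ⟨g1, g2, g3, g4, g5, g6⟩ := common J (by have := le_max_left J1 J2; omega)
    have d1 := h2 J (le_trans (le_max_right _ _) hJ)
    have d2 := (cnt_down A L a b g2 g4)
    have d3 := hV (J:ℝ)⁻¹ g2 g3 (J:ℝ)⁻¹ g2 g3 κ hκ hκ1 ((J:ℝ)^m) g4 (fun p => a p + (J:ℝ)⁻¹) (fun p => b p - (J:ℝ)⁻¹) (fun p => by linarith [g6 p])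
      (fun p => by have := hMp p; have := abs_add_le (a p) (J:ℝ)⁻¹; rw [aP g2] at this; linarith [abs_nonneg (b p)])
      (fun p => by have := hMp p; have := abs_sub (b p) (J:ℝ)⁻¹; rw [aP g2] at this; linarith [abs_nonneg (a p)])
    rw [mul_pow, mul_assoc (κ ^ (k+2)), pow_e he (by linarith)] at d3
    have d4 := hG2 _ g2.le g3
    have d5 := (hcE _ g2 g3).1
    generalize (J:ℝ)⁻¹ = ε at *
    generalize (J:ℝ)^m = T at *
    have hTe : 0 < T ^ e := by positivity
    have e1 : ∀ p, b p - ε - (a p + ε) = b p - a p - 2 * ε := fun p => by ring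
    simp only [e1] at d3
    have hPp : 0 ≤ ∏ p, (b p - a p - 2 * ε) := Finset.prod_nonneg fun p _ => by linarith [g6 p]
    have d6 := (abs_le.mp d4).1
    have d7 : T ^ e * (κ ^ (k+2) * (∏ p, (b p - a p)) * cA (k+2) A - c2 * ε) ≤ κ ^ (k+2) * T ^ e * ((∏ p, (b p - a p - 2 * ε)) * cE (k+2) A ε) := by
      calc _ ≤ T ^ e * (κ ^ (k+2) * (∏ p, (b p - a p - 2 * ε)) * cA (k+2) A) := by gcongr; linarith
        _ ≤ T ^ e * (κ ^ (k+2) * (∏ p, (b p - a p - 2 * ε)) * cE (k+2) A ε) := by gcongr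
        _ = _ := by ring
    have d8 : κ ^ (k+2) * T ^ e * (CV * ε⁻¹ ^ (2*n) * (T ^ 2)⁻¹) ≤ T ^ e * (CV * ε) := by
      calc _ = κ ^ (k+2) * (T ^ e * (CV * (ε⁻¹ ^ (2*n) * (T ^ 2)⁻¹))) := by ring
        _ ≤ 1 * (T ^ e * (CV * ε)) := by gcongr
        _ = _ := one_mul _
    have d9 := (abs_le.mp d1).1
    have d10 := (abs_le.mp d3).1
    refine le_trans ?_ d2
    calc _ = T ^ e * (κ ^ (k+2) * (∏ p, (b p - a p)) * cA (k+2) A - c2 * ε) - T ^ e * (CV * ε) - T ^ e * ε := by ring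
      _ ≤ _ := by linarith
  refine interp (fun T => cnt A L a b T) (fun T T' h => cnt_mono A L a b h) m e (by omega) (2 * (2*n:ℕ)) pz (by exact_mod_cast (by omega : 2 * (2*n) ≤ m)) _ (c1 + CV + 1) (c2 + CV + 1) pz pz pz (max J1 J2) hUp hLo

lemma main_ae (k m e : ℕ) (hd : fC (Pairs (k+2)) + 1 < 2*n) (he : 2*n * (k+2) = e + 2 * fC (Pairs (k+2))) (hm : m = 2*(2*n) + 4 * fC (Pairs (k+2)) + 3) (he' : 2*n*(k+1)+6 ≤ e)
    (L : Set (Fin (2*n) → ℤ)) {κ : ℝ} (hκ : 0 ≤ κ) (hκ1 : κ ≤ 1) (hD : Dprop n L κ) (a b : Pairs (k+2) → ℝ) (hab : ∀ p, a p < b p) (μ : Measure (SL2n n)) (hμ : μ.IsHaarMeasure) :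
    ∀ᵐ g ∂μ, ∃ C > (0:ℝ), ∃ T0 > (1:ℝ), ∀ T > T0, |cnt (Ag n g) L a b T - (κ ^ (k+2) * (∏ p, (b p - a p)) * cA (k+2) (Ag n g)) * T ^ e| ≤ C * (T ^ e * (T ^ ((m:ℝ)⁻¹))⁻¹) := by
  have hlim : Filter.Tendsto (fun J : ℕ => 2 * (J:ℝ)⁻¹) Filter.atTop (nhds (2 * 0)) := (tendsto_inv_atTop_nhds_zero_nat).const_mul 2
  rw [mul_zero] at hlim
  have hev : ∀ᶠ J : ℕ in Filter.atTop, ∀ p, 2 * (J:ℝ)⁻¹ ≤ b p - a p := by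
    rw [Filter.eventually_all]
    intro p
    exact (hlim.eventually (gt_mem_nhds (sub_pos.mpr (hab p)))).mono fun J hJ => hJ.le
  obtain ⟨J0, hJ0⟩ := Filter.eventually_atTop.mp (hev.and (Filter.eventually_ge_atTop 1))
  have hJ01 := (hJ0 J0 le_rfl).2
  obtain ⟨B, hB⟩ : ∃ B : ℝ, B = ∑ p, (b p - a p) + 2 := ⟨_, rfl⟩
  have hB0 : 0 ≤ B := by
    rw [hB]; have := Finset.sum_nonneg (fun p (_ : p ∈ Finset.univ) => (sub_pos.mpr (hab p)).le); linarith
  have hBp : ∀ p, b p - a p + 2 ≤ B := by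
    intro p; rw [hB]
    have := Finset.single_le_sum (f := fun p => b p - a p) (fun p _ => (sub_pos.mpr (hab p)).le) (Finset.mem_univ p)
    linarith
  have hinv : ∀ J ≥ J0, (0:ℝ) ≤ (J:ℝ)⁻¹ ∧ (J:ℝ)⁻¹ ≤ 1 := fun J hJ => ⟨by positivity, iL (by exact_mod_cast hJ01.trans hJ)⟩
  have b1 := BC (k := k+1) L hκ hκ1 hD μ B hB0 m e hm he' J0 hJ01 (fun J p => a p - (J:ℝ)⁻¹) (fun J p => b p + (J:ℝ)⁻¹)
    (fun J hJ p => by linarith [hab p, (hinv J hJ).1]) (fun J hJ p => by linarith [hBp p, (hinv J hJ).2])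
  have b2 := BC (k := k+1) L hκ hκ1 hD μ B hB0 m e hm he' J0 hJ01 (fun J p => a p + (J:ℝ)⁻¹) (fun J p => b p - (J:ℝ)⁻¹)
    (fun J hJ p => by linarith [(hJ0 J hJ).1 p]) (fun J hJ p => by linarith [hBp p, (hinv J hJ).1])
  filter_upwards [b1, b2] with g h1 h2
  exact main_det k m e hd he (by omega) L hκ hκ1 a b g J0 hJ01 (hJ0 J0 le_rfl).1 h1 h2

lemma fin_conv {N : ℝ → ℝ} {M M' E δ : ℝ} {m e : ℕ} (hm : 0 < m) (he : 0 < e) (hE : E = e) (hM : M = M') (hδ : 1 - 1 / ((m:ℝ) * e) < δ)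
    (h : ∃ C > (0:ℝ), ∃ T0 > (1:ℝ), ∀ T > T0, |N T - M * T ^ e| ≤ C * (T ^ e * (T ^ ((m:ℝ)⁻¹))⁻¹)) :
    ∃ C > (0:ℝ), ∃ T0 > (0:ℝ), ∀ T > T0, |N T - M' * T ^ E| ≤ C * T ^ (δ * E) := by
  obtain ⟨C, hC, T0, hT0, h⟩ := h
  refine ⟨C, hC, T0, by linarith, fun T hT => ?_⟩
  subst hE hM
  rw [Real.rpow_natCast]
  refine (h T hT).trans ?_
  have hT1 : (1:ℝ) < T := lt_trans hT0 hT
  have hm' : (0:ℝ) < m := by exact_mod_cast hm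
  have he' : (0:ℝ) < e := by exact_mod_cast he
  rw [← Real.rpow_natCast, ← Real.rpow_neg (by linarith), ← Real.rpow_add (by linarith)]
  refine mL (Real.rpow_le_rpow_of_exponent_le hT1.le ?_) hC.le
  have : (1 - 1 / ((m:ℝ) * e)) * e ≤ δ * e := by gcongr
  refine le_trans (le_of_eq ?_) this
  field_simp
  ring

/-- Theorem 1.4 (primitive generic counting): with `δ₀` and the constant `c_g` as in the
non-primitive generic counting theorem (formalized by requiring both asymptotics to hold
simultaneously with the same `δ₀` and `c_g`), for Haar-almost every `g`,
`N̂_{g,I}(T) = (c_g/ζ(2n)^k) ∏(b_{ij}-a_{ij}) T^{2nk-k(k-1)} + O(T^{δ(2nk-k(k-1))})`. -/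
theorem stmt4 (n k : ℕ) (hk : 2 ≤ k) (hnk : k^2 + 3 ≤ 2*n) :
    ∃ δ0 ∈ Set.Ioo (0:ℝ) 1, ∃ c : SL2n n → ℝ,
      ∀ δ ∈ Set.Ioo δ0 (1:ℝ), ∀ a b : Pairs k → ℝ, (∀ p, a p < b p) →
        ∀ μ : Measure (SL2n n), μ.IsHaarMeasure →
          ∀ᵐ g ∂μ, 0 < c g ∧
            (∃ C > (0:ℝ), ∃ T0 > (0:ℝ), ∀ T > T0,
              |(Ncount n k g a b T : ℝ)
                - c g * (∏ p : Pairs k, (b p - a p)) * T ^ expo n k|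
                ≤ C * T ^ (δ * expo n k)) ∧
            (∃ C > (0:ℝ), ∃ T0 > (0:ℝ), ∀ T > T0,
              |(NcountPrim n k g a b T : ℝ)
                - (c g / zetaval (2*n) ^ k) * (∏ p : Pairs k, (b p - a p)) * T ^ expo n k|
                ≤ C * T ^ (δ * expo n k)) := by
  obtain ⟨k, rfl⟩ : ∃ k', k = k' + 2 := ⟨k - 2, by omega⟩
  have h2c := two_card (k+2)
  have h2c' : 2 * fC (Pairs (k+2)) = (k+2) * (k+1) := h2c
  have hsq : k * k + 4 * k + 7 ≤ 2 * n := by nlinarith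
  have hcd : 2 * fC (Pairs (k+2)) = k * k + 3 * k + 2 := by rw [h2c']; ring
  have hn : 0 < n := by omega
  have hd : fC (Pairs (k+2)) + 1 < 2*n := by omega
  have hpar : k * k + 3 * k + 8 ≤ 2 * n := by
    rcases Nat.eq_zero_or_pos k with h | h
    · subst h; omega
    · omega
  obtain ⟨e, hee⟩ : ∃ e, e = 2*n * (k+2) - 2 * fC (Pairs (k+2)) := ⟨_, rfl⟩
  have hx : 2*n*(k+2) = 2*n*(k+1) + 2*n := by ring
  have he : 2*n * (k+2) = e + 2 * fC (Pairs (k+2)) := by omega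
  have he' : 2*n*(k+1)+6 ≤ e := by omega
  obtain ⟨m, hm⟩ : ∃ m, m = 2*(2*n) + 4 * fC (Pairs (k+2)) + 3 := ⟨_, rfl⟩
  have hexpo : expo n (k+2) = (e:ℝ) := by
    unfold expo
    rw [← h2c, he]
    push_cast; ring
  have hm3 : (3:ℝ) ≤ m := by exact_mod_cast (by omega : 3 ≤ m)
  have he6 : (6:ℝ) ≤ e := by exact_mod_cast (by omega : 6 ≤ e)
  obtain ⟨_, hz0, hz1⟩ := zeta_moeb (d := 2*n) (by omega)
  have hme : 1 < (m:ℝ) * e := by nlinarith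
  refine ⟨1 - 1 / ((m:ℝ) * e), ⟨?_, ?_⟩, fun g => cA (k+2) (Ag n g), ?_⟩
  · rw [sub_pos, div_lt_one (by linarith)]; exact hme
  · have : 0 < 1 / ((m:ℝ) * e) := by positivity
    linarith
  intro δ hδ a b hab μ hμ
  have r1 := main_ae k m e hd he hm he' Set.univ zero_le_one le_rfl (Dprop_univ hn) a b hab μ hμ
  have r2 := main_ae k m e hd he hm he' {v | IsPrimitiveVec v} (inv_nonneg.mpr hz0.le) (iL hz1) (Dprop_prim hn) a b hab μ hμ
  filter_upwards [r1, r2] with g h1 h2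
  refine ⟨?_, ?_, ?_⟩
  · obtain ⟨c, hc, hlow⟩ := Ag_low n g
    exact (cA_props k e hd he hc (Ag_skew n g) hlow).1
  · refine fin_conv (N := fun T => (Ncount n (k+2) g a b T : ℝ)) (m := m) (e := e) (by omega) (by omega) hexpo ?_ hδ.1 (M := 1 ^ (k+2) * (∏ p, (b p - a p)) * cA (k+2) (Ag n g)) ?_
    · rw [one_pow]; ring
    · have : ∀ T, (Ncount n (k+2) g a b T : ℝ) = cnt (Ag n g) Set.univ a b T := by
        intro T
        rw [cnt_eq]
        simp only [Set.mem_univ, implies_true, true_and]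
        rfl
      simp only [this]
      exact h1
  · refine fin_conv (N := fun T => (NcountPrim n (k+2) g a b T : ℝ)) (m := m) (e := e) (by omega) (by omega) hexpo ?_ hδ.1 (M := (zetaval (2*n))⁻¹ ^ (k+2) * (∏ p, (b p - a p)) * cA (k+2) (Ag n g)) ?_
    · rw [inv_pow, dI]; ring
    · have : ∀ T, (NcountPrim n (k+2) g a b T : ℝ) = cnt (Ag n g) {v | IsPrimitiveVec v} a b T := by
        intro T
        rw [cnt_eq]
        rfl
      simp only [this]
      exact h2
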